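/- For every μ ∈ [0.1, 0.5] and every Jacobi energy c with c₁(μ) ≤ c ≤ 2.1, there exists a symmetric T-periodic orbit x(t) = (q(t),p(t)) of the Jacobi Hamiltonian H on the level set H^{−1}(−c) which is direct, i.e. (q₁(t)+μ)p₂(t) − q₂(t)p₁(t) < μ(q₁(t)+μ) for all t, which crosses the q₁-axis exactly twice per period, i.e. #{t ∈ [0,T) : q₂(t) = 0} = 2, and which is transversely non-degenerate. -/

import Mathlib

open Matrix Set

noncomputable section

/-- Phase space ℝ⁴. -/
abbrev V4 := Fin 4 → ℝ

/-- 2×2 real matrices. -/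
abbrev M2 := Matrix (Fin 2) (Fin 2) ℝ

/-- Euclidean norm on ℝ⁴. -/
def enorm4 (v : V4) : ℝ := Real.sqrt (∑ i, (v i)^2)

/-- The gradient of `H : ℝ⁴ → ℝ` with respect to the standard Euclidean structure. -/
def gradient4 (H : V4 → ℝ) (x : V4) : V4 := fun i => fderiv ℝ H x (Pi.single i (1:ℝ))

/-- The Hamiltonian vector field of `H` with respect to the symplectic form `dw ∧ dz`
in coordinates `(z₁, z₂, w₁, w₂)`:  ż = ∂H/∂w, ẇ = -∂H/∂z  (i.e. X_H = I₄∇H). -/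
def symplGrad (H : V4 → ℝ) (x : V4) : V4 :=
  ![fderiv ℝ H x (Pi.single (2:Fin 4) (1:ℝ)), fderiv ℝ H x (Pi.single (3:Fin 4) (1:ℝ)),
    -fderiv ℝ H x (Pi.single (0:Fin 4) (1:ℝ)), -fderiv ℝ H x (Pi.single (1:Fin 4) (1:ℝ))]

/-- `γ : ℝ → ℝ⁴` is a solution of Hamilton's equations for `H` staying in the domain `D`. -/
def IsOrbit (H : V4 → ℝ) (D : Set V4) (γ : ℝ → V4) : Prop :=
  ∀ t : ℝ, γ t ∈ D ∧ HasDerivAt γ (symplGrad H (γ t)) t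

/-- The Jacobi Hamiltonian of the planar restricted three-body problem, in coordinates
`(q₁, q₂, p₁, p₂)`:  H = ½|p|² + q₁p₂ - q₂p₁ - (1-μ)/|q-(-μ,0)| - μ/|q-(1-μ,0)|. -/
def JacobiH (μ : ℝ) (x : V4) : ℝ :=
  (1/2) * ((x 2)^2 + (x 3)^2) + x 0 * x 3 - x 1 * x 2
    - (1 - μ) / Real.sqrt ((x 0 + μ)^2 + (x 1)^2)
    - μ / Real.sqrt ((x 0 - (1 - μ))^2 + (x 1)^2)

/-- The domain of the Jacobi Hamiltonian: `q ∉ {(-μ,0), (1-μ,0)}`. -/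
def JacobiDom (μ : ℝ) : Set V4 :=
  {x | (x 0, x 1) ≠ (-μ, 0) ∧ (x 0, x 1) ≠ (1 - μ, 0)}

/-- The set of critical values of the Jacobi Hamiltonian. -/
def JacobiCritVals (μ : ℝ) : Set ℝ :=
  {v | ∃ x ∈ JacobiDom μ, fderiv ℝ (JacobiH μ) x = 0 ∧ JacobiH μ x = v}

/-- The first critical energy `c₁(μ) = -H(L₁)`, where `H(L₁)` is the smallest critical
value of the Jacobi Hamiltonian. -/
def firstCritEnergy (μ : ℝ) : ℝ := -sInf (JacobiCritVals μ)

/-- `|2z² - 1|` as a function of `(z₁, z₂)`, where `z = z₁ + i z₂`. -/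
def lcAbs (z1 z2 : ℝ) : ℝ := Real.sqrt ((2*(z1^2 - z2^2) - 1)^2 + (4*z1*z2)^2)

/-- The domain of the Levi-Civita Hamiltonian: `2z² ≠ 1`. -/
def LCDom : Set V4 := {x | lcAbs (x 0) (x 1) ≠ 0}

/-- The Levi-Civita Hamiltonian `K_{μ,c}` in coordinates `(z₁, z₂, w₁, w₂)`. -/
def Kham (μ c : ℝ) (x : V4) : ℝ :=
  (1/2) * ((x 2)^2 + (x 3)^2) + c * ((x 0)^2 + (x 1)^2) - (1 - μ)/2
    + 2 * ((x 0)^2 + (x 1)^2) * (x 0 * x 3 - x 1 * x 2)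
    - μ * (x 0 * x 3 + x 1 * x 2)
    - μ * ((x 0)^2 + (x 1)^2) / lcAbs (x 0) (x 1)

/-- `Σ_{μ,c}`: the connected component of `K_{μ,c}⁻¹(0)` containing the circle
`{(0,w) : |w|² = 1-μ}` (we use the point `(0,0,√(1-μ),0)` of that circle). -/
def SigmaLC (μ c : ℝ) : Set V4 :=
  connectedComponentIn {x : V4 | x ∈ LCDom ∧ Kham μ c x = 0} ![0, 0, Real.sqrt (1 - μ), 0]

/-- The anti-symplectic involution `R₊(z,w) = (z̄, -w̄)`. -/
def Rplus (x : V4) : V4 := ![x 0, -x 1, -x 2, x 3]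

/-- The anti-symplectic involution `R₋(z,w) = (-z̄, w̄)`. -/
def Rminus (x : V4) : V4 := ![-x 0, x 1, x 2, -x 3]

/-- A `T`-periodic orbit of the Levi-Civita Hamiltonian flow lying on `Σ_{μ,c}`. -/
def IsClosedOrbit (μ c T : ℝ) (γ : ℝ → V4) : Prop :=
  0 < T ∧ IsOrbit (Kham μ c) LCDom γ ∧ (∀ t, γ (t + T) = γ t) ∧ ∀ t, γ t ∈ SigmaLC μ c

/-- A `T`-periodic orbit is symmetric if, after a time shift, `γ(t) = R₊(γ(T-t))` for all `t`
or `γ(t) = R₋(γ(T-t))` for all `t`. -/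
def IsSymmetricOrbit (T : ℝ) (γ : ℝ → V4) : Prop :=
  ∃ s : ℝ, (∀ t, γ (s + t) = Rplus (γ (s + (T - t))))
         ∨ (∀ t, γ (s + t) = Rminus (γ (s + (T - t))))

/-- An orbit `(z(t),w(t))` is retrograde if `z₁w₂ - z₂w₁ > μ(z₁² - z₂²)` along it. -/
def IsRetrograde (μ : ℝ) (γ : ℝ → V4) : Prop :=
  ∀ t : ℝ, μ * ((γ t 0)^2 - (γ t 1)^2) < γ t 0 * γ t 3 - γ t 1 * γ t 2

/-- An orbit `(z(t),w(t))` is direct if `z₁w₂ - z₂w₁ < μ(z₁² - z₂²)` along it. -/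
def IsDirect (μ : ℝ) (γ : ℝ → V4) : Prop :=
  ∀ t : ℝ, γ t 0 * γ t 3 - γ t 1 * γ t 2 < μ * ((γ t 0)^2 - (γ t 1)^2)

/-- The crossing number of a `T`-periodic orbit: `#{t ∈ [0,T) : z₁(t) = 0 or z₂(t) = 0}`. -/
def crossingNumber (T : ℝ) (γ : ℝ → V4) : ℕ :=
  {t ∈ Set.Ico (0:ℝ) T | γ t 0 = 0 ∨ γ t 1 = 0}.ncard

/-- `γ'` is a reparametrization (time shift) of `γ`. -/
def IsTimeShift (γ γ' : ℝ → V4) : Prop := ∃ s : ℝ, ∀ t, γ' t = γ (t + s)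

/-- The action `𝒜(γ) = ∫₀ᵀ (w·ż - z·ẇ) dt` of a `T`-periodic Levi-Civita orbit. -/
def orbitAction (μ c T : ℝ) (γ : ℝ → V4) : ℝ :=
  ∫ t in (0:ℝ)..T,
    (γ t 2 * symplGrad (Kham μ c) (γ t) 0 + γ t 3 * symplGrad (Kham μ c) (γ t) 1
      - γ t 0 * symplGrad (Kham μ c) (γ t) 2 - γ t 1 * symplGrad (Kham μ c) (γ t) 3)

/-- Transverse non-degeneracy of a `T`-periodic orbit `γ` of `X_H` on a regular level set:
any `T`-periodic solution of the variational equation along `γ` starting tangent to the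
level set is a multiple of the Hamiltonian vector field. -/
def TransverseNondeg (H : V4 → ℝ) (T : ℝ) (γ : ℝ → V4) : Prop :=
  ∀ v : ℝ → V4,
    (∀ t : ℝ, HasDerivAt v (fderiv ℝ (symplGrad H) (γ t) (v t)) t) →
    v T = v 0 →
    fderiv ℝ H (γ 0) (v 0) = 0 →
    ∃ a : ℝ, v 0 = a • symplGrad H (γ 0)

/-- `T` is the minimal period of `γ`. -/
def IsMinimalPeriod (T : ℝ) (γ : ℝ → V4) : Prop :=
  0 < T ∧ (∀ t, γ (t + T) = γ t) ∧ ∀ T' : ℝ, 0 < T' → (∀ t, γ (t + T') = γ t) → T ≤ T'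

/-- The quaternionic matrix `I₄`. -/
def I4 : Matrix (Fin 4) (Fin 4) ℝ := !![0,0,1,0; 0,0,0,1; -1,0,0,0; 0,-1,0,0]

/-- The quaternionic matrix `J₄`. -/
def J4 : Matrix (Fin 4) (Fin 4) ℝ := !![0,1,0,0; -1,0,0,0; 0,0,0,-1; 0,0,1,0]

/-- The quaternionic matrix `K₄`. -/
def K4 : Matrix (Fin 4) (Fin 4) ℝ := !![0,0,0,-1; 0,0,1,0; 0,-1,0,0; 1,0,0,0]

/-- `Ω₂ = [[0,1],[-1,0]]`. -/
def Omega2 : M2 := !![0,1; -1,0]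

/-- `Ω₄ = -I₄`. -/
def Omega4 : Matrix (Fin 4) (Fin 4) ℝ := -I4

/-- The 4×2 frame matrix `F(x) = [U(x) V(x)]` with `U = J₄∇H/‖∇H‖`, `V = K₄∇H/‖∇H‖`. -/
def frameF (H : V4 → ℝ) (x : V4) : Matrix (Fin 4) (Fin 2) ℝ :=
  Matrix.of fun i j =>
    (if j = 0 then J4.mulVec (gradient4 H x) i else K4.mulVec (gradient4 H x) i)
      / enorm4 (gradient4 H x)

/-- `M` is the linearized flow `t ↦ dFl_t(γ(0))` along the orbit `γ` of `X_H`: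
`M(0) = id` and each column solves the variational equation. -/
def IsLinearizedFlow (H : V4 → ℝ) (γ : ℝ → V4) (M : ℝ → Matrix (Fin 4) (Fin 4) ℝ) : Prop :=
  M 0 = 1 ∧ ∀ j : Fin 4, ∀ t : ℝ,
    HasDerivAt (fun s => fun i => M s i j)
      (fderiv ℝ (symplGrad H) (γ t) (fun i => M t i j)) t

/-- The reduced monodromy path `Ψ(t) = Ω₂ᵀ F(γ(t))ᵀ Ω₄ M(t) F(γ(0))`. -/
def reducedMonodromy (H : V4 → ℝ) (γ : ℝ → V4)
    (M : ℝ → Matrix (Fin 4) (Fin 4) ℝ) (t : ℝ) : M2 :=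
  Omega2ᵀ * (frameF H (γ t))ᵀ * Omega4 * M t * frameF H (γ 0)

/-- The retraction `ρ(Ψ) = (ΨΨᵀ)^{-1/2}Ψ` of `SL(2,ℝ)` onto `SO(2)`, written explicitly. -/
def rho (Ψ : M2) : M2 :=
  (1 / Real.sqrt ((Ψ 0 0 + Ψ 1 1)^2 + (Ψ 0 1 - Ψ 1 0)^2)) •
    !![Ψ 0 0 + Ψ 1 1, Ψ 0 1 - Ψ 1 0; -(Ψ 0 1 - Ψ 1 0), Ψ 0 0 + Ψ 1 1]

/-- The rotation by angle `θ`. -/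
def rotMat (θ : ℝ) : M2 := !![Real.cos θ, -Real.sin θ; Real.sin θ, Real.cos θ]

/-- The Conley-Zehnder index of the path `ψ : [0,T] → SL(2,ℝ)` equals `k`: there is a
continuous angle `θ` with `θ(0) = 0` lifting `t ↦ ρ(ψ(t))`, and `k` is the even integer
closest to `θ(T)/π` if `tr ψ(T) > 2`, the odd integer closest to `θ(T)/π` if `tr ψ(T) < 2`. -/
def CZIndexIs (T : ℝ) (ψ : ℝ → M2) (k : ℤ) : Prop :=
  ∃ θ : ℝ → ℝ, ContinuousOn θ (Set.Icc 0 T) ∧ θ 0 = 0 ∧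
    (∀ t ∈ Set.Icc (0:ℝ) T, rho (ψ t) = rotMat (θ t)) ∧
    (((2:ℝ) < (ψ T).trace ∧ Even k) ∨ ((ψ T).trace < 2 ∧ Odd k)) ∧
    |θ T / Real.pi - (k:ℝ)| < 1

end

/-- A bounded vector field which is uniformly Lipschitz in space and continuous in time has global
solutions. -/
theorem exists_global_solution {E : Type*} [NormedAddCommGroup E] [NormedSpace ℝ E]
    [CompleteSpace E] (F : ℝ → E → E) (M K : NNReal) (hM : ∀ t x, ‖F t x‖ ≤ M)
    (hK : ∀ t, LipschitzWith K (F t)) (hc : ∀ x, Continuous fun t => F t x) (x₀ : E) :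
    ∃ α : ℝ → E, α 0 = x₀ ∧ ∀ t, HasDerivAt α (F t (α t)) t := by
  have key : ∀ n : ℕ, ∃ α : ℝ → E, α 0 = x₀ ∧
      ∀ t ∈ Ioo (-((n : ℝ) + 1)) ((n : ℝ) + 1), HasDerivAt α (F t (α t)) t := by
    intro n
    have h0 : (0 : ℝ) ∈ Icc (-((n : ℝ) + 1)) ((n : ℝ) + 1) := by
      constructor <;> linarith [n.cast_nonneg (α := ℝ)]
    have hP : IsPicardLindelof F (⟨0, h0⟩ : Icc (-((n : ℝ) + 1)) ((n : ℝ) + 1)) x₀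
        (M * ((n : NNReal) + 1)) 0 M K :=
      { lipschitzOnWith := fun t _ => (hK t).lipschitzOnWith
        continuousOn := fun x _ => (hc x).continuousOn
        norm_le := fun t _ x _ => hM t x
        mul_max_le := by simp }
    obtain ⟨α, h1, h2⟩ := hP.exists_eq_forall_mem_Icc_hasDerivWithinAt₀
    exact ⟨α, h1, fun t ht => (h2 t (Ioo_subset_Icc_self ht)).hasDerivAt
      (Icc_mem_nhds ht.1 ht.2)⟩
  choose α h0 hα using key
  have heq : ∀ (m n : ℕ), m ≤ n → EqOn (α m) (α n) (Ioo (-((m : ℝ) + 1)) ((m : ℝ) + 1)) := by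
    intro m n hmn
    have hmn' : (m : ℝ) ≤ n := by exact_mod_cast hmn
    refine ODE_solution_unique_of_mem_Ioo (v := F) (s := fun _ => univ) (K := K) (t₀ := 0)
      (fun t _ => (hK t).lipschitzOnWith) ?_ (fun t ht => ⟨hα m t ht, trivial⟩)
      (fun t ht => ⟨hα n t ⟨?_, ?_⟩, trivial⟩) (by rw [h0, h0])
    · constructor <;> linarith [m.cast_nonneg (α := ℝ)]
    · linarith [ht.1]
    · linarith [ht.2]
  refine ⟨fun t => α ⌈|t|⌉₊ t, by simp [h0], fun t => ?_⟩
  set n := ⌈|t|⌉₊ with hn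
  have hle : |t| ≤ n := Nat.le_ceil _
  have hmem : t ∈ Ioo (-((n : ℝ) + 1)) ((n : ℝ) + 1) := by
    constructor <;> linarith [abs_le.mp hle]
  refine (hα n t hmem).congr_of_eventuallyEq ?_
  filter_upwards [Ioo_mem_nhds hmem.1 hmem.2] with u hu
  have hu' : u ∈ Ioo (-((⌈|u|⌉₊ : ℝ) + 1)) ((⌈|u|⌉₊ : ℝ) + 1) := by
    have := Nat.le_ceil |u|
    constructor <;> linarith [abs_le.mp this]
  rcases le_total ⌈|u|⌉₊ n with h | h
  · exact heq _ _ h hu'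
  · exact (heq _ _ h hu).symm

/-- A time dependent function on the plane which is bounded, uniformly Lipschitz in space and
continuous in time. -/
noncomputable def BddLip (f : ℝ → ℝ × ℝ → ℝ) : Prop :=
  (∃ K : ℝ, 0 ≤ K ∧ ∀ θ x y, |f θ x| ≤ K ∧ |f θ x - f θ y| ≤ K * dist x y) ∧
    ∀ x, Continuous fun θ => f θ x

theorem BddLip.add {f g : ℝ → ℝ × ℝ → ℝ} (hf : BddLip f) (hg : BddLip g) :
    BddLip fun θ x => f θ x + g θ x := by
  obtain ⟨⟨K, hK0, hK⟩, hfc⟩ := hf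
  obtain ⟨⟨L, hL0, hL⟩, hgc⟩ := hg
  refine ⟨⟨K + L, by positivity, fun θ x y => ⟨?_, ?_⟩⟩, fun x => (hfc x).add (hgc x)⟩
  · exact (abs_add_le _ _).trans (add_le_add (hK θ x y).1 (hL θ x y).1)
  · have e : f θ x + g θ x - (f θ y + g θ y) = (f θ x - f θ y) + (g θ x - g θ y) := by ring
    rw [e, add_mul]
    exact (abs_add_le _ _).trans (add_le_add (hK θ x y).2 (hL θ x y).2)

theorem BddLip.mul {f g : ℝ → ℝ × ℝ → ℝ} (hf : BddLip f) (hg : BddLip g) :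
    BddLip fun θ x => f θ x * g θ x := by
  obtain ⟨⟨K, hK0, hK⟩, hfc⟩ := hf
  obtain ⟨⟨L, hL0, hL⟩, hgc⟩ := hg
  refine ⟨⟨K * L + K * L, by positivity, fun θ x y => ⟨?_, ?_⟩⟩, fun x => (hfc x).mul (hgc x)⟩
  · rw [abs_mul]
    have := mul_le_mul (hK θ x y).1 (hL θ x y).1 (abs_nonneg _) hK0
    nlinarith [mul_nonneg hK0 hL0]
  · have e : f θ x * g θ x - f θ y * g θ y
        = f θ x * (g θ x - g θ y) + (f θ x - f θ y) * g θ y := by ring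
    rw [e]
    refine (abs_add_le _ _).trans ?_
    rw [abs_mul, abs_mul]
    have h1 := mul_le_mul (hK θ x y).1 (hL θ x y).2 (abs_nonneg _) hK0
    have h2 := mul_le_mul (hK θ x y).2 (hL θ y y).1 (abs_nonneg _)
      (mul_nonneg hK0 dist_nonneg)
    linarith

theorem BddLip.neg {f : ℝ → ℝ × ℝ → ℝ} (hf : BddLip f) : BddLip fun θ x => -f θ x := by
  obtain ⟨⟨K, hK0, hK⟩, hfc⟩ := hf
  refine ⟨⟨K, hK0, fun θ x y => ⟨by rw [abs_neg]; exact (hK θ x y).1, ?_⟩⟩, fun x => (hfc x).neg⟩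
  rw [neg_sub_neg, abs_sub_comm]
  exact (hK θ x y).2

/-- The planar field with components `f` and `g` has global solutions. -/
theorem BddLip.exists_solution {f g : ℝ → ℝ × ℝ → ℝ} (hf : BddLip f) (hg : BddLip g) :
    ∃ K : NNReal, (∀ θ, LipschitzWith K fun x => (f θ x, g θ x)) ∧
      ∀ x₀ : ℝ × ℝ, ∃ α : ℝ → ℝ × ℝ, α 0 = x₀ ∧
        ∀ θ, HasDerivAt α (f θ (α θ), g θ (α θ)) θ := by
  obtain ⟨⟨K, hK0, hK⟩, hfc⟩ := hf
  obtain ⟨⟨L, hL0, hL⟩, hgc⟩ := hg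
  have hlip : ∀ θ, LipschitzWith (K + L).toNNReal fun x => (f θ x, g θ x) := by
    intro θ
    refine LipschitzWith.of_dist_le_mul fun x y => ?_
    rw [Real.coe_toNNReal _ (by positivity), Prod.dist_eq, Real.dist_eq, Real.dist_eq]
    have h0 : 0 ≤ dist x y := dist_nonneg
    refine max_le ((hK θ x y).2.trans ?_) ((hL θ x y).2.trans ?_) <;> nlinarith
  refine ⟨_, hlip, fun x₀ => exists_global_solution (fun θ x => (f θ x, g θ x)) (K + L).toNNReal
    (K + L).toNNReal (fun θ x => ?_) hlip (fun x => (hfc x).prodMk (hgc x)) x₀⟩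
  rw [Real.coe_toNNReal _ (by positivity), Prod.norm_def, Real.norm_eq_abs, Real.norm_eq_abs]
  exact max_le ((hK θ x x).1.trans (by linarith)) ((hL θ x x).1.trans (by linarith))

/-- Truncation of a real number to the interval `[a, b]`. -/
noncomputable def clampR (a b x : ℝ) : ℝ := max a (min b x)

theorem clampR_mem {a b : ℝ} (h : a ≤ b) (x : ℝ) : clampR a b x ∈ Icc a b :=
  ⟨le_max_left _ _, max_le h (min_le_left _ _)⟩

theorem clampR_of_mem {a b x : ℝ} (h : x ∈ Icc a b) : clampR a b x = x := by
  rw [clampR, min_eq_right h.2, max_eq_right h.1]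

theorem abs_clampR_sub_le (a b x y : ℝ) : |clampR a b x - clampR a b y| ≤ |x - y| := by
  unfold clampR
  refine (abs_max_sub_max_le_max _ _ _ _).trans (max_le (by simp) ?_)
  exact (abs_min_sub_min_le_max _ _ _ _).trans (max_le (by simp) le_rfl)

theorem clampR_neg (a x : ℝ) (ha : 0 ≤ a) : clampR (-a) a (-x) = -clampR (-a) a x := by
  unfold clampR
  grind

theorem abs_clampR_le (a x : ℝ) (ha : 0 ≤ a) : |clampR (-a) a x| ≤ |x| := by
  have := abs_clampR_sub_le (-a) a x 0
  rwa [clampR_of_mem (x := 0) ⟨by linarith, ha⟩, sub_zero, sub_zero] at this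

theorem bddLip_clampR_fst (a : ℝ) (ha : 0 ≤ a) : BddLip fun _ x => clampR (-a) a x.1 := by
  refine ⟨⟨a + 1, by positivity, fun θ x y => ⟨?_, ?_⟩⟩, fun x => continuous_const⟩
  · have := clampR_mem (show -a ≤ a by linarith) x.1
    rw [abs_le]; constructor <;> linarith [this.1, this.2]
  · refine (abs_clampR_sub_le _ _ _ _).trans ?_
    have h1 : |x.1 - y.1| ≤ dist x y := by
      rw [← Real.dist_eq, Prod.dist_eq]; exact le_max_left _ _
    nlinarith [dist_nonneg (x := x) (y := y)]

theorem bddLip_clampR_snd (a : ℝ) (ha : 0 ≤ a) : BddLip fun _ x => clampR (-a) a x.2 := by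
  refine ⟨⟨a + 1, by positivity, fun θ x y => ⟨?_, ?_⟩⟩, fun x => continuous_const⟩
  · have := clampR_mem (show -a ≤ a by linarith) x.2
    rw [abs_le]; constructor <;> linarith [this.1, this.2]
  · refine (abs_clampR_sub_le _ _ _ _).trans ?_
    have h1 : |x.2 - y.2| ≤ dist x y := by
      rw [← Real.dist_eq, Prod.dist_eq]; exact le_max_right _ _
    nlinarith [dist_nonneg (x := x) (y := y)]

theorem bddLip_time {h : ℝ → ℝ} (b : ℝ) (hb : 0 ≤ b) (hc : Continuous h) (hh : ∀ θ, |h θ| ≤ b) :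
    BddLip fun θ _ => h θ :=
  ⟨⟨b, hb, fun θ _ _ => ⟨hh θ, by simpa using mul_nonneg hb dist_nonneg⟩⟩, fun _ => hc⟩

/-- Comparison estimate for a forced oscillator with instantaneous frequency `n`, whose total phase
does not exceed a quarter turn. -/
theorem oscillator_comparison {ζ w n j h φ : ℝ → ℝ} {Θ j₀ b : ℝ} (hΘ : 0 ≤ Θ)
    (hζ : ∀ θ ∈ Icc 0 Θ, HasDerivAt ζ (-n θ * (w θ - h θ)) θ)
    (hw : ∀ θ ∈ Icc 0 Θ, HasDerivAt w (n θ * (ζ θ + j θ)) θ)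
    (hφ : ∀ θ ∈ Icc 0 Θ, HasDerivAt φ (n θ) θ) (hn : ∀ θ ∈ Icc 0 Θ, 0 ≤ n θ)
    (hj : ∀ θ ∈ Icc 0 Θ, -j₀ ≤ j θ) (hh : ∀ θ ∈ Icc 0 Θ, |h θ| ≤ b) (hφ0 : φ 0 = 0)
    (hφΘ : φ Θ ≤ Real.pi / 2) (hw0 : w 0 = 0) :
    (ζ 0 - j₀) * Real.sin (φ Θ) - b * (1 - Real.cos (φ Θ)) ≤ w Θ ∧
      ζ Θ ≤ ζ 0 * Real.cos (φ Θ) + b * Real.sin (φ Θ) + j₀ * (1 - Real.cos (φ Θ)) := by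
  have hmono : MonotoneOn φ (Icc 0 Θ) := by
    refine monotoneOn_of_deriv_nonneg (convex_Icc _ _)
      (fun θ hθ => (hφ θ hθ).continuousAt.continuousWithinAt) ?_ ?_
    · intro θ hθ
      exact (hφ θ (interior_subset hθ)).differentiableAt.differentiableWithinAt
    · intro θ hθ
      rw [(hφ θ (interior_subset hθ)).deriv]
      exact hn θ (interior_subset hθ)
  have hrange : ∀ θ ∈ Icc 0 Θ, 0 ≤ Real.sin (φ Θ - φ θ) ∧ 0 ≤ Real.cos (φ Θ - φ θ) := by
    intro θ hθ
    have h1 := hmono hθ (right_mem_Icc.2 hΘ) hθ.2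
    have h2 := hmono (left_mem_Icc.2 hΘ) hθ hθ.1
    have := Real.pi_pos
    exact ⟨Real.sin_nonneg_of_nonneg_of_le_pi (by linarith) (by linarith),
      Real.cos_nonneg_of_neg_pi_div_two_le_of_le (by linarith) (by linarith)⟩
  have hs : ∀ θ ∈ Icc 0 Θ, HasDerivAt (fun θ => Real.sin (φ Θ - φ θ))
      (Real.cos (φ Θ - φ θ) * (-n θ)) θ := fun θ hθ => ((hφ θ hθ).const_sub (φ Θ)).sin
  have hco : ∀ θ ∈ Icc 0 Θ, HasDerivAt (fun θ => Real.cos (φ Θ - φ θ))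
      (-Real.sin (φ Θ - φ θ) * (-n θ)) θ := fun θ hθ => ((hφ θ hθ).const_sub (φ Θ)).cos
  constructor
  · have hd : ∀ θ ∈ Icc 0 Θ, HasDerivAt (fun θ => w θ * Real.cos (φ Θ - φ θ)
        + ζ θ * Real.sin (φ Θ - φ θ) - j₀ * Real.sin (φ Θ - φ θ) + b * Real.cos (φ Θ - φ θ))
        (n θ * ((j θ + j₀) * Real.cos (φ Θ - φ θ) + (h θ + b) * Real.sin (φ Θ - φ θ))) θ := by
      intro θ hθ
      refine HasDerivAt.congr_deriv (((((hw θ hθ).fun_mul (hco θ hθ)).fun_add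
        ((hζ θ hθ).fun_mul (hs θ hθ))).fun_sub
        ((hs θ hθ).const_mul j₀)).fun_add ((hco θ hθ).const_mul b)) ?_
      ring
    have hm : MonotoneOn (fun θ => w θ * Real.cos (φ Θ - φ θ)
        + ζ θ * Real.sin (φ Θ - φ θ) - j₀ * Real.sin (φ Θ - φ θ) + b * Real.cos (φ Θ - φ θ))
        (Icc 0 Θ) := by
      refine monotoneOn_of_deriv_nonneg (convex_Icc _ _)
        (fun θ hθ => (hd θ hθ).continuousAt.continuousWithinAt) ?_ ?_
      · intro θ hθ
        exact (hd θ (interior_subset hθ)).differentiableAt.differentiableWithinAt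
      · intro θ hθ
        have hθ' := interior_subset hθ
        rw [(hd θ hθ').deriv]
        have := abs_le.mp (hh θ hθ')
        exact mul_nonneg (hn θ hθ') (add_nonneg
          (mul_nonneg (by linarith [hj θ hθ']) (hrange θ hθ').2)
          (mul_nonneg (by linarith) (hrange θ hθ').1))
    have := hm (left_mem_Icc.2 hΘ) (right_mem_Icc.2 hΘ) hΘ
    simp only [hw0, hφ0, sub_zero, sub_self, Real.sin_zero, Real.cos_zero] at this
    linarith
  · have hd : ∀ θ ∈ Icc 0 Θ, HasDerivAt (fun θ => ζ θ * Real.cos (φ Θ - φ θ)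
        - w θ * Real.sin (φ Θ - φ θ) + b * Real.sin (φ Θ - φ θ) - j₀ * Real.cos (φ Θ - φ θ))
        (-(n θ * ((b - h θ) * Real.cos (φ Θ - φ θ) + (j θ + j₀) * Real.sin (φ Θ - φ θ)))) θ := by
      intro θ hθ
      refine HasDerivAt.congr_deriv (((((hζ θ hθ).fun_mul (hco θ hθ)).fun_sub
        ((hw θ hθ).fun_mul (hs θ hθ))).fun_add
        ((hs θ hθ).const_mul b)).fun_sub ((hco θ hθ).const_mul j₀)) ?_
      ring
    have hm : AntitoneOn (fun θ => ζ θ * Real.cos (φ Θ - φ θ)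
        - w θ * Real.sin (φ Θ - φ θ) + b * Real.sin (φ Θ - φ θ) - j₀ * Real.cos (φ Θ - φ θ))
        (Icc 0 Θ) := by
      refine antitoneOn_of_deriv_nonpos (convex_Icc _ _)
        (fun θ hθ => (hd θ hθ).continuousAt.continuousWithinAt) ?_ ?_
      · intro θ hθ
        exact (hd θ (interior_subset hθ)).differentiableAt.differentiableWithinAt
      · intro θ hθ
        have hθ' := interior_subset hθ
        rw [(hd θ hθ').deriv]
        have := abs_le.mp (hh θ hθ')
        exact neg_nonpos.2 (mul_nonneg (hn θ hθ') (add_nonneg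
          (mul_nonneg (by linarith) (hrange θ hθ').2)
          (mul_nonneg (by linarith [hj θ hθ']) (hrange θ hθ').1)))
    have := hm (left_mem_Icc.2 hΘ) (right_mem_Icc.2 hΘ) hΘ
    simp only [hw0, hφ0, sub_zero, sub_self, Real.sin_zero, Real.cos_zero] at this
    linarith

theorem BddLip.continuous_comp {f : ℝ → ℝ × ℝ → ℝ} (hf : BddLip f) {α : ℝ → ℝ × ℝ}
    (hα : Continuous α) : Continuous fun θ => f θ (α θ) := by
  obtain ⟨⟨K, hK0, hK⟩, hfc⟩ := hf
  have hu : Continuous (Function.uncurry f) := by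
    refine continuous_prod_of_continuous_lipschitzWith' (Function.uncurry f) K.toNNReal
      (fun θ => ?_) hfc
    refine LipschitzWith.of_dist_le_mul fun x y => ?_
    rw [Real.coe_toNNReal _ hK0, Real.dist_eq]
    exact (hK θ x y).2
  exact hu.comp (continuous_id.prodMk hα)

theorem one_le_sin_add_cos {Φ : ℝ} (h0 : 0 ≤ Φ) (h1 : Φ ≤ Real.pi / 2) :
    0 ≤ Real.sin Φ ∧ 0 ≤ Real.cos Φ ∧ 1 ≤ Real.sin Φ + Real.cos Φ ∧
      Real.sin Φ + Real.cos Φ ≤ 1.42 := by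
  have hs : 0 ≤ Real.sin Φ := Real.sin_nonneg_of_nonneg_of_le_pi h0 (by linarith [Real.pi_pos])
  have hc : 0 ≤ Real.cos Φ :=
    Real.cos_nonneg_of_neg_pi_div_two_le_of_le (by linarith [Real.pi_pos]) h1
  have h2 := Real.sin_sq_add_cos_sq Φ
  refine ⟨hs, hc, ?_, ?_⟩
  · nlinarith [mul_nonneg hs hc]
  · nlinarith [sq_nonneg (Real.sin Φ - Real.cos Φ)]

/-- A priori bounds for the solution of a symmetric forced oscillator shot from the axis. -/
theorem oscillator_bounds {N J : ℝ → ℝ × ℝ → ℝ} {h : ℝ → ℝ} {j₀ j₁ b : ℝ}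
    (hN : BddLip N) (hN0 : ∀ θ x, 0 ≤ N θ x) (hN1 : ∀ θ x, N θ x ≤ 1 / 2)
    (hJ0 : ∀ θ x, -j₀ ≤ J θ x) (hJ1 : ∀ θ x, J θ x ≤ j₁) (hh : ∀ θ, |h θ| ≤ b)
    (hs0 : j₀ + b ≤ 1) (hs1 : j₁ + b ≤ 1)
    {α : ℝ → ℝ × ℝ} (hα0 : (α 0).2 = 0)
    (hα : ∀ θ, HasDerivAt α (-N θ (α θ) * (clampR (-20) 20 (α θ).2 - h θ),
      N θ (α θ) * (clampR (-20) 20 (α θ).1 + J θ (α θ))) θ) (hz : |(α 0).1| ≤ 1) :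
    ∀ Θ ∈ Icc 0 Real.pi, |(α Θ).1| ≤ 20 ∧ |(α Θ).2| ≤ 20 ∧ ∃ Φ ∈ Icc 0 (Real.pi / 2),
      ((α 0).1 - j₀) * Real.sin Φ - b * (1 - Real.cos Φ) ≤ (α Θ).2 ∧
      (α Θ).2 ≤ ((α 0).1 + j₁) * Real.sin Φ + b * (1 - Real.cos Φ) ∧
      (α Θ).1 ≤ (α 0).1 * Real.cos Φ + b * Real.sin Φ + j₀ * (1 - Real.cos Φ) ∧
      (α 0).1 * Real.cos Φ - b * Real.sin Φ - j₁ * (1 - Real.cos Φ) ≤ (α Θ).1 := by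
  have hb : 0 ≤ b := (abs_nonneg _).trans (hh 0)
  have hcont : Continuous α := continuous_iff_continuousAt.2 fun θ => (hα θ).continuousAt
  have hsmall : ∀ Θ ∈ Icc 0 Real.pi, ‖α Θ‖ ≤ 20 := by
    have hg := norm_le_gronwallBound_of_norm_deriv_right_le (f := α) (a := 0) (b := Real.pi)
      (f' := fun θ => (-N θ (α θ) * (clampR (-20) 20 (α θ).2 - h θ),
        N θ (α θ) * (clampR (-20) 20 (α θ).1 + J θ (α θ)))) (δ := 1) (K := 1 / 2) (ε := 1 / 2)
      hcont.continuousOn (fun θ _ => (hα θ).hasDerivWithinAt) ?_ ?_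
    · intro Θ hΘ
      refine (hg Θ hΘ).trans ?_
      rw [gronwallBound_of_K_ne_0 (by norm_num)]
      have h1 : Real.exp (1 / 2 * (Θ - 0)) ≤ Real.exp 2 :=
        Real.exp_le_exp.2 (by linarith [hΘ.2, Real.pi_le_four])
      have h2 : Real.exp 2 ≤ 8 := by
        have : Real.exp 2 = Real.exp 1 * Real.exp 1 := by rw [← Real.exp_add]; norm_num
        nlinarith [Real.exp_one_lt_d9, Real.exp_pos 1]
      linarith
    · rw [Prod.norm_def, Real.norm_eq_abs, Real.norm_eq_abs, hα0]
      exact max_le hz (by simp)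
    · intro θ _
      have h1 := abs_clampR_le 20 (α θ).1 (by norm_num)
      have h2 := abs_clampR_le 20 (α θ).2 (by norm_num)
      have h3 : |(α θ).1| ≤ ‖α θ‖ := norm_fst_le (α θ)
      have h4 : |(α θ).2| ≤ ‖α θ‖ := norm_snd_le (α θ)
      have hJ : |J θ (α θ)| ≤ 1 := abs_le.2 ⟨by linarith [hJ0 θ (α θ)], by linarith [hJ1 θ (α θ)]⟩
      have hNn := hN0 θ (α θ)
      have hNh := hN1 θ (α θ)
      rw [Prod.norm_def, Real.norm_eq_abs, Real.norm_eq_abs]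
      refine max_le ?_ ?_
      · rw [abs_mul, abs_neg, abs_of_nonneg hNn]
        have := (abs_sub (clampR (-20) 20 (α θ).2) (h θ)).trans
          (add_le_add (h2.trans h4)
            ((hh θ).trans (show b ≤ 1 by linarith [hJ0 θ (α θ), hJ1 θ (α θ)])))
        nlinarith [abs_nonneg (clampR (-20) 20 (α θ).2 - h θ)]
      · rw [abs_mul, abs_of_nonneg hNn]
        have := (abs_add_le (clampR (-20) 20 (α θ).1) (J θ (α θ))).trans
          (add_le_add (h1.trans h3) hJ)
        nlinarith [abs_nonneg (clampR (-20) 20 (α θ).1 + J θ (α θ))]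
  have hclamp : ∀ θ ∈ Icc 0 Real.pi, clampR (-20) 20 (α θ).1 = (α θ).1 ∧
      clampR (-20) 20 (α θ).2 = (α θ).2 := fun θ hθ =>
    ⟨clampR_of_mem (abs_le.1 ((norm_fst_le (α θ)).trans (hsmall θ hθ))),
      clampR_of_mem (abs_le.1 ((norm_snd_le (α θ)).trans (hsmall θ hθ)))⟩
  have hζ : ∀ θ ∈ Icc 0 Real.pi,
      HasDerivAt (fun θ => (α θ).1) (-N θ (α θ) * ((α θ).2 - h θ)) θ := by
    intro θ hθ
    have := (hα θ).fst
    rwa [(hclamp θ hθ).2] at this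
  have hw : ∀ θ ∈ Icc 0 Real.pi,
      HasDerivAt (fun θ => (α θ).2) (N θ (α θ) * ((α θ).1 + J θ (α θ))) θ := by
    intro θ hθ
    have := (hα θ).snd
    rwa [(hclamp θ hθ).1] at this
  set n : ℝ → ℝ := fun θ => N θ (α θ) with hn
  have hnc : Continuous n := hN.continuous_comp hcont
  set φ : ℝ → ℝ := fun θ => ∫ τ in (0 : ℝ)..θ, n τ with hφ
  have hφd : ∀ θ, HasDerivAt φ (n θ) θ := fun θ => hnc.integral_hasStrictDerivAt 0 θ |>.hasDerivAt
  have hφ0 : φ 0 = 0 := intervalIntegral.integral_same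
  intro Θ hΘ
  have hφnn : 0 ≤ φ Θ := intervalIntegral.integral_nonneg hΘ.1 fun τ _ => hN0 τ _
  have hφle : φ Θ ≤ Real.pi / 2 := by
    have : φ Θ ≤ ∫ τ in (0 : ℝ)..Θ, (1 / 2 : ℝ) :=
      intervalIntegral.integral_mono_on hΘ.1 (hnc.intervalIntegrable _ _)
        (continuous_const.intervalIntegrable _ _) fun τ _ => hN1 τ _
    rw [intervalIntegral.integral_const, smul_eq_mul] at this
    linarith [hΘ.2]
  have hsub : ∀ θ ∈ Icc 0 Θ, θ ∈ Icc 0 Real.pi := fun θ hθ => ⟨hθ.1, hθ.2.trans hΘ.2⟩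
  refine ⟨(norm_fst_le (α Θ)).trans (hsmall Θ hΘ), (norm_snd_le (α Θ)).trans (hsmall Θ hΘ),
    φ Θ, ⟨hφnn, hφle⟩, ?_⟩
  have A := oscillator_comparison (ζ := fun θ => (α θ).1) (w := fun θ => (α θ).2) (n := n)
    (j := fun θ => J θ (α θ)) (h := h) (φ := φ) (j₀ := j₀) (b := b) hΘ.1
    (fun θ hθ => hζ θ (hsub θ hθ)) (fun θ hθ => hw θ (hsub θ hθ)) (fun θ _ => hφd θ)
    (fun θ _ => hN0 θ _) (fun θ _ => hJ0 θ _) (fun θ _ => hh θ) hφ0 hφle hα0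
  have B := oscillator_comparison (ζ := fun θ => -(α θ).1) (w := fun θ => -(α θ).2) (n := n)
    (j := fun θ => -J θ (α θ)) (h := fun θ => -h θ) (φ := φ) (j₀ := j₁) (b := b) hΘ.1
    (fun θ hθ => (hζ θ (hsub θ hθ)).fun_neg.congr_deriv (by simp only [hn]; ring))
    (fun θ hθ => (hw θ (hsub θ hθ)).fun_neg.congr_deriv (by simp only [hn]; ring))
    (fun θ _ => hφd θ)
    (fun θ _ => hN0 θ _) (fun θ _ => neg_le_neg (hJ1 θ _))
    (fun θ _ => by rw [abs_neg]; exact hh θ) hφ0 hφle (by simp [hα0])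
  refine ⟨A.1, by linarith [B.1], A.2, by linarith [B.2]⟩

/-- A weakly forced oscillator, `2 * π`-periodic and reversible in time, whose total phase over
half a
period is at most a quarter turn, has a symmetric periodic solution close to the equilibrium. -/
theorem oscillator_periodic {N J : ℝ → ℝ × ℝ → ℝ} {h : ℝ → ℝ} {j₀ j₁ b : ℝ}
    (hN : BddLip N) (hJ : BddLip J) (hhc : Continuous h)
    (hN0 : ∀ θ x, 0 ≤ N θ x) (hN1 : ∀ θ x, N θ x ≤ 1 / 2)
    (hJ0 : ∀ θ x, -j₀ ≤ J θ x) (hJ1 : ∀ θ x, J θ x ≤ j₁) (hh : ∀ θ, |h θ| ≤ b)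
    (hj0 : 0 ≤ j₀) (hj1 : 0 ≤ j₁) (hs0 : j₀ + b ≤ 1) (hs1 : j₁ + b ≤ 1)
    (hNs : ∀ θ ζ w, N (-θ) (ζ, -w) = N θ (ζ, w)) (hJs : ∀ θ ζ w, J (-θ) (ζ, -w) = J θ (ζ, w))
    (hhs : ∀ θ, h (-θ) = -h θ) (hNp : ∀ θ x, N (θ + 2 * Real.pi) x = N θ x)
    (hJp : ∀ θ x, J (θ + 2 * Real.pi) x = J θ x) (hhp : ∀ θ, h (θ + 2 * Real.pi) = h θ) :
    ∃ ζ w : ℝ → ℝ,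
      (∀ θ, HasDerivAt ζ (-N θ (ζ θ, w θ) * (w θ - h θ)) θ) ∧
      (∀ θ, HasDerivAt w (N θ (ζ θ, w θ) * (ζ θ + J θ (ζ θ, w θ))) θ) ∧
      (∀ θ, ζ (-θ) = ζ θ) ∧ (∀ θ, w (-θ) = -w θ) ∧
      (∀ θ, ζ (θ + 2 * Real.pi) = ζ θ) ∧ (∀ θ, w (θ + 2 * Real.pi) = w θ) ∧
      (∀ θ, -(j₁ + 1.42 * b) ≤ ζ θ) ∧ (∀ θ, ζ θ ≤ j₀ + 1.42 * b) ∧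
      (∀ θ, |w θ| ≤ j₀ + j₁ + 2 * b) := by
  have hb : 0 ≤ b := (abs_nonneg _).trans (hh 0)
  have hpi := Real.pi_pos
  have hF1 : BddLip fun θ x => -N θ x * (clampR (-20) 20 x.2 - h θ) := by
    have := hN.neg.mul ((bddLip_clampR_snd 20 (by norm_num)).add (bddLip_time b hb hhc hh).neg)
    simpa only [sub_eq_add_neg] using this
  have hF2 : BddLip fun θ x => N θ x * (clampR (-20) 20 x.1 + J θ x) :=
    hN.mul ((bddLip_clampR_fst 20 (by norm_num)).add hJ)
  obtain ⟨K, hK, hsol⟩ := hF1.exists_solution hF2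
  choose α hα0 hα using hsol
  have hαc : ∀ x, Continuous (α x) := fun x =>
    continuous_iff_continuousAt.2 fun θ => (hα x θ).continuousAt
  have hdep : Continuous fun z : ℝ => (α (z, 0) Real.pi).2 := by
    refine (LipschitzWith.of_dist_le_mul (K := (Real.exp (K * Real.pi)).toNNReal)
      fun x y => ?_).continuous
    rw [Real.coe_toNNReal _ (Real.exp_pos _).le]
    have := dist_le_of_trajectories_ODE
      (v := fun θ x => (-N θ x * (clampR (-20) 20 x.2 - h θ),
        N θ x * (clampR (-20) 20 x.1 + J θ x)))
      (f := α (x, 0)) (g := α (y, 0)) (a := 0) (b := Real.pi) (δ := dist x y) (K := K) hK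
      (hαc _).continuousOn (fun θ _ => (hα _ θ).hasDerivWithinAt)
      (hαc _).continuousOn (fun θ _ => (hα _ θ).hasDerivWithinAt)
      (by rw [hα0, hα0, Prod.dist_eq]; simp) Real.pi (right_mem_Icc.2 hpi.le)
    rw [sub_zero, mul_comm] at this
    refine le_trans ?_ this
    rw [Prod.dist_eq]
    exact le_max_right _ _
  have hbd := fun z : ℝ => fun hz : |z| ≤ 1 => oscillator_bounds hN hN0 hN1 hJ0 hJ1 hh hs0 hs1
    (α := α (z, 0)) (by rw [hα0]) (hα _) (by rw [hα0]; exact hz)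
  obtain ⟨z, hz, hz0⟩ : ∃ z ∈ Icc (-(j₁ + b)) (j₀ + b), (α (z, 0) Real.pi).2 = 0 := by
    have hle : -(j₁ + b) ≤ j₀ + b := by linarith
    refine (intermediate_value_Icc hle hdep.continuousOn) ⟨?_, ?_⟩
    · obtain ⟨-, -, Φ, ⟨h1, h2⟩, -, h3, -, -⟩ := hbd (-(j₁ + b))
        (by rw [abs_neg, abs_of_nonneg (by linarith)]; exact hs1) Real.pi (right_mem_Icc.2 hpi.le)
      obtain ⟨h4, h5, h6, h7⟩ := one_le_sin_add_cos h1 h2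
      rw [hα0] at h3
      refine h3.trans ?_
      simp only
      nlinarith
    · obtain ⟨-, -, Φ, ⟨h1, h2⟩, h3, -, -, -⟩ := hbd (j₀ + b)
        (by rw [abs_of_nonneg (by linarith)]; exact hs0) Real.pi (right_mem_Icc.2 hpi.le)
      obtain ⟨h4, h5, h6, h7⟩ := one_le_sin_add_cos h1 h2
      rw [hα0] at h3
      refine le_trans ?_ h3
      simp only
      nlinarith
  have hzabs : |z| ≤ 1 := abs_le.2 ⟨by linarith [hz.1], by linarith [hz.2]⟩
  set x := α (z, 0) with hx
  have hxd := hα (z, 0)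
  rw [← hx] at hxd
  have hx0 : x 0 = (z, 0) := hα0 _
  have huniq : ∀ y : ℝ → ℝ × ℝ, (∀ θ, HasDerivAt y (-N θ (y θ) * (clampR (-20) 20 (y θ).2 - h θ),
      N θ (y θ) * (clampR (-20) 20 (y θ).1 + J θ (y θ))) θ) → ∀ θ₀, y θ₀ = x θ₀ → y = x :=
    fun y hy θ₀ h₀ => ODE_solution_unique_univ
      (v := fun θ x => (-N θ x * (clampR (-20) 20 x.2 - h θ),
        N θ x * (clampR (-20) 20 x.1 + J θ x))) (s := fun _ => univ) (K := K)
      (fun θ => (hK θ).lipschitzOnWith) (fun θ => ⟨hy θ, trivial⟩) (fun θ => ⟨hxd θ, trivial⟩) h₀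
  have hrefl : (fun θ => ((x (-θ)).1, -(x (-θ)).2)) = x := by
    refine huniq _ (fun θ => ?_) 0 (by simp [hx0])
    have h1 := (hxd (-θ)).scomp θ (hasDerivAt_neg θ)
    have h2 : HasDerivAt (fun θ => (x (-θ)).1)
        (-1 * (-N (-θ) (x (-θ)) * (clampR (-20) 20 (x (-θ)).2 - h (-θ)))) θ := h1.fst
    have h3 : HasDerivAt (fun θ => (x (-θ)).2)
        (-1 * (N (-θ) (x (-θ)) * (clampR (-20) 20 (x (-θ)).1 + J (-θ) (x (-θ))))) θ := h1.snd
    refine (h2.prodMk h3.fun_neg).congr_deriv ?_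
    have e1 := hNs θ (x (-θ)).1 (-(x (-θ)).2)
    have e2 := hJs θ (x (-θ)).1 (-(x (-θ)).2)
    rw [neg_neg] at e1 e2
    simp only [Prod.mk.eta] at e1 e2
    rw [← e1, ← e2, clampR_neg _ _ (by norm_num), hhs]
    ext <;> simp only <;> ring
  have hperiod : (fun θ => x (θ + 2 * Real.pi)) = x := by
    refine huniq _ (fun θ => ?_) (-Real.pi) ?_
    · have h1 : HasDerivAt (fun θ => x (θ + 2 * Real.pi)) _ θ :=
        (hxd (θ + 2 * Real.pi)).comp_add_const θ (2 * Real.pi)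
      rwa [hNp, hJp, hhp] at h1
    · have h1 := congrFun hrefl (-Real.pi)
      simp only [neg_neg, hz0, neg_zero] at h1
      rw [← h1, show -Real.pi + 2 * Real.pi = Real.pi by ring]
      ext <;> simp [hz0]
  have hx1 : ∀ θ, (x (-θ)).1 = (x θ).1 := fun θ => by
    rw [← congrFun hrefl θ]
  have hx2 : ∀ θ, (x (-θ)).2 = -(x θ).2 := fun θ => by
    rw [← congrArg Prod.snd (congrFun hrefl θ), neg_neg]
  have hxp : ∀ θ, x (θ + 2 * Real.pi) = x θ := fun θ => congrFun hperiod θ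
  have hbase : ∀ θ ∈ Icc 0 Real.pi, |(x θ).1| ≤ 20 ∧ -(j₁ + 1.42 * b) ≤ (x θ).1 ∧
      (x θ).1 ≤ j₀ + 1.42 * b ∧ |(x θ).2| ≤ j₀ + j₁ + 2 * b := by
    intro θ hθ
    obtain ⟨h1, -, Φ, ⟨hΦ0, hΦ1⟩, h3, h4, h5, h6⟩ := hbd z hzabs θ hθ
    obtain ⟨g1, g2, g3, g4⟩ := one_le_sin_add_cos hΦ0 hΦ1
    have g5 := Real.sin_le_one Φ
    have g6 := Real.cos_le_one Φ
    simp only [← hx] at h1 h3 h4 h5 h6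
    rw [hx0] at h3 h4 h5 h6
    simp only at h3 h4 h5 h6
    refine ⟨h1, ?_, ?_, abs_le.2 ⟨?_, ?_⟩⟩
    · nlinarith [hz.1]
    · nlinarith [hz.2]
    · nlinarith [hz.1]
    · nlinarith [hz.2]
  have hall : ∀ θ, |(x θ).1| ≤ 20 ∧ -(j₁ + 1.42 * b) ≤ (x θ).1 ∧
      (x θ).1 ≤ j₀ + 1.42 * b ∧ |(x θ).2| ≤ j₀ + j₁ + 2 * b := by
    intro θ
    have hper : Function.Periodic x (2 * Real.pi) := hxp
    obtain ⟨θ', hθ', he⟩ := hper.exists_mem_Ico (by positivity) θ (-Real.pi)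
    rw [he]
    rcases le_total 0 θ' with h0 | h0
    · exact hbase θ' ⟨h0, by linarith [hθ'.2]⟩
    · have := hbase (-θ') ⟨by linarith, by linarith [hθ'.1]⟩
      rwa [hx1, hx2, abs_neg (x θ').2] at this
  have hc : ∀ θ, clampR (-20) 20 (x θ).1 = (x θ).1 ∧ clampR (-20) 20 (x θ).2 = (x θ).2 :=
    fun θ => ⟨clampR_of_mem (abs_le.1 (hall θ).1),
      clampR_of_mem (abs_le.1 ((hall θ).2.2.2.trans (by linarith)))⟩
  refine ⟨fun θ => (x θ).1, fun θ => (x θ).2, fun θ => ?_, fun θ => ?_, hx1, hx2,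
    fun θ => by simp only [hxp], fun θ => by simp only [hxp], fun θ => (hall θ).2.1,
    fun θ => (hall θ).2.2.1, fun θ => (hall θ).2.2.2⟩
  · have := (hxd θ).fst
    rwa [(hc θ).2] at this
  · have := (hxd θ).snd
    rwa [(hc θ).1] at this

/-- On a half period of length less than `π / κ`, a solution of `n' = V y`, `y' = -q n` taking the
same value `c` at both ends satisfies a monotonicity relation, with rigidity. -/
theorem half_period_rigidity {n y V q : ℝ → ℝ} {m τ κ c V₁ q₁ : ℝ} (hτ : 0 < τ)
    (hn : ∀ t, HasDerivAt n (V t * y t) t) (hy : ∀ t, HasDerivAt y (-q t * n t) t)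
    (hV0 : ∀ t, 0 < V t) (hV : ∀ t, V t ≤ V₁) (hq0 : ∀ t, 0 < q t) (hq : ∀ t, q t ≤ q₁)
    (hκ0 : 0 < κ) (hκ : κ * τ < Real.pi / 2) (hκq : q₁ * V₁ < κ ^ 2)
    (ha : n (m - τ) = c) (hb : n (m + τ) = c) :
    (n (m - τ) - 2 * c) * y (m - τ) ≤ (n (m + τ) - 2 * c) * y (m + τ) ∧
      ((n (m - τ) - 2 * c) * y (m - τ) = (n (m + τ) - 2 * c) * y (m + τ) →
        ∀ t ∈ Ioo (m - τ) (m + τ), n t = 0) := by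
  have hV1 : 0 < V₁ := (hV0 0).trans_le (hV 0)
  have hcos : ∀ t ∈ Icc (m - τ) (m + τ), Real.cos (κ * (t - m)) ≠ 0 := by
    intro t ht
    refine (Real.cos_pos_of_mem_Ioo ⟨?_, ?_⟩).ne' <;> nlinarith [ht.1, ht.2]
  set Ψ : ℝ → ℝ := fun t => (n t - 2 * c) * y t
    + (n t - c) ^ 2 * (κ / V₁ * Real.tan (κ * (t - m))) with hΨ
  set d : ℝ → ℝ := fun t => V t * y t * y t - (n t - 2 * c) * (q t * n t)
    + (2 * (n t - c) * (V t * y t) * (κ / V₁ * Real.tan (κ * (t - m)))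
      + (n t - c) ^ 2 * (κ / V₁ * (κ * (1 + Real.tan (κ * (t - m)) ^ 2)))) with hd
  have hder : ∀ t ∈ Icc (m - τ) (m + τ), HasDerivAt Ψ (d t) t := by
    intro t ht
    have h1 : HasDerivAt (fun t => κ * (t - m)) κ t := by
      simpa using ((hasDerivAt_id t).sub_const m).const_mul κ
    have h2 : HasDerivAt (fun t => Real.tan (κ * (t - m)))
        (1 / Real.cos (κ * (t - m)) ^ 2 * κ) t :=
      HasDerivAt.comp t (h₂ := Real.tan) (Real.hasDerivAt_tan (hcos t ht)) h1
    have h3 := ((hn t).sub_const (2 * c)).fun_mul (hy t)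
    have h4 := (((hn t).sub_const c).fun_pow 2).fun_mul (h2.const_mul (κ / V₁))
    refine (h3.fun_add h4).congr_deriv ?_
    rw [hd]
    simp only
    have h5 : 1 + Real.tan (κ * (t - m)) ^ 2 = 1 / Real.cos (κ * (t - m)) ^ 2 := by
      rw [one_div, ← Real.inv_one_add_tan_sq (hcos t ht), inv_inv]
    rw [← h5]
    push_cast
    ring
  have hlow : ∀ t, c ^ 2 * q t + (κ ^ 2 / V₁ - q₁) * (n t - c) ^ 2 ≤ d t := by
    intro t
    set f := n t - c with hf
    set T := κ * Real.tan (κ * (t - m)) with hT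
    have e1 : d t = V t * y t ^ 2 - q t * f ^ 2 + c ^ 2 * q t
        + (2 * f * (V t * y t) * T + f ^ 2 * (κ ^ 2 + T ^ 2)) / V₁ := by
      simp only [hd, hT, hf]
      field_simp
      ring
    have e2 : (V t * y t) ^ 2 / V₁ ≤ V t * y t ^ 2 := by
      rw [div_le_iff₀ hV1]
      nlinarith [mul_nonneg (mul_nonneg (hV0 t).le (sq_nonneg (y t))) (sub_nonneg.2 (hV t))]
    have e3 : (2 * f * (V t * y t) * T + f ^ 2 * (κ ^ 2 + T ^ 2)) / V₁
        = ((V t * y t) + f * T) ^ 2 / V₁ - (V t * y t) ^ 2 / V₁ + κ ^ 2 / V₁ * f ^ 2 := by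
      field_simp
      ring
    have e4 : 0 ≤ ((V t * y t) + f * T) ^ 2 / V₁ := by positivity
    have e5 := mul_le_mul_of_nonneg_right (hq t) (sq_nonneg f)
    rw [e1, e3]
    linarith
  have hpos : 0 < κ ^ 2 / V₁ - q₁ := by
    rw [sub_pos, lt_div_iff₀ hV1]
    exact hκq
  have hlow0 : ∀ t, 0 ≤ d t := fun t =>
    (add_nonneg (mul_nonneg (sq_nonneg _) (hq0 t).le)
      (mul_nonneg hpos.le (sq_nonneg _))).trans (hlow t)
  have hmono : MonotoneOn Ψ (Icc (m - τ) (m + τ)) := by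
    refine monotoneOn_of_deriv_nonneg (convex_Icc _ _)
      (fun t ht => (hder t ht).continuousAt.continuousWithinAt) ?_ ?_
    · intro t ht
      exact (hder t (interior_subset ht)).differentiableAt.differentiableWithinAt
    · intro t ht
      rw [(hder t (interior_subset ht)).deriv]
      exact hlow0 t
  have hle : m - τ ≤ m + τ := by linarith
  have hΨa : Ψ (m - τ) = (n (m - τ) - 2 * c) * y (m - τ) := by simp [hΨ, ha]
  have hΨb : Ψ (m + τ) = (n (m + τ) - 2 * c) * y (m + τ) := by simp [hΨ, hb]
  rw [← hΨa, ← hΨb]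
  refine ⟨hmono (left_mem_Icc.2 hle) (right_mem_Icc.2 hle) hle, fun he t ht => ?_⟩
  have hconst : ∀ u ∈ Icc (m - τ) (m + τ), Ψ u = Ψ (m - τ) := fun u hu =>
    le_antisymm ((hmono hu (right_mem_Icc.2 hle) hu.2).trans he.ge)
      (hmono (left_mem_Icc.2 hle) hu hu.1)
  have hd0 : d t = 0 := by
    refine (hder t (Ioo_subset_Icc_self ht)).unique ?_
    refine (hasDerivAt_const t (Ψ (m - τ))).congr_of_eventuallyEq ?_
    filter_upwards [Ioo_mem_nhds ht.1 ht.2] with u hu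
    exact hconst u (Ioo_subset_Icc_self hu)
  have h1 := hlow t
  rw [hd0] at h1
  have h2 : 0 ≤ c ^ 2 * q t := mul_nonneg (sq_nonneg _) (hq0 t).le
  have h3 : 0 ≤ (κ ^ 2 / V₁ - q₁) * (n t - c) ^ 2 := mul_nonneg hpos.le (sq_nonneg _)
  have h4 : c ^ 2 = 0 := by
    have : c ^ 2 * q t = 0 := by linarith
    exact (mul_eq_zero.1 this).resolve_right (hq0 t).ne'
  have h5 : (n t - c) ^ 2 = 0 := by
    have : (κ ^ 2 / V₁ - q₁) * (n t - c) ^ 2 = 0 := by linarith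
    exact (mul_eq_zero.1 this).resolve_left hpos.ne'
  have h6 : c = 0 := by simpa using h4
  have h7 : n t - c = 0 := by simpa using h5
  linarith

/-- A periodic solution of `n' = V y`, `y' = -q n` with `0 < q` and `T² sup q sup V < 4 * π ^ 2`
vanishes
on some open interval. -/
theorem periodic_oscillator_vanishes {n y V q : ℝ → ℝ} {T V₁ q₁ : ℝ} (hT : 0 < T)
    (hn : ∀ t, HasDerivAt n (V t * y t) t) (hy : ∀ t, HasDerivAt y (-q t * n t) t)
    (hV0 : ∀ t, 0 < V t) (hV : ∀ t, V t ≤ V₁) (hq0 : ∀ t, 0 < q t) (hq : ∀ t, q t ≤ q₁)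
    (hnT : ∀ t, n (t + T) = n t) (hyT : ∀ t, y (t + T) = y t)
    (hlt : T ^ 2 * (q₁ * V₁) < 4 * Real.pi ^ 2) :
    ∃ t, n t = 0 ∧ y t = 0 := by
  have hq1 : 0 < q₁ := (hq0 0).trans_le (hq 0)
  have hV1 : 0 < V₁ := (hV0 0).trans_le (hV 0)
  have hnc : Continuous n := continuous_iff_continuousAt.2 fun t => (hn t).continuousAt
  obtain ⟨t₀, -, ht₀⟩ : ∃ t ∈ Icc 0 (T / 2), n (t + T / 2) - n t = 0 := by
    have hg : Continuous fun t => n (t + T / 2) - n t := by fun_prop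
    have e : n (T / 2 + T / 2) = n 0 := by
      rw [add_halves, ← hnT 0, zero_add]
    have hsub := intermediate_value_uIcc (a := (0 : ℝ)) (b := T / 2) hg.continuousOn
    rw [uIcc_of_le (by positivity : (0 : ℝ) ≤ T / 2)] at hsub
    have h0 : (0 : ℝ) ∈ uIcc ((fun t => n (t + T / 2) - n t) 0)
        ((fun t => n (t + T / 2) - n t) (T / 2)) := by
      simp only [zero_add, e]
      rw [mem_uIcc]
      rcases le_total (n 0) (n (T / 2)) with h | h
      · right; constructor <;> linarith
      · left; constructor <;> linarith
    exact hsub h0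
  have hpi := Real.pi_pos
  obtain ⟨κ, hκ1, hκ2⟩ : ∃ κ, Real.sqrt (q₁ * V₁) < κ ∧ κ < 2 * Real.pi / T := by
    refine exists_between ?_
    rw [lt_div_iff₀ hT]
    have h1 : (Real.sqrt (q₁ * V₁) * T) ^ 2 < (2 * Real.pi) ^ 2 := by
      rw [mul_pow, Real.sq_sqrt (by positivity)]
      linarith
    exact lt_of_pow_lt_pow_left₀ 2 (by positivity) h1
  have hκ0 : 0 < κ := (Real.sqrt_nonneg _).trans_lt hκ1
  have hκq : q₁ * V₁ < κ ^ 2 := by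
    rwa [Real.sqrt_lt' hκ0] at hκ1
  have hκT : κ * (T / 4) < Real.pi / 2 := by
    rw [lt_div_iff₀ hT] at hκ2
    linarith
  set c := n t₀ with hc
  have hc1 : n (t₀ + T / 2) = c := by linarith
  have hc2 : n (t₀ + T) = c := hnT t₀
  have r1 := half_period_rigidity (m := t₀ + T / 4) (c := c) (by positivity : 0 < T / 4) hn hy hV0
    hV hq0 hq hκ0 hκT hκq (by rw [add_sub_cancel_right])
    (by rw [← hc1]; congr 1; ring)
  have r2 := half_period_rigidity (m := t₀ + 3 * (T / 4)) (c := c) (by positivity : 0 < T / 4) hn hy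
    hV0 hV hq0 hq hκ0 hκT hκq (by rw [← hc1]; congr 1; ring)
    (by rw [← hc2]; congr 1; ring)
  have e1 : t₀ + T / 4 - T / 4 = t₀ := by ring
  have e2 : t₀ + T / 4 + T / 4 = t₀ + T / 2 := by ring
  have e3 : t₀ + 3 * (T / 4) - T / 4 = t₀ + T / 2 := by ring
  have e4 : t₀ + 3 * (T / 4) + T / 4 = t₀ + T := by ring
  rw [e1, e2] at r1
  rw [e3, e4, hyT, hnT] at r2
  have hz := r1.2 (le_antisymm r1.1 r2.1)
  have hmem : t₀ + T / 4 ∈ Ioo t₀ (t₀ + T / 2) := by constructor <;> linarith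
  refine ⟨t₀ + T / 4, hz _ hmem, ?_⟩
  have hd : HasDerivAt n 0 (t₀ + T / 4) := by
    refine (hasDerivAt_const _ (0 : ℝ)).congr_of_eventuallyEq ?_
    filter_upwards [Ioo_mem_nhds hmem.1 hmem.2] with u hu
    exact hz u hu
  have := (hn _).unique hd
  have hne := (hV0 (t₀ + T / 4)).ne'
  exact (mul_eq_zero.1 this).resolve_left hne

/-- Uniqueness for linear differential equations with continuous coefficients. -/
theorem linear_ode_unique {E : Type*} [NormedAddCommGroup E] [NormedSpace ℝ E]
    {A : ℝ → E →L[ℝ] E} (hA : Continuous A) {f g : ℝ → E}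
    (hf : ∀ t, HasDerivAt f (A t (f t)) t) (hg : ∀ t, HasDerivAt g (A t (g t)) t) {t₀ : ℝ}
    (h₀ : f t₀ = g t₀) : f = g := by
  ext t
  set R := |t| + |t₀| + 1 with hR
  have ht : t ∈ Ioo (-R) R := by
    rw [mem_Ioo, ← abs_lt]
    linarith [abs_nonneg t₀]
  have ht₀ : t₀ ∈ Ioo (-R) R := by
    rw [mem_Ioo, ← abs_lt]
    linarith [abs_nonneg t]
  obtain ⟨C, hC⟩ := (isCompact_Icc (a := -R) (b := R)).exists_bound_of_continuousOn hA.continuousOn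
  refine ODE_solution_unique_of_mem_Ioo (v := fun t x => A t x) (s := fun _ => univ)
    (K := C.toNNReal) (fun u hu => ?_) ht₀ (fun u _ => ⟨hf u, trivial⟩) (fun u _ => ⟨hg u, trivial⟩)
    h₀ ht
  refine LipschitzWith.lipschitzOnWith ((A u).lipschitz.weaken ?_)
  rw [← NNReal.coe_le_coe]
  exact (hC u (Ioo_subset_Icc_self hu)).trans (Real.le_coe_toNNReal C)

/-- Inverse distance of the position part of `x` to the point `(e, 0)`. -/
noncomputable def invDist (e : ℝ) (x : V4) : ℝ := (Real.sqrt ((x 0 - e) ^ 2 + (x 1) ^ 2))⁻¹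

/-- Coordinate functional on phase space. -/
abbrev coordF (i : Fin 4) : V4 →L[ℝ] ℝ := ContinuousLinearMap.proj i

theorem hasFDerivAt_coord (i : Fin 4) (x : V4) : HasFDerivAt (fun y : V4 => y i) (coordF i) x :=
  (coordF i).hasFDerivAt

theorem hasFDerivAt_invDist {e : ℝ} {x : V4} (hx : 0 < (x 0 - e) ^ 2 + (x 1) ^ 2) :
    HasFDerivAt (invDist e)
      (-(invDist e x) ^ 3 • ((x 0 - e) • coordF 0 + x 1 • coordF 1)) x := by
  have h1 : HasFDerivAt (fun y : V4 => (y 0 - e) ^ 2 + (y 1) ^ 2)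
      ((2 * (x 0 - e)) • coordF 0 + (2 * x 1) • coordF 1) x := by
    have := (((hasFDerivAt_coord 0 x).sub_const e).pow 2).add ((hasFDerivAt_coord 1 x).pow 2)
    refine this.congr_fderiv ?_
    simp
  have hs := Real.sqrt_pos.2 hx
  have h2 := (hasDerivAt_inv hs.ne').comp_hasFDerivAt x (h1.sqrt hx.ne')
  refine h2.congr_fderiv ?_
  ext v
  simp only [invDist, _root_.smul_apply, _root_.add_apply,
    ContinuousLinearMap.proj_apply, smul_eq_mul]
  field_simp

/-- First component of the gradient of the (positive) Newtonian attraction towards the primaries. -/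
noncomputable def attr0 (μ : ℝ) (x : V4) : ℝ :=
  (1 - μ) * ((x 0 + μ) * invDist (-μ) x ^ 3) + μ * ((x 0 - (1 - μ)) * invDist (1 - μ) x ^ 3)

/-- Second component of the gradient of the (positive) Newtonian attraction. -/
noncomputable def attr1 (μ : ℝ) (x : V4) : ℝ :=
  (1 - μ) * (x 1 * invDist (-μ) x ^ 3) + μ * (x 1 * invDist (1 - μ) x ^ 3)

theorem dom_iff {μ : ℝ} {x : V4} : x ∈ JacobiDom μ ↔
    0 < (x 0 - (-μ)) ^ 2 + (x 1) ^ 2 ∧ 0 < (x 0 - (1 - μ)) ^ 2 + (x 1) ^ 2 := by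
  have key : ∀ e : ℝ, (x 0, x 1) ≠ (e, 0) ↔ 0 < (x 0 - e) ^ 2 + (x 1) ^ 2 := by
    intro e
    rw [not_iff_comm, not_lt]
    constructor
    · intro h
      have h0 : x 0 - e = 0 := by nlinarith [sq_nonneg (x 0 - e), sq_nonneg (x 1)]
      have h1 : x 1 = 0 := by nlinarith [sq_nonneg (x 0 - e), sq_nonneg (x 1)]
      rw [h1, sub_eq_zero.1 h0]
    · intro h
      rw [Prod.mk.injEq] at h
      rw [h.1, h.2]
      norm_num
  rw [JacobiDom, mem_ofPred_eq, key, key]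

theorem isOpen_dom (μ : ℝ) : IsOpen (JacobiDom μ) := by
  have : JacobiDom μ = {x | 0 < (x 0 - (-μ)) ^ 2 + (x 1) ^ 2} ∩
      {x | 0 < (x 0 - (1 - μ)) ^ 2 + (x 1) ^ 2} := by
    ext x
    exact dom_iff
  rw [this]
  refine IsOpen.inter ?_ ?_ <;> exact isOpen_lt continuous_const (by fun_prop)

theorem jacobiH_eq (μ : ℝ) : JacobiH μ = fun x => (1 / 2) * ((x 2) ^ 2 + (x 3) ^ 2) + x 0 * x 3
    - x 1 * x 2 - (1 - μ) * invDist (-μ) x - μ * invDist (1 - μ) x := by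
  ext x
  simp only [JacobiH, invDist, sub_neg_eq_add, div_eq_mul_inv]

theorem hasFDerivAt_jacobiH {μ : ℝ} {x : V4} (hx : x ∈ JacobiDom μ) :
    HasFDerivAt (JacobiH μ) ((x 3 + attr0 μ x) • coordF 0 + (attr1 μ x - x 2) • coordF 1
      + (x 2 - x 1) • coordF 2 + (x 3 + x 0) • coordF 3) x := by
  obtain ⟨h1, h2⟩ := dom_iff.1 hx
  have c := fun i => hasFDerivAt_coord i x
  have := ((((((((c 2).pow 2).add ((c 3).pow 2)).const_mul (1 / 2)).add ((c 0).mul (c 3))).sub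
    ((c 1).mul (c 2))).sub ((hasFDerivAt_invDist h1).const_mul (1 - μ))).sub
    ((hasFDerivAt_invDist h2).const_mul μ))
  rw [jacobiH_eq]
  refine this.congr_fderiv ?_
  ext v
  simp [attr0, attr1]
  ring

theorem symplGrad_jacobiH {μ : ℝ} {x : V4} (hx : x ∈ JacobiDom μ) :
    symplGrad (JacobiH μ) x
      = ![x 2 - x 1, x 3 + x 0, -(x 3 + attr0 μ x), x 2 - attr1 μ x] := by
  rw [symplGrad, (hasFDerivAt_jacobiH hx).fderiv]
  ext i
  fin_cases i <;> simp

/-- Entry `∂²/∂q₁²` of the Hessian of the attraction potential. -/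
noncomputable def tide00 (μ : ℝ) (x : V4) : ℝ :=
  (1 - μ) * (3 * (x 0 + μ) ^ 2 * invDist (-μ) x ^ 5 - invDist (-μ) x ^ 3)
    + μ * (3 * (x 0 - (1 - μ)) ^ 2 * invDist (1 - μ) x ^ 5 - invDist (1 - μ) x ^ 3)

/-- Entry `∂²/∂q₁∂q₂` of the Hessian of the attraction potential. -/
noncomputable def tide01 (μ : ℝ) (x : V4) : ℝ :=
  (1 - μ) * (3 * (x 0 + μ) * x 1 * invDist (-μ) x ^ 5)
    + μ * (3 * (x 0 - (1 - μ)) * x 1 * invDist (1 - μ) x ^ 5)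

/-- Entry `∂²/∂q₂²` of the Hessian of the attraction potential. -/
noncomputable def tide11 (μ : ℝ) (x : V4) : ℝ :=
  (1 - μ) * (3 * (x 1) ^ 2 * invDist (-μ) x ^ 5 - invDist (-μ) x ^ 3)
    + μ * (3 * (x 1) ^ 2 * invDist (1 - μ) x ^ 5 - invDist (1 - μ) x ^ 3)

theorem hasFDerivAt_attr0 {μ : ℝ} {x : V4} (hx : x ∈ JacobiDom μ) :
    HasFDerivAt (attr0 μ) (-tide00 μ x • coordF 0 + -tide01 μ x • coordF 1) x := by
  obtain ⟨h1, h2⟩ := dom_iff.1 hx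
  have c := fun i => hasFDerivAt_coord i x
  have := ((((c 0).add_const μ).mul ((hasFDerivAt_invDist h1).pow 3)).const_mul (1 - μ)).add
    ((((c 0).sub_const (1 - μ)).mul ((hasFDerivAt_invDist h2).pow 3)).const_mul μ)
  refine this.congr_fderiv ?_
  ext v
  simp [tide00, tide01]
  ring

theorem hasFDerivAt_attr1 {μ : ℝ} {x : V4} (hx : x ∈ JacobiDom μ) :
    HasFDerivAt (attr1 μ) (-tide01 μ x • coordF 0 + -tide11 μ x • coordF 1) x := by
  obtain ⟨h1, h2⟩ := dom_iff.1 hx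
  have c := fun i => hasFDerivAt_coord i x
  have := (((c 1).mul ((hasFDerivAt_invDist h1).pow 3)).const_mul (1 - μ)).add
    (((c 1).mul ((hasFDerivAt_invDist h2).pow 3)).const_mul μ)
  refine this.congr_fderiv ?_
  ext v
  simp [tide01, tide11]
  ring

/-- The Jacobi vector field is differentiable, with explicit derivative. -/
theorem hasFDerivAt_symplGrad {μ : ℝ} {x : V4} (hx : x ∈ JacobiDom μ) :
    HasFDerivAt (symplGrad (JacobiH μ)) (ContinuousLinearMap.pi
      ![coordF 2 - coordF 1, coordF 3 + coordF 0,
        tide00 μ x • coordF 0 + tide01 μ x • coordF 1 - coordF 3,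
        tide01 μ x • coordF 0 + tide11 μ x • coordF 1 + coordF 2]) x := by
  have he : symplGrad (JacobiH μ) =ᶠ[nhds x]
      fun x => ![x 2 - x 1, x 3 + x 0, -(x 3 + attr0 μ x), x 2 - attr1 μ x] := by
    filter_upwards [(isOpen_dom μ).mem_nhds hx] with y hy
    exact symplGrad_jacobiH hy
  refine HasFDerivAt.congr_of_eventuallyEq ?_ he
  have c := fun i => hasFDerivAt_coord i x
  rw [hasFDerivAt_pi']
  intro i
  fin_cases i
  · exact ((c 2).sub (c 1)).congr_fderiv (by ext v; simp)
  · exact ((c 3).add (c 0)).congr_fderiv (by ext v; simp)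
  · exact ((c 3).add (hasFDerivAt_attr0 hx)).neg.congr_fderiv (by ext v; simp; ring)
  · exact ((c 2).sub (hasFDerivAt_attr1 hx)).congr_fderiv (by ext v; simp; ring)

/-- Squared velocity `|q̇|²` in the rotating frame. -/
def speedSq (x : V4) : ℝ := (x 2 - x 1) ^ 2 + (x 3 + x 0) ^ 2

/-- Squared norm of `ṗ`. -/
noncomputable def forceSq (μ : ℝ) (x : V4) : ℝ := (x 3 + attr0 μ x) ^ 2 + (x 2 - attr1 μ x) ^ 2

/-- The potential of the normal variational equation. -/
noncomputable def normalCurv (μ : ℝ) (x : V4) : ℝ :=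
  (2 * forceSq μ x / speedSq x - (tide00 μ x + tide11 μ x)) / speedSq x

theorem orbit_components {μ : ℝ} {γ : ℝ → V4} (hγ : IsOrbit (JacobiH μ) (JacobiDom μ) γ) (t : ℝ) :
    HasDerivAt (fun t => γ t 0) (γ t 2 - γ t 1) t ∧ HasDerivAt (fun t => γ t 1) (γ t 3 + γ t 0) t ∧
    HasDerivAt (fun t => γ t 2) (-(γ t 3 + attr0 μ (γ t))) t ∧
    HasDerivAt (fun t => γ t 3) (γ t 2 - attr1 μ (γ t)) t := by
  obtain ⟨h1, h2⟩ := hγ t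
  rw [symplGrad_jacobiH h1, hasDerivAt_pi] at h2
  exact ⟨h2 0, h2 1, h2 2, h2 3⟩

theorem attr_along {μ : ℝ} {γ : ℝ → V4} (hγ : IsOrbit (JacobiH μ) (JacobiDom μ) γ) (t : ℝ) :
    HasDerivAt (fun t => attr0 μ (γ t))
      (-tide00 μ (γ t) * (γ t 2 - γ t 1) - tide01 μ (γ t) * (γ t 3 + γ t 0)) t ∧
    HasDerivAt (fun t => attr1 μ (γ t))
      (-tide01 μ (γ t) * (γ t 2 - γ t 1) - tide11 μ (γ t) * (γ t 3 + γ t 0)) t := by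
  obtain ⟨h1, h2⟩ := hγ t
  rw [symplGrad_jacobiH h1] at h2
  constructor
  · refine ((hasFDerivAt_attr0 h1).comp_hasDerivAt t h2).congr_deriv ?_
    simp
    ring
  · refine ((hasFDerivAt_attr1 h1).comp_hasDerivAt t h2).congr_deriv ?_
    simp
    ring

theorem variation_components {μ : ℝ} {γ v : ℝ → V4}
    (hγ : IsOrbit (JacobiH μ) (JacobiDom μ) γ)
    (hv : ∀ t : ℝ, HasDerivAt v (fderiv ℝ (symplGrad (JacobiH μ)) (γ t) (v t)) t) (t : ℝ) :
    HasDerivAt (fun t => v t 0) (v t 2 - v t 1) t ∧ HasDerivAt (fun t => v t 1) (v t 3 + v t 0) t ∧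
    HasDerivAt (fun t => v t 2) (tide00 μ (γ t) * v t 0 + tide01 μ (γ t) * v t 1 - v t 3) t ∧
    HasDerivAt (fun t => v t 3) (tide01 μ (γ t) * v t 0 + tide11 μ (γ t) * v t 1 + v t 2) t := by
  have h2 := hv t
  rw [(hasFDerivAt_symplGrad (hγ t).1).fderiv, hasDerivAt_pi] at h2
  refine ⟨(h2 0).congr_deriv ?_, (h2 1).congr_deriv ?_, (h2 2).congr_deriv ?_,
    (h2 3).congr_deriv ?_⟩ <;> simp

theorem variation_energy {μ : ℝ} {γ v : ℝ → V4}
    (hγ : IsOrbit (JacobiH μ) (JacobiDom μ) γ)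
    (hv : ∀ t : ℝ, HasDerivAt v (fderiv ℝ (symplGrad (JacobiH μ)) (γ t) (v t)) t)
    (h0 : fderiv ℝ (JacobiH μ) (γ 0) (v 0) = 0) (t : ℝ) :
    (γ t 3 + attr0 μ (γ t)) * v t 0 + (attr1 μ (γ t) - γ t 2) * v t 1
      + (γ t 2 - γ t 1) * v t 2 + (γ t 3 + γ t 0) * v t 3 = 0 := by
  set E : ℝ → ℝ := fun t => (γ t 3 + attr0 μ (γ t)) * v t 0 + (attr1 μ (γ t) - γ t 2) * v t 1
      + (γ t 2 - γ t 1) * v t 2 + (γ t 3 + γ t 0) * v t 3 with hE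
  have hd : ∀ t, HasDerivAt E 0 t := by
    intro t
    obtain ⟨g0, g1, g2, g3⟩ := orbit_components hγ t
    obtain ⟨a0, a1⟩ := attr_along hγ t
    obtain ⟨v0, v1, v2, v3⟩ := variation_components hγ hv t
    refine HasDerivAt.congr_deriv (((((g3.fun_add a0).fun_mul v0).fun_add
      ((a1.fun_sub g2).fun_mul v1)).fun_add ((g2.fun_sub g1).fun_mul v2)).fun_add
      ((g3.fun_add g0).fun_mul v3)) ?_
    ring
  have hc : E t = E 0 := is_const_of_deriv_eq_zero (fun t => (hd t).differentiableAt)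
    (fun t => (hd t).deriv) t 0
  have h00 : E 0 = 0 := by
    rw [(hasFDerivAt_jacobiH (hγ 0).1).fderiv] at h0
    simpa [hE] using h0
  change E t = 0
  rw [hc, h00]

/-- Sturm-type criterion for transverse non-degeneracy of a periodic orbit. -/
theorem transverseNondeg_of_bounds {μ T V₁ q₁ : ℝ} {γ : ℝ → V4} (hT : 0 < T)
    (hγ : IsOrbit (JacobiH μ) (JacobiDom μ) γ) (hper : ∀ t, γ (t + T) = γ t)
    (hV0 : ∀ t, 0 < speedSq (γ t)) (hV : ∀ t, speedSq (γ t) ≤ V₁)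
    (hq0 : ∀ t, 0 < normalCurv μ (γ t)) (hq : ∀ t, normalCurv μ (γ t) ≤ q₁)
    (hlt : T ^ 2 * (q₁ * V₁) < 4 * Real.pi ^ 2) : TransverseNondeg (JacobiH μ) T γ := by
  intro v hv hvT hv0
  have hγc : Continuous γ := continuous_iff_continuousAt.2 fun t => (hγ t).2.continuousAt
  have hinv : ∀ e : ℝ, (∀ t, 0 < (γ t 0 - e) ^ 2 + (γ t 1) ^ 2) →
      Continuous fun t => invDist e (γ t) := by
    intro e he
    unfold invDist
    refine Continuous.inv₀ (by fun_prop) fun t => (Real.sqrt_pos.2 (he t)).ne'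
  have hi1 := hinv (-μ) fun t => (dom_iff.1 (hγ t).1).1
  have hi2 := hinv (1 - μ) fun t => (dom_iff.1 (hγ t).1).2
  have hA : Continuous fun t => fderiv ℝ (symplGrad (JacobiH μ)) (γ t) := by
    have e : (fun t => fderiv ℝ (symplGrad (JacobiH μ)) (γ t)) = fun t =>
        ContinuousLinearMap.pi ![coordF 2 - coordF 1, coordF 3 + coordF 0,
        tide00 μ (γ t) • coordF 0 + tide01 μ (γ t) • coordF 1 - coordF 3,
        tide01 μ (γ t) • coordF 0 + tide11 μ (γ t) • coordF 1 + coordF 2] :=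
      funext fun t => (hasFDerivAt_symplGrad (hγ t).1).fderiv
    rw [e]
    have c00 : Continuous fun t => tide00 μ (γ t) := by unfold tide00; fun_prop
    have c01 : Continuous fun t => tide01 μ (γ t) := by unfold tide01; fun_prop
    have c11 : Continuous fun t => tide11 μ (γ t) := by unfold tide11; fun_prop
    refine continuous_clm_apply.2 fun x => continuous_pi fun i => ?_
    fin_cases i <;> simp <;> fun_prop
  have hvper : (fun t => v (t + T)) = v := by
    refine linear_ode_unique hA (fun t => ?_) hv (t₀ := 0) (by simpa using hvT)
    have := (hv (t + T)).comp_add_const t T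
    rwa [hper] at this
  have hvper' : ∀ t, v (t + T) = v t := fun t => congrFun hvper t
  set n : ℝ → ℝ := fun t => (γ t 2 - γ t 1) * v t 1 - (γ t 3 + γ t 0) * v t 0 with hn
  set m : ℝ → ℝ := fun t => (-(γ t 3 + attr0 μ (γ t)) - (γ t 3 + γ t 0)) * v t 1
    - ((γ t 2 - attr1 μ (γ t)) + (γ t 2 - γ t 1)) * v t 0
    + (γ t 2 - γ t 1) * (v t 3 + v t 0) - (γ t 3 + γ t 0) * (v t 2 - v t 1) with hm
  have hE := variation_energy hγ hv hv0
  have hnd : ∀ t, HasDerivAt n (speedSq (γ t) * (m t / speedSq (γ t))) t := by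
    intro t
    obtain ⟨g0, g1, g2, g3⟩ := orbit_components hγ t
    obtain ⟨v0, v1, v2, v3⟩ := variation_components hγ hv t
    refine HasDerivAt.congr_deriv (((g2.fun_sub g1).fun_mul v1).fun_sub
      ((g3.fun_add g0).fun_mul v0)) ?_
    rw [mul_div_cancel₀ _ (hV0 t).ne']
    simp only [hm]
    ring
  have hyd : ∀ t, HasDerivAt (fun t => m t / speedSq (γ t)) (-normalCurv μ (γ t) * n t) t := by
    intro t
    obtain ⟨g0, g1, g2, g3⟩ := orbit_components hγ t
    obtain ⟨a0, a1⟩ := attr_along hγ t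
    obtain ⟨v0, v1, v2, v3⟩ := variation_components hγ hv t
    have hmd := (((((g3.fun_add a0).fun_neg.fun_sub (g3.fun_add g0)).fun_mul v1).fun_sub
      (((g2.fun_sub a1).fun_add (g2.fun_sub g1)).fun_mul v0)).fun_add
      ((g2.fun_sub g1).fun_mul (v3.fun_add v0))).fun_sub
      ((g3.fun_add g0).fun_mul (v2.fun_sub v1))
    have hVd := ((g2.fun_sub g1).fun_pow 2).fun_add ((g3.fun_add g0).fun_pow 2)
    have hVne : (γ t 2 - γ t 1) ^ 2 + (γ t 3 + γ t 0) ^ 2 ≠ 0 := (hV0 t).ne'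
    refine HasDerivAt.congr_deriv (hmd.fun_div hVd hVne) ?_
    have he := hE t
    simp only [normalCurv, forceSq, speedSq, hn]
    generalize attr0 μ (γ t) = f0 at *
    generalize attr1 μ (γ t) = f1 at *
    generalize tide00 μ (γ t) = t00 at *
    generalize tide01 μ (γ t) = t01 at *
    generalize tide11 μ (γ t) = t11 at *
    generalize γ t 0 = x0 at *
    generalize γ t 1 = x1 at *
    generalize γ t 2 = x2 at *
    generalize γ t 3 = x3 at *
    generalize v t 0 = y0 at *
    generalize v t 1 = y1 at *
    generalize v t 2 = y2 at *
    generalize v t 3 = y3 at *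
    field_simp
    push_cast
    linear_combination (2 * ((x2 - x1) ^ 2 + (x3 + x0) ^ 2)
      - 2 * ((x2 - x1) * ((x2 - f1) + (x2 - x1)) - (x3 + x0) * (-(x3 + f0) - (x3 + x0)))) * he
  obtain ⟨t₁, ht1, ht2⟩ := periodic_oscillator_vanishes hT hnd hyd hV0 hV hq0 hq
    (fun t => by simp only [hn, hper, hvper']) (fun t => by simp only [hm, hper, hvper']) hlt
  have hm0 : m t₁ = 0 := by
    rcases div_eq_zero_iff.1 ht2 with h | h
    · exact h
    · exact absurd h (hV0 t₁).ne'
  set lam : ℝ := ((γ t₁ 2 - γ t₁ 1) * v t₁ 0 + (γ t₁ 3 + γ t₁ 0)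
      * v t₁ 1) / speedSq (γ t₁) with hlam
  have hX : v t₁ = lam • symplGrad (JacobiH μ) (γ t₁) := by
    rw [symplGrad_jacobiH (hγ t₁).1]
    have he := hE t₁
    have hVne := (hV0 t₁).ne'
    simp only [hn] at ht1
    simp only [hm] at hm0
    have hl : lam * speedSq (γ t₁) = (γ t₁ 2 - γ t₁ 1) * v t₁ 0 + (γ t₁ 3 + γ t₁ 0) * v t₁ 1 :=
      div_mul_cancel₀ _ hVne
    have c0 : v t₁ 0 = lam * (γ t₁ 2 - γ t₁ 1) := by
      apply mul_right_cancel₀ hVne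
      unfold speedSq at hl ⊢
      linear_combination -(γ t₁ 2 - γ t₁ 1) * hl - (γ t₁ 3 + γ t₁ 0) * ht1
    have c1 : v t₁ 1 = lam * (γ t₁ 3 + γ t₁ 0) := by
      apply mul_right_cancel₀ hVne
      unfold speedSq at hl ⊢
      linear_combination -(γ t₁ 3 + γ t₁ 0) * hl + (γ t₁ 2 - γ t₁ 1) * ht1
    rw [c0, c1] at he hm0
    have c2 : v t₁ 2 = lam * -(γ t₁ 3 + attr0 μ (γ t₁)) := by
      apply mul_right_cancel₀ hVne
      unfold speedSq
      linear_combination (γ t₁ 2 - γ t₁ 1) * he - (γ t₁ 3 + γ t₁ 0) * hm0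
    have c3 : v t₁ 3 = lam * (γ t₁ 2 - attr1 μ (γ t₁)) := by
      apply mul_right_cancel₀ hVne
      unfold speedSq
      linear_combination (γ t₁ 3 + γ t₁ 0) * he + (γ t₁ 2 - γ t₁ 1) * hm0
    ext i
    fin_cases i
    · simpa using c0
    · simpa using c1
    · simpa using c2
    · simpa using c3
  have hfin : v = fun t => lam • symplGrad (JacobiH μ) (γ t) := by
    refine linear_ode_unique hA hv (fun t => ?_) (t₀ := t₁) hX
    have h1 := ((hasFDerivAt_symplGrad (hγ t).1).differentiableAt.hasFDerivAt.comp_hasDerivAt t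
      (hγ t).2).const_smul lam
    rw [map_smul]
    exact h1
  exact ⟨lam, congrFun hfin 0⟩

theorem legendre_upper {t C : ℝ} (ht : 0 ≤ t) (ht' : t ≤ 2 / 5) (hC : -1 ≤ C)
    (hC' : C ≤ 1) : 1 ≤ (1 + t * C + t ^ 2 * ((3 * C ^ 2 - 1) / 2)
        + t ^ 3 * ((5 * C ^ 3 - 3 * C) / 2)
      + 1.67 * t ^ 4) ^ 2 * (1 - 2 * t * C + t ^ 2) := by
  obtain ⟨hb, hu, hv⟩ : 0 ≤ 2 / 5 - t ∧ 0 ≤ C - (-1) ∧ 0 ≤ 1 - C :=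
    ⟨by linarith, by linarith, by linarith⟩
  have key : ∀ b u v : ℝ, 0 ≤ b → 0 ≤ u → 0 ≤ v → b = 2 / 5 - t → u = C - (-1) → v = 1 - C →
    1 ≤ (1 + t * C + t ^ 2 * ((3 * C ^ 2 - 1) / 2) + t ^ 3 * ((5 * C ^ 3 - 3 * C) / 2)
      + 1.67 * t ^ 4) ^ 2 * (1 - 2 * t * C + t ^ 2) := by
    intro b u v hb hu hv eb eu ev
    have h0 : 0 ≤ t ^ 4 * (t ^ 0 * b ^ 6) * (
        41875/16384 * (u ^ 0 * v ^ 7) + 1543125/16384 * (u ^ 1 * v ^ 6) +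
        2754375/16384 * (u ^ 2 * v ^ 5) + 840625/16384 * (u ^ 3 * v ^ 4) +
        840625/16384 * (u ^ 4 * v ^ 3) + 2754375/16384 * (u ^ 5 * v ^ 2) +
        1543125/16384 * (u ^ 6 * v ^ 1) + 41875/16384 * (u ^ 7 * v ^ 0)) := by positivity
    have h1 : 0 ≤ t ^ 4 * (t ^ 1 * b ^ 5) * (
        36625/2048 * (u ^ 0 * v ^ 7) + 2316875/4096 * (u ^ 1 * v ^ 6) +
        1106375/1024 * (u ^ 2 * v ^ 5) + 1563125/4096 * (u ^ 3 * v ^ 4) +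
        479375/2048 * (u ^ 4 * v ^ 3) + 3837625/4096 * (u ^ 5 * v ^ 2) +
        578125/1024 * (u ^ 6 * v ^ 1) + 52375/4096 * (u ^ 7 * v ^ 0)) := by positivity
    have h2 : 0 ≤ t ^ 4 * (t ^ 2 * b ^ 4) * (
        836875/16384 * (u ^ 0 * v ^ 7) + 23304025/16384 * (u ^ 1 * v ^ 6) +
        46761375/16384 * (u ^ 2 * v ^ 5) + 19587125/16384 * (u ^ 3 * v ^ 4) +
        7499625/16384 * (u ^ 4 * v ^ 3) + 35003875/16384 * (u ^ 5 * v ^ 2) +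
        23216525/16384 * (u ^ 6 * v ^ 1) + 419375/16384 * (u ^ 7 * v ^ 0)) := by positivity
    have h3 : 0 ≤ t ^ 4 * (t ^ 3 * b ^ 3) * (
        156875/2048 * (u ^ 0 * v ^ 7) + 979945/512 * (u ^ 1 * v ^ 6) +
        8182115/2048 * (u ^ 2 * v ^ 5) + 122755/64 * (u ^ 3 * v ^ 4) +
        1208965/2048 * (u ^ 4 * v ^ 3) + 644595/256 * (u ^ 5 * v ^ 2) +
        3909245/2048 * (u ^ 6 * v ^ 1) + 13125/512 * (u ^ 7 * v ^ 0)) := by positivity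
    have h4 : 0 ≤ t ^ 4 * (t ^ 4 * b ^ 2) * (
        26149603/409600 * (u ^ 0 * v ^ 7) + 595519821/409600 * (u ^ 1 * v ^ 6) +
        1291064663/409600 * (u ^ 2 * v ^ 5) + 132739221/81920 * (u ^ 3 * v ^ 4) +
        48185821/81920 * (u ^ 4 * v ^ 3) + 651601663/409600 * (u ^ 5 * v ^ 2) +
        597948821/409600 * (u ^ 6 * v ^ 1) + 5274603/409600 * (u ^ 7 * v ^ 0)) := by positivity
    have h5 : 0 ≤ t ^ 4 * (t ^ 5 * b ^ 1) * (
        14419823/512000 * (u ^ 0 * v ^ 7) + 30370263/51200 * (u ^ 1 * v ^ 6) +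
        687958497/512000 * (u ^ 2 * v ^ 5) + 8573871/12800 * (u ^ 3 * v ^ 4) +
        38134137/102400 * (u ^ 4 * v ^ 3) + 126822409/256000 * (u ^ 5 * v ^ 2) +
        12343259/20480 * (u ^ 6 * v ^ 1) + 20753/8000 * (u ^ 7 * v ^ 0)) := by positivity
    have h6 : 0 ≤ t ^ 4 * (t ^ 6 * b ^ 0) * (
        53160747/10240000 * (u ^ 0 * v ^ 7) + 1049237609/10240000 * (u ^ 1 * v ^ 6) +
        2514219967/10240000 * (u ^ 2 * v ^ 5) + 211154369/2048000 * (u ^ 3 * v ^ 4) +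
        205407749/2048000 * (u ^ 4 * v ^ 3) + 566496387/10240000 * (u ^ 5 * v ^ 2) +
        1077164509/10240000 * (u ^ 6 * v ^ 1) + 78127/10240000 * (u ^ 7 * v ^ 0)) := by positivity
    subst eb eu ev
    linear_combination h0 + h1 + h2 + h3 + h4 + h5 + h6
  exact key _ _ _ hb hu hv rfl rfl rfl

theorem legendre_lower_neg {t C : ℝ} (ht : 0 ≤ t) (ht' : t ≤ 2 / 5) (hC : -1 ≤ C)
    (hC' : C ≤ 0) : (1 + t * C + t ^ 2 * ((3 * C ^ 2 - 1) / 2) + t ^ 3 * ((5 * C ^ 3 - 3 * C) / 2)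
      - 0.8 * t ^ 4) ^ 2 * (1 - 2 * t * C + t ^ 2) ≤ 1 := by
  obtain ⟨hb, hu, hv⟩ : 0 ≤ 2 / 5 - t ∧ 0 ≤ C - (-1) ∧ 0 ≤ 0 - C :=
    ⟨by linarith, by linarith, by linarith⟩
  have key : ∀ b u v : ℝ, 0 ≤ b → 0 ≤ u → 0 ≤ v → b = 2 / 5 - t → u = C - (-1) → v = 0 - C →
    (1 + t * C + t ^ 2 * ((3 * C ^ 2 - 1) / 2) + t ^ 3 * ((5 * C ^ 3 - 3 * C) / 2)
      - 0.8 * t ^ 4) ^ 2 * (1 - 2 * t * C + t ^ 2) ≤ 1 := by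
    intro b u v hb hu hv eb eu ev
    have h0 : 0 ≤ t ^ 4 * (t ^ 0 * b ^ 6) * (
        28125/32 * (u ^ 0 * v ^ 7) + 40625/32 * (u ^ 1 * v ^ 6) + 9375/64 * (u ^ 2 * v ^ 5) +
        15625/4 * (u ^ 3 * v ^ 4) + 2796875/256 * (u ^ 4 * v ^ 3) +
        2615625/256 * (u ^ 5 * v ^ 2) + 1028125/256 * (u ^ 6 * v ^ 1) +
        146875/256 * (u ^ 7 * v ^ 0)) := by positivity
    have h1 : 0 ≤ t ^ 4 * (t ^ 1 * b ^ 5) * (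
        86875/16 * (u ^ 0 * v ^ 7) + 149375/16 * (u ^ 1 * v ^ 6) + 128125/32 * (u ^ 2 * v ^ 5) +
        196875/8 * (u ^ 3 * v ^ 4) + 8253125/128 * (u ^ 4 * v ^ 3) +
        7741875/128 * (u ^ 5 * v ^ 2) + 3066875/128 * (u ^ 6 * v ^ 1) +
        440625/128 * (u ^ 7 * v ^ 0)) := by positivity
    have h2 : 0 ≤ t ^ 4 * (t ^ 2 * b ^ 4) * (
        446875/32 * (u ^ 0 * v ^ 7) + 876375/32 * (u ^ 1 * v ^ 6) +
        1177625/64 * (u ^ 2 * v ^ 5) + 265625/4 * (u ^ 3 * v ^ 4) +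
        40993125/256 * (u ^ 4 * v ^ 3) + 38344375/256 * (u ^ 5 * v ^ 2) +
        15285375/256 * (u ^ 6 * v ^ 1) + 2208625/256 * (u ^ 7 * v ^ 0)) := by positivity
    have h3 : 0 ≤ t ^ 4 * (t ^ 3 * b ^ 3) * (
        153125/8 * (u ^ 0 * v ^ 7) + 333425/8 * (u ^ 1 * v ^ 6) + 576075/16 * (u ^ 2 * v ^ 5) +
        388825/4 * (u ^ 3 * v ^ 4) + 13711675/64 * (u ^ 4 * v ^ 3) +
        12717325/64 * (u ^ 5 * v ^ 2) + 5092325/64 * (u ^ 6 * v ^ 1) +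
        739875/64 * (u ^ 7 * v ^ 0)) := by positivity
    have h4 : 0 ≤ t ^ 4 * (t ^ 4 * b ^ 2) * (
        471227/32 * (u ^ 0 * v ^ 7) + 1122359/32 * (u ^ 1 * v ^ 6) +
        2276129/64 * (u ^ 2 * v ^ 5) + 161345/2 * (u ^ 3 * v ^ 4) +
        41649685/256 * (u ^ 4 * v ^ 3) + 38104311/256 * (u ^ 5 * v ^ 2) +
        15295147/256 * (u ^ 6 * v ^ 1) + 2233821/256 * (u ^ 7 * v ^ 0)) := by positivity
    have h5 : 0 ≤ t ^ 4 * (t ^ 5 * b ^ 1) * (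
        480559/80 * (u ^ 0 * v ^ 7) + 1245939/80 * (u ^ 1 * v ^ 6) +
        561853/32 * (u ^ 2 * v ^ 5) + 286063/8 * (u ^ 3 * v ^ 4) +
        8494981/128 * (u ^ 4 * v ^ 3) + 38143807/640 * (u ^ 5 * v ^ 2) +
        15311527/640 * (u ^ 6 * v ^ 1) + 449321/128 * (u ^ 7 * v ^ 0)) := by positivity
    have h6 : 0 ≤ t ^ 4 * (t ^ 6 * b ^ 0) * (
        805653/800 * (u ^ 0 * v ^ 7) + 2283081/800 * (u ^ 1 * v ^ 6) +
        5506671/1600 * (u ^ 2 * v ^ 5) + 65661/10 * (u ^ 3 * v ^ 4) +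
        14487463/1280 * (u ^ 4 * v ^ 3) + 63570529/6400 * (u ^ 5 * v ^ 2) +
        25446673/6400 * (u ^ 6 * v ^ 1) + 3747679/6400 * (u ^ 7 * v ^ 0)) := by positivity
    subst eb eu ev
    linear_combination h0 + h1 + h2 + h3 + h4 + h5 + h6
  exact key _ _ _ hb hu hv rfl rfl rfl

theorem legendre_lower_mid {t C : ℝ} (ht : 0 ≤ t) (ht' : t ≤ 2 / 5) (hC : 0 ≤ C)
    (hC' : C ≤ 1/2) : (1 + t * C + t ^ 2 * ((3 * C ^ 2 - 1) / 2) + t ^ 3 * ((5 * C ^ 3 - 3 * C) / 2)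
      - 0.8 * t ^ 4) ^ 2 * (1 - 2 * t * C + t ^ 2) ≤ 1 := by
  obtain ⟨hb, hu, hv⟩ : 0 ≤ 2 / 5 - t ∧ 0 ≤ C - (0) ∧ 0 ≤ 1/2 - C :=
    ⟨by linarith, by linarith, by linarith⟩
  have key : ∀ b u v : ℝ, 0 ≤ b → 0 ≤ u → 0 ≤ v → b = 2 / 5 - t → u = C - (0) → v = 1/2 - C →
    (1 + t * C + t ^ 2 * ((3 * C ^ 2 - 1) / 2) + t ^ 3 * ((5 * C ^ 3 - 3 * C) / 2)
      - 0.8 * t ^ 4) ^ 2 * (1 - 2 * t * C + t ^ 2) ≤ 1 := by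
    intro b u v hb hu hv eb eu ev
    have h0 : 0 ≤ t ^ 4 * (t ^ 0 * b ^ 6) * (
        146875/2 * (u ^ 0 * v ^ 7) + 1028125/2 * (u ^ 1 * v ^ 6) + 5934375/4 * (u ^ 2 * v ^ 5) +
        9109375/4 * (u ^ 3 * v ^ 4) + 64046875/32 * (u ^ 4 * v ^ 3) +
        32240625/32 * (u ^ 5 * v ^ 2) + 8715625/32 * (u ^ 6 * v ^ 1) +
        1021875/32 * (u ^ 7 * v ^ 0)) := by positivity
    have h1 : 0 ≤ t ^ 4 * (t ^ 1 * b ^ 5) * (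
        440625 * (u ^ 0 * v ^ 7) + 3093125 * (u ^ 1 * v ^ 6) + 17908125/2 * (u ^ 2 * v ^ 5) +
        27559375/2 * (u ^ 3 * v ^ 4) + 193940625/16 * (u ^ 4 * v ^ 3) +
        97365625/16 * (u ^ 5 * v ^ 2) + 26074375/16 * (u ^ 6 * v ^ 1) +
        2999375/16 * (u ^ 7 * v ^ 0)) := by positivity
    have h2 : 0 ≤ t ^ 4 * (t ^ 2 * b ^ 4) * (
        2208625/2 * (u ^ 0 * v ^ 7) + 15547875/2 * (u ^ 1 * v ^ 6) +
        90318875/4 * (u ^ 2 * v ^ 5) + 139449375/4 * (u ^ 3 * v ^ 4) +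
        983425625/32 * (u ^ 4 * v ^ 3) + 493262375/32 * (u ^ 5 * v ^ 2) +
        65562375/16 * (u ^ 6 * v ^ 1) + 463000 * (u ^ 7 * v ^ 0)) := by positivity
    have h3 : 0 ≤ t ^ 4 * (t ^ 3 * b ^ 3) * (
        1479750 * (u ^ 0 * v ^ 7) + 10445050 * (u ^ 1 * v ^ 6) + 30445925 * (u ^ 2 * v ^ 5) +
        47191550 * (u ^ 3 * v ^ 4) + 333930475/8 * (u ^ 4 * v ^ 3) +
        167670525/8 * (u ^ 5 * v ^ 2) + 11090125/2 * (u ^ 6 * v ^ 1) +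
        9869225/16 * (u ^ 7 * v ^ 0)) := by positivity
    have h4 : 0 ≤ t ^ 4 * (t ^ 4 * b ^ 2) * (
        2233821/2 * (u ^ 0 * v ^ 7) + 15807547/2 * (u ^ 1 * v ^ 6) +
        92491917/4 * (u ^ 2 * v ^ 5) + 144007745/4 * (u ^ 3 * v ^ 4) +
        1023747085/32 * (u ^ 4 * v ^ 3) + 515715431/32 * (u ^ 5 * v ^ 2) +
        136226077/32 * (u ^ 6 * v ^ 1) + 14970241/32 * (u ^ 7 * v ^ 0)) := by positivity
    have h5 : 0 ≤ t ^ 4 * (t ^ 5 * b ^ 1) * (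
        449321 * (u ^ 0 * v ^ 7) + 15933589/5 * (u ^ 1 * v ^ 6) + 93572333/10 * (u ^ 2 * v ^ 5) +
        29283389/2 * (u ^ 3 * v ^ 4) + 209405881/16 * (u ^ 4 * v ^ 3) +
        106083133/16 * (u ^ 5 * v ^ 2) + 140403069/80 * (u ^ 6 * v ^ 1) +
        3828761/20 * (u ^ 7 * v ^ 0)) := by positivity
    have h6 : 0 ≤ t ^ 4 * (t ^ 6 * b ^ 0) * (
        3747679/50 * (u ^ 0 * v ^ 7) + 26627293/50 * (u ^ 1 * v ^ 6) +
        156920873/100 * (u ^ 2 * v ^ 5) + 49368821/20 * (u ^ 3 * v ^ 4) +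
        355517883/160 * (u ^ 4 * v ^ 3) + 907653369/800 * (u ^ 5 * v ^ 2) +
        60419847/200 * (u ^ 6 * v ^ 1) + 6578001/200 * (u ^ 7 * v ^ 0)) := by positivity
    subst eb eu ev
    linear_combination h0 + h1 + h2 + h3 + h4 + h5 + h6
  exact key _ _ _ hb hu hv rfl rfl rfl

theorem legendre_lower_pos {t C : ℝ} (ht : 0 ≤ t) (ht' : t ≤ 2 / 5) (hC : 1/2 ≤ C)
    (hC' : C ≤ 1) : (1 + t * C + t ^ 2 * ((3 * C ^ 2 - 1) / 2) + t ^ 3 * ((5 * C ^ 3 - 3 * C) / 2)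
      - 0.8 * t ^ 4) ^ 2 * (1 - 2 * t * C + t ^ 2) ≤ 1 := by
  obtain ⟨hb, hu, hv⟩ : 0 ≤ 2 / 5 - t ∧ 0 ≤ C - (1/2) ∧ 0 ≤ 1 - C :=
    ⟨by linarith, by linarith, by linarith⟩
  have key : ∀ b u v : ℝ, 0 ≤ b → 0 ≤ u → 0 ≤ v → b = 2 / 5 - t → u = C - (1/2) → v = 1 - C →
    (1 + t * C + t ^ 2 * ((3 * C ^ 2 - 1) / 2) + t ^ 3 * ((5 * C ^ 3 - 3 * C) / 2)
      - 0.8 * t ^ 4) ^ 2 * (1 - 2 * t * C + t ^ 2) ≤ 1 := by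
    intro b u v hb hu hv eb eu ev
    have h0 : 0 ≤ t ^ 4 * (t ^ 0 * b ^ 6) * (
        1021875/32 * (u ^ 0 * v ^ 7) + 5590625/32 * (u ^ 1 * v ^ 6) +
        13490625/32 * (u ^ 2 * v ^ 5) + 21546875/32 * (u ^ 3 * v ^ 4) +
        3484375/4 * (u ^ 4 * v ^ 3) + 1678125/2 * (u ^ 5 * v ^ 2) + 475000 * (u ^ 6 * v ^ 1) +
        112500 * (u ^ 7 * v ^ 0)) := by positivity
    have h1 : 0 ≤ t ^ 4 * (t ^ 1 * b ^ 5) * (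
        2999375/16 * (u ^ 0 * v ^ 7) + 15916875/16 * (u ^ 1 * v ^ 6) +
        36420625/16 * (u ^ 2 * v ^ 5) + 55078125/16 * (u ^ 3 * v ^ 4) +
        8915625/2 * (u ^ 4 * v ^ 3) + 4499375 * (u ^ 5 * v ^ 2) + 2670000 * (u ^ 6 * v ^ 1) +
        655000 * (u ^ 7 * v ^ 0)) := by positivity
    have h2 : 0 ≤ t ^ 4 * (t ^ 2 * b ^ 4) * (
        463000 * (u ^ 0 * v ^ 7) + 38149625/16 * (u ^ 1 * v ^ 6) +
        164309375/32 * (u ^ 2 * v ^ 5) + 230193125/32 * (u ^ 3 * v ^ 4) +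
        36960625/4 * (u ^ 4 * v ^ 3) + 19762875/2 * (u ^ 5 * v ^ 2) + 6209000 * (u ^ 6 * v ^ 1) +
        1587500 * (u ^ 7 * v ^ 0)) := by positivity
    have h3 : 0 ≤ t ^ 4 * (t ^ 3 * b ^ 3) * (
        9869225/16 * (u ^ 0 * v ^ 7) + 24724075/8 * (u ^ 1 * v ^ 6) +
        49851975/8 * (u ^ 2 * v ^ 5) + 62836275/8 * (u ^ 3 * v ^ 4) + 9826575 * (u ^ 4 * v ^ 3) +
        11309650 * (u ^ 5 * v ^ 2) + 7629600 * (u ^ 6 * v ^ 1) + 2050000 * (u ^ 7 * v ^ 0)) :=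
            by positivity
    have h4 : 0 ≤ t ^ 4 * (t ^ 4 * b ^ 2) * (
        14970241/32 * (u ^ 0 * v ^ 7) + 73357297/32 * (u ^ 1 * v ^ 6) +
        138502751/32 * (u ^ 2 * v ^ 5) + 151510085/32 * (u ^ 3 * v ^ 4) +
        22233145/4 * (u ^ 4 * v ^ 3) + 14092771/2 * (u ^ 5 * v ^ 2) + 5203496 * (u ^ 6 * v ^ 1) +
        1484908 * (u ^ 7 * v ^ 0)) := by positivity
    have h5 : 0 ≤ t ^ 4 * (t ^ 5 * b ^ 1) * (
        3828761/20 * (u ^ 0 * v ^ 7) + 74007547/80 * (u ^ 1 * v ^ 6) +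
        132042533/80 * (u ^ 2 * v ^ 5) + 24231085/16 * (u ^ 3 * v ^ 4) +
        3091513/2 * (u ^ 4 * v ^ 3) + 11184699/5 * (u ^ 5 * v ^ 2) +
        9294512/5 * (u ^ 6 * v ^ 1) + 2853688/5 * (u ^ 7 * v ^ 0)) := by positivity
    have h6 : 0 ≤ t ^ 4 * (t ^ 6 * b ^ 0) * (
        6578001/200 * (u ^ 0 * v ^ 7) + 31672167/200 * (u ^ 1 * v ^ 6) +
        217709049/800 * (u ^ 2 * v ^ 5) + 33108423/160 * (u ^ 3 * v ^ 4) +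
        3154811/20 * (u ^ 4 * v ^ 3) + 13867949/50 * (u ^ 5 * v ^ 2) +
        6760824/25 * (u ^ 6 * v ^ 1) + 2268692/25 * (u ^ 7 * v ^ 0)) := by positivity
    subst eb eu ev
    linear_combination h0 + h1 + h2 + h3 + h4 + h5 + h6
  exact key _ _ _ hb hu hv rfl rfl rfl

theorem legendre_aux_small {t C : ℝ} (ht : 0 ≤ t) (ht' : t ≤ 2 / 5) (hC : 0 ≤ C)
    (hC' : C ≤ 1/2) : 0 ≤ 4.2 - 15 * C ^ 2 + 17.5 * C ^ 4 - 0.2 * t * C - 10 * t * C ^ 3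
        + 3.5 * t ^ 2 := by
  obtain ⟨hb, hu, hv⟩ : 0 ≤ 2 / 5 - t ∧ 0 ≤ C - (0) ∧ 0 ≤ 1/2 - C :=
    ⟨by linarith, by linarith, by linarith⟩
  have key : ∀ b u v : ℝ, 0 ≤ b → 0 ≤ u → 0 ≤ v → b = 2 / 5 - t → u = C - (0) → v = 1/2 - C →
    0 ≤ 4.2 - 15 * C ^ 2 + 17.5 * C ^ 4 - 0.2 * t * C - 10 * t * C ^ 3 + 3.5 * t ^ 2 := by
    intro b u v hb hu hv eb eu ev
    have h0 : 0 ≤ (t ^ 0 * b ^ 2) * (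
        420 * (u ^ 0 * v ^ 4) + 1680 * (u ^ 1 * v ^ 3) + 2145 * (u ^ 2 * v ^ 2) +
        930 * (u ^ 3 * v ^ 1) + 1235/8 * (u ^ 4 * v ^ 0)) := by positivity
    have h1 : 0 ≤ (t ^ 1 * b ^ 1) * (
        840 * (u ^ 0 * v ^ 4) + 3356 * (u ^ 1 * v ^ 3) + 4278 * (u ^ 2 * v ^ 2) +
        1798 * (u ^ 3 * v ^ 1) + 1019/4 * (u ^ 4 * v ^ 0)) := by positivity
    have h2 : 0 ≤ (t ^ 2 * b ^ 0) * (
        476 * (u ^ 0 * v ^ 4) + 1900 * (u ^ 1 * v ^ 3) + 2469 * (u ^ 2 * v ^ 2) +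
        1092 * (u ^ 3 * v ^ 1) + 1251/8 * (u ^ 4 * v ^ 0)) := by positivity
    subst eb eu ev
    linear_combination h0 + h1 + h2
  exact key _ _ _ hb hu hv rfl rfl rfl

theorem legendre_aux_mid {t C : ℝ} (ht : 0 ≤ t) (ht' : t ≤ 2 / 5) (hC : 1/2 ≤ C)
    (hC' : C ≤ 3/4) : 0 ≤ 4.2 - 15 * C ^ 2 + 17.5 * C ^ 4 - 0.2 * t * C - 10 * t * C ^ 3
        + 3.5 * t ^ 2 := by
  obtain ⟨hb, hu, hv⟩ : 0 ≤ 2 / 5 - t ∧ 0 ≤ C - (1/2) ∧ 0 ≤ 3/4 - C :=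
    ⟨by linarith, by linarith, by linarith⟩
  have key : ∀ b u v : ℝ, 0 ≤ b → 0 ≤ u → 0 ≤ v → b = 2 / 5 - t → u = C - (1/2) → v = 3/4 - C →
    0 ≤ 4.2 - 15 * C ^ 2 + 17.5 * C ^ 4 - 0.2 * t * C - 10 * t * C ^ 3 + 3.5 * t ^ 2 := by
    intro b u v hb hu hv eb eu ev
    have h0 : 0 ≤ (t ^ 0 * b ^ 2) * (
        2470 * (u ^ 0 * v ^ 4) + 7380 * (u ^ 1 * v ^ 3) + 8445 * (u ^ 2 * v ^ 2) +
        5505 * (u ^ 3 * v ^ 1) + 16635/8 * (u ^ 4 * v ^ 0)) := by positivity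
    have h1 : 0 ≤ (t ^ 1 * b ^ 1) * (
        4076 * (u ^ 0 * v ^ 4) + 10072 * (u ^ 1 * v ^ 3) + 7410 * (u ^ 2 * v ^ 2) +
        2558 * (u ^ 3 * v ^ 1) + 5451/4 * (u ^ 4 * v ^ 0)) := by positivity
    have h2 : 0 ≤ (t ^ 2 * b ^ 0) * (
        2502 * (u ^ 0 * v ^ 4) + 6276 * (u ^ 1 * v ^ 3) + 4341 * (u ^ 2 * v ^ 2) +
        637 * (u ^ 3 * v ^ 1) + 1435/8 * (u ^ 4 * v ^ 0)) := by positivity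
    subst eb eu ev
    linear_combination h0 + h1 + h2
  exact key _ _ _ hb hu hv rfl rfl rfl

theorem legendre_aux_large {t C : ℝ} (ht : 0 ≤ t) (ht' : t ≤ 2 / 5) (hC : 3/4 ≤ C)
    (hC' : C ≤ 1) : 0 ≤ 4.2 - 15 * C ^ 2 + 17.5 * C ^ 4 - 0.2 * t * C - 10 * t * C ^ 3
        + 3.5 * t ^ 2 := by
  obtain ⟨hb, hu, hv⟩ : 0 ≤ 2 / 5 - t ∧ 0 ≤ C - (3/4) ∧ 0 ≤ 1 - C :=
    ⟨by linarith, by linarith, by linarith⟩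
  have key : ∀ b u v : ℝ, 0 ≤ b → 0 ≤ u → 0 ≤ v → b = 2 / 5 - t → u = C - (3/4) → v = 1 - C →
    0 ≤ 4.2 - 15 * C ^ 2 + 17.5 * C ^ 4 - 0.2 * t * C - 10 * t * C ^ 3 + 3.5 * t ^ 2 := by
    intro b u v hb hu hv eb eu ev
    have h0 : 0 ≤ (t ^ 0 * b ^ 2) * (
        16635/8 * (u ^ 0 * v ^ 4) + 11130 * (u ^ 1 * v ^ 3) + 25320 * (u ^ 2 * v ^ 2) +
        26880 * (u ^ 3 * v ^ 1) + 10720 * (u ^ 4 * v ^ 0)) := by positivity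
    have h1 : 0 ≤ (t ^ 1 * b ^ 1) * (
        5451/4 * (u ^ 0 * v ^ 4) + 8344 * (u ^ 1 * v ^ 3) + 24768 * (u ^ 2 * v ^ 2) +
        32480 * (u ^ 3 * v ^ 1) + 14912 * (u ^ 4 * v ^ 0)) := by positivity
    have h2 : 0 ≤ (t ^ 2 * b ^ 0) * (
        1435/8 * (u ^ 0 * v ^ 4) + 798 * (u ^ 1 * v ^ 3) + 4824 * (u ^ 2 * v ^ 2) +
        9184 * (u ^ 3 * v ^ 1) + 5088 * (u ^ 4 * v ^ 0)) := by positivity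
    subst eb eu ev
    linear_combination h0 + h1 + h2
  exact key _ _ _ hb hu hv rfl rfl rfl

theorem le_of_sq_le_of_nonneg {a b : ℝ} (hb : 0 ≤ b) (h : a ^ 2 ≤ b ^ 2) : a ≤ b :=
  (abs_le_of_sq_le_sq' h hb).2

/-- Generating function of the Legendre polynomials. -/
noncomputable def legF (t C : ℝ) : ℝ := (Real.sqrt (1 - 2 * t * C + t ^ 2))⁻¹

/-- The combination `legF + t ∂ₜ legF`. -/
noncomputable def legG (t C : ℝ) : ℝ := legF t C ^ 3 * (1 - t * C)

theorem legendre_disc_pos {t C : ℝ} (ht : 0 ≤ t) (ht' : t < 1) (hC' : C ≤ 1) :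
    0 < 1 - 2 * t * C + t ^ 2 := by nlinarith [mul_nonneg ht (sub_nonneg.2 hC')]

theorem legF_pos {t C : ℝ} (ht : 0 ≤ t) (ht' : t < 1) (hC' : C ≤ 1) : 0 < legF t C :=
  inv_pos.2 (Real.sqrt_pos.2 (legendre_disc_pos ht ht' hC'))

theorem legF_sq_mul {t C : ℝ} (ht : 0 ≤ t) (ht' : t < 1) (hC' : C ≤ 1) :
    legF t C ^ 2 * (1 - 2 * t * C + t ^ 2) = 1 := by
  have h := legendre_disc_pos ht ht' hC'
  rw [legF, inv_pow, Real.sq_sqrt h.le, inv_mul_cancel₀ h.ne']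

theorem legF_bounds {t C : ℝ} (ht : 0 ≤ t) (ht' : t ≤ 2 / 5) (hC : -1 ≤ C) (hC' : C ≤ 1) :
    1 + t * C + t ^ 2 * ((3 * C ^ 2 - 1) / 2) + t ^ 3 * ((5 * C ^ 3 - 3 * C) / 2) - 0.8 * t ^ 4
      ≤ legF t C ∧
    legF t C ≤ 1 + t * C + t ^ 2 * ((3 * C ^ 2 - 1) / 2) + t ^ 3 * ((5 * C ^ 3 - 3 * C) / 2)
      + 1.67 * t ^ 4 := by
  have h1 : t < 1 := by linarith
  have hD := legendre_disc_pos ht h1 hC'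
  have hf := legF_sq_mul ht h1 hC'
  have hf0 := legF_pos ht h1 hC'
  constructor
  · have hlow : (1 + t * C + t ^ 2 * ((3 * C ^ 2 - 1) / 2) + t ^ 3 * ((5 * C ^ 3 - 3 * C) / 2)
        - 0.8 * t ^ 4) ^ 2 * (1 - 2 * t * C + t ^ 2) ≤ 1 := by
      rcases le_total C 0 with h | h
      · exact legendre_lower_neg ht ht' hC h
      · rcases le_total C (1 / 2) with h2 | h2
        · exact legendre_lower_mid ht ht' h h2
        · exact legendre_lower_pos ht ht' h2 hC'
    refine le_of_sq_le_of_nonneg hf0.le ?_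
    exact le_of_mul_le_mul_right (hlow.trans_eq hf.symm) hD
  · have hup := legendre_upper ht ht' hC hC'
    refine le_of_sq_le_of_nonneg ?_ ?_
    · have h2 : |t * C| ≤ 2 / 5 := by
        rw [abs_mul, abs_of_nonneg ht]
        nlinarith [abs_nonneg C, abs_le.2 ⟨hC, hC'⟩]
      have h3 := abs_le.1 h2
      have h4 : -1 ≤ (5 * C ^ 3 - 3 * C) / 2 := by
        nlinarith [mul_nonneg (by linarith : 0 ≤ C + 1) (sq_nonneg (2 * C - 1)),
            sq_nonneg (C + 1), sq_nonneg C,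
          mul_nonneg (by linarith : 0 ≤ C + 1) (sq_nonneg C)]
      have h5 : t ^ 3 ≤ 0.064 := by
        have := pow_le_pow_left₀ ht ht' 3
        norm_num at this ⊢
        exact this
      nlinarith [pow_nonneg ht 3, mul_nonneg (pow_nonneg ht 3)
          (by linarith : 0 ≤ (5 * C ^ 3 - 3 * C) / 2 + 1),
        pow_nonneg ht 4, mul_nonneg (sq_nonneg t) (sq_nonneg C)]
    · exact le_of_mul_le_mul_right (hf.trans_le hup) hD

theorem legG_bounds {t C : ℝ} (ht : 0 ≤ t) (ht' : t ≤ 2 / 5) (hC : -1 ≤ C) (hC' : C ≤ 1) :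
    1 + 2 * (t * C) + 3 * (t ^ 2 * ((3 * C ^ 2 - 1) / 2)) + 4 * (t ^ 3 * ((5 * C ^ 3 - 3 * C) / 2))
      - 3.5 * t ^ 4 ≤ legG t C ∧
    legG t C ≤ 1 + 2 * (t * C) + 3 * (t ^ 2 * ((3 * C ^ 2 - 1) / 2))
      + 4 * (t ^ 3 * ((5 * C ^ 3 - 3 * C) / 2)) + 9.5 * t ^ 4 := by
  have h1 : t < 1 := by linarith
  have hD := legendre_disc_pos ht h1 hC'
  have hf := legF_sq_mul ht h1 hC'
  obtain ⟨hl, hu⟩ := legF_bounds ht ht' hC hC'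
  have hL : 0 ≤ 1 - t * C := by nlinarith [mul_nonneg ht (sub_nonneg.2 hC')]
  have hg : legG t C * (1 - 2 * t * C + t ^ 2) = (1 - t * C) * legF t C := by
    rw [legG]
    linear_combination legF t C * (1 - t * C) * hf
  constructor
  · refine le_of_mul_le_mul_right ?_ hD
    rw [hg]
    refine le_trans ?_ (mul_le_mul_of_nonneg_left hl hL)
    have : 0 ≤ 4.2 - 15 * C ^ 2 + 17.5 * C ^ 4 - 0.2 * t * C - 10 * t * C ^ 3 + 3.5 * t ^ 2 := by
      rcases le_total C 0 with h | h
      · have h1 : 0 ≤ t * -C := mul_nonneg ht (by linarith)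
        nlinarith [sq_nonneg (C ^ 2 - 3 / 7), mul_nonneg h1 (sq_nonneg C), sq_nonneg t]
      · rcases le_total C (1 / 2) with h2 | h2
        · exact legendre_aux_small ht ht' h h2
        · rcases le_total C (3 / 4) with h3 | h3
          · exact legendre_aux_mid ht ht' h2 h3
          · exact legendre_aux_large ht ht' h3 hC'
    nlinarith [mul_nonneg (pow_nonneg ht 4) this]
  · refine le_of_mul_le_mul_right ?_ hD
    rw [hg]
    refine le_trans (mul_le_mul_of_nonneg_left hu hL) ?_
    have : 0 ≤ 6.33 + 15 * C ^ 2 - 17.5 * C ^ 4 - 23.33 * t * C + 10 * t * C ^ 3 + 9.5 * t ^ 2 := by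
      have h : 0 ≤ 1 - C ^ 2 := by nlinarith
      have h2 : 0 ≤ t * (1 - C) := mul_nonneg ht (by linarith)
      nlinarith [mul_nonneg h (sq_nonneg C), mul_nonneg h2 h,
          mul_nonneg h2 (by linarith : 0 ≤ 1 + C),
        sq_nonneg (t - 2 / 5), mul_nonneg ht (sub_nonneg.2 ht'), sq_nonneg (C - 1),
        mul_nonneg (sub_nonneg.2 ht') (sub_nonneg.2 hC')]
    nlinarith [mul_nonneg (pow_nonneg ht 4) this]

/-- Angular speed of the polar angle, as determined by the energy. -/
noncomputable def polS (ε z y U : ℝ) : ℝ :=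
  Real.sqrt (1 - 2 * ε * z ^ 2 - ε ^ 2 * z ^ 2 * (1 - 2 * U + y ^ 2))

/-- Scaled angular momentum, as determined by the energy. -/
noncomputable def polL (ε z y U : ℝ) : ℝ := (1 - polS ε z y U) / (ε * z ^ 2)

theorem polS_bounds {ε z y U X s₀ δ : ℝ} (hX : X = (z - 1) ^ 2 - 2 * (U - z) + y ^ 2)
    (hs : s₀ ≤ 1 - ε * z ^ 2) (hδ0 : 0 ≤ δ) (hδ1 : δ ≤ s₀)
    (hb : |ε ^ 2 * z ^ 2 * X| ≤ δ * (2 * s₀ - δ)) :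
    1 - ε * z ^ 2 - δ ≤ polS ε z y U ∧ polS ε z y U ≤ 1 - ε * z ^ 2 + δ ∧
    polS ε z y U ^ 2 = 1 - 2 * ε * z ^ 2 - ε ^ 2 * z ^ 2 * (1 - 2 * U + y ^ 2) := by
  obtain ⟨hb1, hb2⟩ := abs_le.1 hb
  have e : 1 - 2 * ε * z ^ 2 - ε ^ 2 * z ^ 2 * (1 - 2 * U + y ^ 2)
      = (1 - ε * z ^ 2) ^ 2 - ε ^ 2 * z ^ 2 * X := by rw [hX]; ring
  have h1 : (1 - ε * z ^ 2 - δ) ^ 2 ≤ (1 - ε * z ^ 2) ^ 2 - ε ^ 2 * z ^ 2 * X := by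
    nlinarith [mul_nonneg hδ0 (sub_nonneg.2 hs)]
  have h2 : (1 - ε * z ^ 2) ^ 2 - ε ^ 2 * z ^ 2 * X ≤ (1 - ε * z ^ 2 + δ) ^ 2 := by
    nlinarith [mul_nonneg hδ0 (sub_nonneg.2 hs)]
  refine ⟨?_, ?_, ?_⟩
  · rw [polS, e]
    exact Real.le_sqrt_of_sq_le h1
  · rw [polS, e]
    exact (Real.sqrt_le_left (by linarith)).2 h2
  · rw [polS, e, Real.sq_sqrt ((sq_nonneg _).trans h1)]

theorem polL_sub_one {ε z y U : ℝ} (hε : 0 < ε) (hz : 0 < z)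
    (hS : polS ε z y U ^ 2 = 1 - 2 * ε * z ^ 2 - ε ^ 2 * z ^ 2 * (1 - 2 * U + y ^ 2)) :
    (polL ε z y U - 1) * (polS ε z y U + (1 - ε * z ^ 2))
      = ε * ((z - 1) ^ 2 - 2 * (U - z) + y ^ 2) := by
  rw [polL]
  field_simp
  linear_combination -hS

theorem polL_bounds {ε z y U X s₀ δ lam : ℝ} (hε : 0 < ε) (hz : 0 < z)
    (hX : X = (z - 1) ^ 2 - 2 * (U - z) + y ^ 2)
    (hs : s₀ ≤ 1 - ε * z ^ 2) (hδ0 : 0 ≤ δ) (hδ1 : δ < s₀)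
    (hb : |ε ^ 2 * z ^ 2 * X| ≤ δ * (2 * s₀ - δ)) (hl : |ε * X| ≤ lam * (2 * s₀ - δ)) :
    |polL ε z y U - 1| ≤ lam := by
  obtain ⟨h1, h2, h3⟩ := polS_bounds hX hs hδ0 hδ1.le hb
  have h4 := polL_sub_one hε hz h3
  rw [← hX] at h4
  have h5 : 2 * s₀ - δ ≤ polS ε z y U + (1 - ε * z ^ 2) := by linarith
  have h6 : 0 < 2 * s₀ - δ := by linarith
  rw [← h4, abs_mul, abs_of_pos (h6.trans_le h5)] at hl
  refine le_of_mul_le_mul_right (le_trans ?_ hl) h6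
  exact mul_le_mul_of_nonneg_left h5 (abs_nonneg _)

/-- Deviation of the scaled radial force from that of the linear oscillator. -/
noncomputable def polJ (ε n C z y U K : ℝ) : ℝ :=
  polL ε z y U ^ 2 * z - K / z - (z - 1) + 3 * n * (2 * C ^ 2 - 1) * (polS ε z y U / z ^ 2)

theorem polJ_eq {ε n C z y U K : ℝ} (hε : 0 < ε) (hz : 0 < z)
    (hS : polS ε z y U ^ 2 = 1 - 2 * ε * z ^ 2 - ε ^ 2 * z ^ 2 * (1 - 2 * U + y ^ 2))
    (hp : 0 < polS ε z y U + (1 - ε * z ^ 2)) :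
    polJ ε n C z y U K = ε * ((polL ε z y U + 1) / (polS ε z y U + (1 - ε * z ^ 2))) * z *
      ((z - 1) ^ 2 - 2 * (U - z) + y ^ 2) - (K / z - 1)
      + 3 * n * (2 * C ^ 2 - 1) * (polS ε z y U / z ^ 2) := by
  have h4 := polL_sub_one hε hz hS
  have h5 : polL ε z y U ^ 2 - 1 = (polL ε z y U + 1) / (polS ε z y U + (1 - ε * z ^ 2)) *
      (ε * ((z - 1) ^ 2 - 2 * (U - z) + y ^ 2)) := by
    rw [← h4]
    field_simp
    ring
  rw [polJ]
  linear_combination z * h5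

theorem force_bounds {e e₁ q q₀ q₁ z z₀ z₁ n k₃ k₄ a P η κ y Q cn dn c₃ c₄ d₄ d₀ : ℝ}
    (he : 0 ≤ e) (he' : e ≤ e₁) (hq : q₀ ≤ q) (hq' : q ≤ q₁) (hz0 : 0 < z₀) (hz : z₀ ≤ z)
    (hz' : z ≤ z₁) (hn : 0 ≤ n) (hk3 : 0 ≤ k₃) (hk4 : 0 ≤ k₄) (ha : 0 ≤ a) (ha' : a ≤ 1)
    (hP : |P| ≤ 1)
    (hη : n * z ^ 3 * ((3 * a - 1) / 2) + k₃ * z ^ 4 * P - 0.8 * k₄ * z ^ 5 ≤ η)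
    (hη' : η ≤ n * z ^ 3 * ((3 * a - 1) / 2) + k₃ * z ^ 4 * P + 1.67 * k₄ * z ^ 5)
    (hκ : 3 * n * z ^ 2 * ((3 * a - 1) / 2) + 4 * k₃ * z ^ 3 * P - 3.5 * k₄ * z ^ 4 ≤ κ)
    (hκ' : κ ≤ 3 * n * z ^ 2 * ((3 * a - 1) / 2) + 4 * k₃ * z ^ 3 * P + 9.5 * k₄ * z ^ 4)
    (hQ : (z - 1) ^ 2 + y ^ 2 ≤ Q)
    (h1 : 2 * e₁ * z₁ ^ 4 + 3 * z₁ ^ 2 - 3 * q₀ ≤ cn) (h2 : 3 * q₁ - 1.5 * z₀ ^ 2 ≤ cn)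
    (h3 : e₁ * z₁ ^ 4 + 1.5 * z₁ ^ 2 - 3 * q₀ ≤ dn) (h4 : 3 * q₁ - 3 * z₀ ^ 2 ≤ dn)
    (h5 : 4 * z₁ ^ 3 + 2 * e₁ * z₁ ^ 5 ≤ c₃) (h6 : 9.5 * z₁ ^ 4 + 3.34 * e₁ * z₁ ^ 6 ≤ c₄)
    (h7 : 3.5 * z₁ ^ 4 + 1.6 * e₁ * z₁ ^ 6 ≤ d₄) (h8 : e₁ * z₁ * Q ≤ d₀) :
    -(cn * n + c₃ * k₃ + c₄ * k₄)
      ≤ e * z * ((z - 1) ^ 2 - 2 * η + y ^ 2) - κ + 3 * n * (2 * a - 1) * q ∧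
    e * z * ((z - 1) ^ 2 - 2 * η + y ^ 2) - κ + 3 * n * (2 * a - 1) * q
      ≤ d₀ + dn * n + c₃ * k₃ + d₄ * k₄ := by
  have hzp : 0 < z := hz0.trans_le hz
  have pw : ∀ m : ℕ, z ^ m ≤ z₁ ^ m := fun m => pow_le_pow_left₀ hzp.le hz' m
  have ew : ∀ m : ℕ, e * z ^ m ≤ e₁ * z₁ ^ m := fun m =>
    mul_le_mul he' (pw m) (by positivity) (he.trans he')
  have en : ∀ m : ℕ, 0 ≤ e * z ^ m := fun m => by positivity
  have lw : z₀ ^ 2 ≤ z ^ 2 := pow_le_pow_left₀ hz0.le hz 2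
  have hez : 0 ≤ e * z := by positivity
  obtain ⟨hP1, hP2⟩ := abs_le.1 hP
  have A1 := mul_le_mul_of_nonneg_left hη' hez
  have A2 := mul_le_mul_of_nonneg_left hη hez
  have B3 : 0 ≤ c₃ - (4 * z ^ 3 + 2 * e * z ^ 5) := by linarith [pw 3, ew 5, mul_assoc 2 e (z ^ 5)]
  have B3' : 0 ≤ 4 * z ^ 3 + 2 * e * z ^ 5 := by positivity
  have C3 : |k₃ * P * (4 * z ^ 3 + 2 * e * z ^ 5)| ≤ c₃ * k₃ := by
    rw [abs_mul, abs_mul, abs_of_nonneg hk3, abs_of_nonneg B3']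
    calc k₃ * |P| * (4 * z ^ 3 + 2 * e * z ^ 5) ≤ k₃ * 1 * c₃ := by gcongr; linarith
      _ = c₃ * k₃ := by ring
  obtain ⟨C31, C32⟩ := abs_le.1 C3
  have C4 : k₄ * (9.5 * z ^ 4 + 3.34 * (e * z ^ 6)) ≤ k₄ * c₄ :=
    mul_le_mul_of_nonneg_left (by linarith [pw 4, ew 6]) hk4
  have D4 : k₄ * (3.5 * z ^ 4 + 1.6 * (e * z ^ 6)) ≤ k₄ * d₄ :=
    mul_le_mul_of_nonneg_left (by linarith [pw 4, ew 6]) hk4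
  have Sq : e * z * ((z - 1) ^ 2 + y ^ 2) ≤ d₀ := by
    refine le_trans ?_ h8
    have := ew 1
    rw [pow_one, pow_one] at this
    exact mul_le_mul this hQ (by positivity) (le_trans hez this)
  have Sq0 : 0 ≤ e * z * ((z - 1) ^ 2 + y ^ 2) := by positivity
  have N1 : n * ((2 * (e * z ^ 4) + 3 * z ^ 2) * ((3 * a - 1) / 2) - 3 * (2 * a - 1) * q)
      ≤ n * cn := by
    refine mul_le_mul_of_nonneg_left ?_ hn
    have u1 : 2 * (e * z ^ 4) + 3 * z ^ 2 - 3 * q ≤ cn := by linarith [ew 4, pw 2]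
    have u0 : -((2 * (e * z ^ 4) + 3 * z ^ 2) / 2) + 3 * q ≤ cn := by linarith [en 4]
    linear_combination a * u1 + (1 - a) * u0
  have N2 : n * -((2 * (e * z ^ 4) + 3 * z ^ 2) * ((3 * a - 1) / 2) - 3 * (2 * a - 1) * q)
      ≤ n * dn := by
    refine mul_le_mul_of_nonneg_left ?_ hn
    have u1 : -(2 * (e * z ^ 4) + 3 * z ^ 2) + 3 * q ≤ dn := by linarith [en 4]
    have u0 : (2 * (e * z ^ 4) + 3 * z ^ 2) / 2 - 3 * q ≤ dn := by linarith [ew 4, pw 2]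
    linear_combination a * u1 + (1 - a) * u0
  constructor
  · linear_combination 2 * A1 + hκ' + C32 + C4 + N1 + Sq0
  · linear_combination 2 * A2 + hκ + C31 + D4 + N2 + Sq

/-- Scaled potential of the two primaries in polar coordinates, `d` being the inverse square of the
scale. -/
noncomputable def potU (μ d C z : ℝ) : ℝ :=
  z * ((1 - μ) * legF (μ * z * d) (-C) + μ * legF ((1 - μ) * z * d) C)

/-- Scaled radial attraction of the two primaries. -/
noncomputable def potK (μ d C z : ℝ) : ℝ :=
  z * ((1 - μ) * legG (μ * z * d) (-C) + μ * legG ((1 - μ) * z * d) C)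

theorem potU_bounds {μ d C z n k₃ k₄ : ℝ} (hμ : 0 ≤ μ) (hμ' : μ ≤ 1 / 2) (hd : 0 ≤ d) (hz : 0 < z)
    (ht : (1 - μ) * z * d ≤ 2 / 5) (hC : -1 ≤ C) (hC' : C ≤ 1) (hn : n = μ * (1 - μ) * d ^ 2)
    (h3 : k₃ = n * (1 - 2 * μ) * d) (h4 : k₄ = n * (1 - 3 * (μ * (1 - μ))) * d ^ 2) :
    n * z ^ 3 * ((3 * C ^ 2 - 1) / 2) + k₃ * z ^ 4 * ((5 * C ^ 3 - 3 * C) / 2) - 0.8 * k₄ * z ^ 5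
      ≤ potU μ d C z - z ∧
    potU μ d C z - z ≤ n * z ^ 3 * ((3 * C ^ 2 - 1) / 2) + k₃ * z ^ 4 * ((5 * C ^ 3 - 3 * C) / 2)
      + 1.67 * k₄ * z ^ 5 := by
  have hzd : 0 ≤ z * d := by positivity
  have g1 : 0 ≤ μ * z * d := by positivity
  have g2 : 0 ≤ (1 - μ) * z * d := by rw [mul_assoc]; exact mul_nonneg (by linarith) hzd
  have g3 : μ * z * d ≤ 2 / 5 := by nlinarith
  obtain ⟨a1, a2⟩ := legF_bounds g1 g3 (neg_le_neg hC') (by linarith : -C ≤ 1)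
  obtain ⟨b1, b2⟩ := legF_bounds g2 ht hC hC'
  have w1 : 0 ≤ z * (1 - μ) := mul_nonneg hz.le (by linarith)
  have w2 : 0 ≤ z * μ := by positivity
  subst hn h3 h4
  rw [potU]
  constructor
  · linear_combination (z * (1 - μ)) * a1 + (z * μ) * b1
  · linear_combination (z * (1 - μ)) * a2 + (z * μ) * b2

theorem potK_bounds {μ d C z n k₃ k₄ : ℝ} (hμ : 0 ≤ μ) (hμ' : μ ≤ 1 / 2) (hd : 0 ≤ d) (hz : 0 < z)
    (ht : (1 - μ) * z * d ≤ 2 / 5) (hC : -1 ≤ C) (hC' : C ≤ 1) (hn : n = μ * (1 - μ) * d ^ 2)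
    (h3 : k₃ = n * (1 - 2 * μ) * d) (h4 : k₄ = n * (1 - 3 * (μ * (1 - μ))) * d ^ 2) :
    3 * n * z ^ 2 * ((3 * C ^ 2 - 1) / 2) + 4 * k₃ * z ^ 3 * ((5 * C ^ 3 - 3 * C) / 2)
      - 3.5 * k₄ * z ^ 4 ≤ potK μ d C z / z - 1 ∧
    potK μ d C z / z - 1 ≤ 3 * n * z ^ 2 * ((3 * C ^ 2 - 1) / 2)
      + 4 * k₃ * z ^ 3 * ((5 * C ^ 3 - 3 * C) / 2) + 9.5 * k₄ * z ^ 4 := by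
  have hzd : 0 ≤ z * d := by positivity
  have g1 : 0 ≤ μ * z * d := by positivity
  have g2 : 0 ≤ (1 - μ) * z * d := by rw [mul_assoc]; exact mul_nonneg (by linarith) hzd
  have g3 : μ * z * d ≤ 2 / 5 := by nlinarith
  obtain ⟨a1, a2⟩ := legG_bounds g1 g3 (neg_le_neg hC') (by linarith : -C ≤ 1)
  obtain ⟨b1, b2⟩ := legG_bounds g2 ht hC hC'
  have w1 : 0 ≤ (1 - μ) := by linarith
  have e : potK μ d C z / z - 1
      = (1 - μ) * legG (μ * z * d) (-C) + μ * legG ((1 - μ) * z * d) C - 1 := by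
    rw [potK, mul_div_cancel_left₀ _ hz.ne']
  subst hn h3 h4
  rw [e]
  constructor
  · linear_combination (1 - μ) * a1 + μ * b1
  · linear_combination (1 - μ) * a2 + μ * b2

theorem abs_legendre_three_le {C : ℝ} (hC : -1 ≤ C) (hC' : C ≤ 1) :
    |(5 * C ^ 3 - 3 * C) / 2| ≤ 1 := by
  rw [abs_le]
  constructor
  · nlinarith [mul_nonneg (by linarith : 0 ≤ C + 1) (sq_nonneg (C - 1 / 2)),
      mul_nonneg (by linarith : 0 ≤ C + 1) (sq_nonneg C), sq_nonneg (C + 1), sq_nonneg C]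
  · nlinarith [mul_nonneg (by linarith : 0 ≤ 1 - C) (sq_nonneg (C + 1 / 2)),
      mul_nonneg (by linarith : 0 ≤ 1 - C) (sq_nonneg C), sq_nonneg (C - 1), sq_nonneg C]

theorem abs_excess_le {n n₁ k₃ m₃ k₄ m₄ C z z₁ y η Y D Xm : ℝ}
    (hn : 0 ≤ n) (hn' : n ≤ n₁) (hk3 : 0 ≤ k₃) (hk3' : k₃ ≤ m₃) (hk4 : 0 ≤ k₄) (hk4' : k₄ ≤ m₄)
    (hC : -1 ≤ C) (hC' : C ≤ 1) (hzp : 0 < z) (hz' : z ≤ z₁) (hy : y ^ 2 ≤ Y)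
    (hD : (z - 1) ^ 2 ≤ D)
    (hη : n * z ^ 3 * ((3 * C ^ 2 - 1) / 2) + k₃ * z ^ 4 * ((5 * C ^ 3 - 3 * C) / 2)
      - 0.8 * k₄ * z ^ 5 ≤ η)
    (hη' : η ≤ n * z ^ 3 * ((3 * C ^ 2 - 1) / 2) + k₃ * z ^ 4 * ((5 * C ^ 3 - 3 * C) / 2)
      + 1.67 * k₄ * z ^ 5)
    (hX1 : 2 * (n₁ * z₁ ^ 3 + m₃ * z₁ ^ 4 + 1.67 * m₄ * z₁ ^ 5) ≤ Xm)
    (hX2 : D + Y + 2 * (n₁ * z₁ ^ 3 / 2 + m₃ * z₁ ^ 4 + 0.8 * m₄ * z₁ ^ 5) ≤ Xm) :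
    |(z - 1) ^ 2 - 2 * η + y ^ 2| ≤ Xm := by
  obtain ⟨hP1, hP2⟩ := abs_le.1 (abs_legendre_three_le hC hC')
  have t2 : n * z ^ 3 ≤ n₁ * z₁ ^ 3 :=
    mul_le_mul hn' (pow_le_pow_left₀ hzp.le hz' 3) (by positivity) (hn.trans hn')
  have t3 : k₃ * z ^ 4 ≤ m₃ * z₁ ^ 4 :=
    mul_le_mul hk3' (pow_le_pow_left₀ hzp.le hz' 4) (by positivity) (hk3.trans hk3')
  have t4 : k₄ * z ^ 5 ≤ m₄ * z₁ ^ 5 :=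
    mul_le_mul hk4' (pow_le_pow_left₀ hzp.le hz' 5) (by positivity) (hk4.trans hk4')
  have t20 : 0 ≤ n * z ^ 3 := by positivity
  have t30 : 0 ≤ k₃ * z ^ 4 := by positivity
  have u2 : n * z ^ 3 * ((3 * C ^ 2 - 1) / 2) ≤ n * z ^ 3 * 1 :=
    mul_le_mul_of_nonneg_left (by nlinarith only [hC, hC']) t20
  have u2' : n * z ^ 3 * (-1 / 2) ≤ n * z ^ 3 * ((3 * C ^ 2 - 1) / 2) :=
    mul_le_mul_of_nonneg_left (by linarith only [sq_nonneg C]) t20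
  have u3 := mul_le_mul_of_nonneg_left hP2 t30
  have u3' := mul_le_mul_of_nonneg_left hP1 t30
  rw [abs_le]
  constructor
  · linarith only [hη', hX1, t2, t3, t4, u2, u3, sq_nonneg (z - 1), sq_nonneg y]
  · linarith only [hη, hX2, t2, t3, t4, u2', u3', hy, hD]

theorem box_bounds {ε ε₀ ε₁ n n₁ k₃ m₃ k₄ m₄ C z z₀ z₁ y U K Y D Xm s₀ δ lam e₁ q₀ q₁ cn dn c₃ c₄ d₄
    d₀ : ℝ}
    (hε0 : 0 < ε₀) (hε : ε₀ ≤ ε) (hε' : ε ≤ ε₁)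
    (hn : 0 ≤ n) (hn' : n ≤ n₁) (hk3 : 0 ≤ k₃) (hk3' : k₃ ≤ m₃) (hk4 : 0 ≤ k₄) (hk4' : k₄ ≤ m₄)
    (hC : -1 ≤ C) (hC' : C ≤ 1)
    (hz0 : 0 < z₀) (hz : z₀ ≤ z) (hz' : z ≤ z₁) (hy : y ^ 2 ≤ Y) (hD : (z - 1) ^ 2 ≤ D)
    (hη : n * z ^ 3 * ((3 * C ^ 2 - 1) / 2) + k₃ * z ^ 4 * ((5 * C ^ 3 - 3 * C) / 2)
      - 0.8 * k₄ * z ^ 5 ≤ U - z)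
    (hη' : U - z ≤ n * z ^ 3 * ((3 * C ^ 2 - 1) / 2) + k₃ * z ^ 4 * ((5 * C ^ 3 - 3 * C) / 2)
      + 1.67 * k₄ * z ^ 5)
    (hκ : 3 * n * z ^ 2 * ((3 * C ^ 2 - 1) / 2) + 4 * k₃ * z ^ 3 * ((5 * C ^ 3 - 3 * C) / 2)
      - 3.5 * k₄ * z ^ 4 ≤ K / z - 1)
    (hκ' : K / z - 1 ≤ 3 * n * z ^ 2 * ((3 * C ^ 2 - 1) / 2)
      + 4 * k₃ * z ^ 3 * ((5 * C ^ 3 - 3 * C) / 2) + 9.5 * k₄ * z ^ 4)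
    (hX1 : 2 * (n₁ * z₁ ^ 3 + m₃ * z₁ ^ 4 + 1.67 * m₄ * z₁ ^ 5) ≤ Xm)
    (hX2 : D + Y + 2 * (n₁ * z₁ ^ 3 / 2 + m₃ * z₁ ^ 4 + 0.8 * m₄ * z₁ ^ 5) ≤ Xm)
    (hs : s₀ ≤ 1 - ε₁ * z₁ ^ 2) (hδ0 : 0 ≤ δ) (hδ1 : δ < s₀)
    (hb : ε₁ ^ 2 * z₁ ^ 2 * Xm ≤ δ * (2 * s₀ - δ)) (hl : ε₁ * Xm ≤ lam * (2 * s₀ - δ))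
    (he : ε₁ * (2 + lam) ≤ e₁ * (2 * s₀ - δ))
    (hq0 : q₀ * z₁ ^ 2 ≤ s₀ - δ) (hq1 : 1 - ε₀ * z₀ ^ 2 + δ ≤ q₁ * z₀ ^ 2)
    (hq0' : 0 ≤ q₀) (hq1' : 0 ≤ q₁) (hlam : lam ≤ 1) (he1 : 0 ≤ e₁)
    (h1 : 2 * e₁ * z₁ ^ 4 + 3 * z₁ ^ 2 - 3 * q₀ ≤ cn) (h2 : 3 * q₁ - 1.5 * z₀ ^ 2 ≤ cn)
    (h3 : e₁ * z₁ ^ 4 + 1.5 * z₁ ^ 2 - 3 * q₀ ≤ dn) (h4 : 3 * q₁ - 3 * z₀ ^ 2 ≤ dn)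
    (h5 : 4 * z₁ ^ 3 + 2 * e₁ * z₁ ^ 5 ≤ c₃) (h6 : 9.5 * z₁ ^ 4 + 3.34 * e₁ * z₁ ^ 6 ≤ c₄)
    (h7 : 3.5 * z₁ ^ 4 + 1.6 * e₁ * z₁ ^ 6 ≤ d₄) (h8 : e₁ * z₁ * (D + Y) ≤ d₀) :
    (1 - ε * z ^ 2 - δ ≤ polS ε z y U ∧ polS ε z y U ≤ 1 - ε * z ^ 2 + δ) ∧
    polS ε z y U ^ 2 = 1 - 2 * ε * z ^ 2 - ε ^ 2 * z ^ 2 * (1 - 2 * U + y ^ 2) ∧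
    |polL ε z y U - 1| ≤ lam ∧ q₀ * z ^ 2 ≤ polS ε z y U ∧ polS ε z y U ≤ q₁ * z ^ 2 ∧
    -(cn * n + c₃ * k₃ + c₄ * k₄) ≤ polJ ε n C z y U K ∧
    polJ ε n C z y U K ≤ d₀ + dn * n + c₃ * k₃ + d₄ * k₄ := by
  have hzp : 0 < z := hz0.trans_le hz
  have hεp : 0 < ε := hε0.trans_le hε
  have hP := abs_legendre_three_le hC hC'
  have ha : C ^ 2 ≤ 1 := by nlinarith only [hC, hC']
  obtain ⟨X, hX⟩ : ∃ X, X = (z - 1) ^ 2 - 2 * (U - z) + y ^ 2 := ⟨_, rfl⟩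
  have z2 : z ^ 2 ≤ z₁ ^ 2 := pow_le_pow_left₀ hzp.le hz' 2
  have z2' : z₀ ^ 2 ≤ z ^ 2 := pow_le_pow_left₀ hz0.le hz 2
  have hε1 : 0 ≤ ε₁ := hεp.le.trans hε'
  have hXa : |X| ≤ Xm := hX ▸ abs_excess_le hn hn' hk3 hk3' hk4 hk4' hC hC' hzp hz' hy hD
    hη hη' hX1 hX2
  have hXm := (abs_nonneg X).trans hXa
  have hs' : s₀ ≤ 1 - ε * z ^ 2 := by
    have : ε * z ^ 2 ≤ ε₁ * z₁ ^ 2 := mul_le_mul hε' z2 (by positivity) (hεp.le.trans hε')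
    linarith only [this, hs]
  have hb' : |ε ^ 2 * z ^ 2 * X| ≤ δ * (2 * s₀ - δ) := by
    refine le_trans ?_ hb
    rw [abs_mul, abs_of_nonneg (by positivity)]
    gcongr
  have hl' : |ε * X| ≤ lam * (2 * s₀ - δ) := by
    refine le_trans ?_ hl
    rw [abs_mul, abs_of_nonneg hεp.le]
    gcongr
  obtain ⟨S1, S2, S3⟩ := polS_bounds hX hs' hδ0 hδ1.le hb'
  have L1 := polL_bounds hεp hzp hX hs' hδ0 hδ1 hb' hl'
  have hsum : 2 * s₀ - δ ≤ polS ε z y U + (1 - ε * z ^ 2) := by linarith only [S1, hs']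
  have hs2 : 0 < 2 * s₀ - δ := by linarith only [hδ0, hδ1, hδ1, hs']
  have hsum0 := hs2.trans_le hsum
  obtain ⟨La, Lb⟩ := abs_le.1 L1
  have hl0 : 0 ≤ polL ε z y U + 1 := by linarith only [La, hlam]
  have Q1 : q₀ * z ^ 2 ≤ polS ε z y U := by
    have := mul_le_mul_of_nonneg_left z2 hq0'
    linarith only [this, hq0, S1, hs']
  have Q2 : polS ε z y U ≤ q₁ * z ^ 2 := by
    have h9 := mul_le_mul_of_nonneg_left z2' hq1'
    have : ε₀ * z₀ ^ 2 ≤ ε * z ^ 2 := mul_le_mul hε z2' (by positivity) hεp.le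
    linarith only [this, hq1, S2, h9]
  have hz2p : 0 < z ^ 2 := by positivity
  have F := force_bounds (e := ε * ((polL ε z y U + 1) / (polS ε z y U + (1 - ε * z ^ 2))))
    (e₁ := e₁) (q := polS ε z y U / z ^ 2) (y := y) (a := C ^ 2) (η := U - z) (κ := K / z - 1)
    (cn := cn) (dn := dn) (c₃ := c₃) (c₄ := c₄) (d₄ := d₄) (d₀ := d₀) (Q := D + Y)
    (q₀ := q₀) (q₁ := q₁) ?_ ?_ ?_ ?_ hz0 hz hz' hn hk3 hk4 (sq_nonneg C) ha hP hη hη' hκ hκ'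
    (add_le_add hD hy) h1 h2 h3 h4 h5 h6 h7 h8
  · rw [← polJ_eq hεp hzp S3 hsum0] at F
    exact ⟨⟨S1, S2⟩, S3, L1, Q1, Q2, F⟩
  · positivity
  · rw [mul_div_assoc', div_le_iff₀ hsum0]
    have h9 : ε * (polL ε z y U + 1) ≤ ε₁ * (2 + lam) :=
      mul_le_mul hε' (by linarith only [Lb]) hl0 (hεp.le.trans hε')
    exact h9.trans (he.trans (mul_le_mul_of_nonneg_left hsum he1))
  · rwa [le_div_iff₀ hz2p]
  · rwa [div_le_iff₀ hz2p]

theorem bddLip_of_contDiffAt {g : ℝ × ℝ × ℝ → ℝ} {A₁ A₂ Y : ℝ} {h : ℝ → ℝ} (hh : Continuous h)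
    (hA : A₁ ≤ A₂) (hY : -Y ≤ Y)
    (hg : ∀ p ∈ Icc (-1 : ℝ) 1 ×ˢ Icc A₁ A₂ ×ˢ Icc (-Y) Y, ContDiffAt ℝ 1 g p) :
    BddLip fun θ x => g (Real.cos θ, clampR A₁ A₂ x.1, clampR (-Y) Y (x.2 - h θ)) := by
  have hK : IsCompact (Icc (-1 : ℝ) 1 ×ˢ Icc A₁ A₂ ×ˢ Icc (-Y) Y) :=
    isCompact_Icc.prod (isCompact_Icc.prod isCompact_Icc)
  have hgc : ContinuousOn g (Icc (-1 : ℝ) 1 ×ˢ Icc A₁ A₂ ×ˢ Icc (-Y) Y) :=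
    fun p hp => (hg p hp).continuousAt.continuousWithinAt
  obtain ⟨B, hB⟩ := hK.exists_bound_of_continuousOn hgc
  have hloc : LocallyLipschitzOn (Icc (-1 : ℝ) 1 ×ˢ Icc A₁ A₂ ×ˢ Icc (-Y) Y) g := by
    intro p hp
    obtain ⟨L, t, ht, hL⟩ := (hg p hp).exists_lipschitzOnWith
    exact ⟨L, t, mem_nhdsWithin_of_mem_nhds ht, hL⟩
  obtain ⟨L, hL⟩ := hloc.exists_lipschitzOnWith_of_compact hK
  have hmem : ∀ θ (x : ℝ × ℝ), ((Real.cos θ, clampR A₁ A₂ x.1,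
      clampR (-Y) Y (x.2 - h θ)) : ℝ × ℝ × ℝ)
      ∈ Icc (-1 : ℝ) 1 ×ˢ Icc A₁ A₂ ×ˢ Icc (-Y) Y := fun θ x =>
    ⟨⟨Real.neg_one_le_cos θ, Real.cos_le_one θ⟩, clampR_mem hA _, clampR_mem hY _⟩
  refine ⟨⟨max B L, le_max_of_le_right L.2, fun θ x y => ⟨?_, ?_⟩⟩, fun x => ?_⟩
  · exact (hB _ (hmem θ x)).trans (le_max_left _ _)
  · rw [← Real.dist_eq]
    refine (hL.dist_le_mul _ (hmem θ x) _ (hmem θ y)).trans ?_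
    refine mul_le_mul (le_max_right _ _) ?_ dist_nonneg (le_max_of_le_right L.2)
    simp only [Prod.dist_eq, dist_self, Real.dist_eq]
    refine max_le (le_max_of_le_left (abs_nonneg _)) (max_le_max (abs_clampR_sub_le _ _ _ _) ?_)
    refine (abs_clampR_sub_le _ _ _ _).trans ?_
    rw [sub_sub_sub_cancel_right]
  · refine hgc.comp_continuous ?_ fun θ => hmem θ x
    have : Continuous fun θ => clampR (-Y) Y (x.2 - h θ) := by unfold clampR; fun_prop
    exact Real.continuous_cos.prodMk (continuous_const.prodMk this)

/-- An oscillator with even autonomous coefficients defined near the origin only, driven by the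
cosine of time. -/
theorem driven_oscillator_periodic {gN gJ : ℝ × ℝ × ℝ → ℝ} {A B Y j₀ j₁ β : ℝ}
    (hA : 0 ≤ A) (hB : 0 ≤ B) (hY : 0 ≤ Y) (hβ : 0 ≤ β)
    (hgN : ∀ p ∈ Icc (-1 : ℝ) 1 ×ˢ Icc (1 - A) (1 + B) ×ˢ Icc (-Y) Y, ContDiffAt ℝ 1 gN p)
    (hgJ : ∀ p ∈ Icc (-1 : ℝ) 1 ×ˢ Icc (1 - A) (1 + B) ×ˢ Icc (-Y) Y, ContDiffAt ℝ 1 gJ p)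
    (hNe : ∀ C z y, gN (C, z, -y) = gN (C, z, y)) (hJe : ∀ C z y, gJ (C, z, -y) = gJ (C, z, y))
    (hb : ∀ C ∈ Icc (-1 : ℝ) 1, ∀ z ∈ Icc (1 - A) (1 + B), ∀ y ∈ Icc (-Y) Y,
      0 ≤ gN (C, z, y) ∧ gN (C, z, y) ≤ 1 / 2 ∧ -j₀ ≤ gJ (C, z, y) ∧ gJ (C, z, y) ≤ j₁)
    (hj0 : 0 ≤ j₀) (hj1 : 0 ≤ j₁) (hs0 : j₀ + β / 2 ≤ 1) (hs1 : j₁ + β / 2 ≤ 1)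
    (hW1 : j₁ + 0.71 * β ≤ A) (hW0 : j₀ + 0.71 * β ≤ B) (hW2 : j₀ + j₁ + 1.5 * β ≤ Y) :
    ∃ z y : ℝ → ℝ,
      (∀ θ, HasDerivAt z (-gN (Real.cos θ, z θ, y θ) * y θ) θ) ∧
      (∀ θ, HasDerivAt y (gN (Real.cos θ, z θ, y θ) * (z θ - 1 + gJ (Real.cos θ, z θ, y θ))
        - β * (2 * Real.cos θ ^ 2 - 1)) θ) ∧
      (∀ θ, z (-θ) = z θ) ∧ (∀ θ, y (-θ) = -y θ) ∧
      (∀ θ, z (θ + 2 * Real.pi) = z θ) ∧ (∀ θ, y (θ + 2 * Real.pi) = y θ) ∧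
      (∀ θ, 1 - (j₁ + 0.71 * β) ≤ z θ) ∧ (∀ θ, z θ ≤ 1 + (j₀ + 0.71 * β)) ∧
      (∀ θ, y θ ∈ Icc (-Y) Y) := by
  obtain ⟨h, hdef⟩ : ∃ h : ℝ → ℝ, ∀ θ, h θ = β * (Real.sin θ * Real.cos θ) := ⟨_, fun _ => rfl⟩
  have hfun : h = fun θ => β * (Real.sin θ * Real.cos θ) := funext hdef
  have hhc : Continuous h := by rw [hfun]; fun_prop
  have hhb : ∀ θ, |h θ| ≤ β / 2 := by
    intro θ
    rw [hdef, abs_mul, abs_of_nonneg hβ]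
    have : |Real.sin θ * Real.cos θ| ≤ 1 / 2 := by
      rw [abs_le]
      have h1 := Real.sin_sq_add_cos_sq θ
      constructor
      · nlinarith only [h1, sq_nonneg (Real.sin θ + Real.cos θ)]
      · nlinarith only [h1, sq_nonneg (Real.sin θ - Real.cos θ)]
    nlinarith only [mul_le_mul_of_nonneg_left this hβ]
  have hcl1 : ∀ x : ℝ, 1 + clampR (-A) B x ∈ Icc (1 - A) (1 + B) := fun x => by
    have := clampR_mem (show -A ≤ B by linarith) x
    exact ⟨by linarith [this.1], by linarith [this.2]⟩
  have hcl2 : ∀ x : ℝ, clampR (-Y) Y x ∈ Icc (-Y) Y := clampR_mem (by linarith)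
  have hcos : ∀ θ, Real.cos θ ∈ Icc (-1 : ℝ) 1 := fun θ => ⟨Real.neg_one_le_cos θ,
      Real.cos_le_one θ⟩
  have hshift : ∀ g : ℝ × ℝ × ℝ → ℝ,
      (∀ p ∈ Icc (-1 : ℝ) 1 ×ˢ Icc (1 - A) (1 + B) ×ˢ Icc (-Y) Y, ContDiffAt ℝ 1 g p) →
      BddLip fun θ x => g (Real.cos θ, 1 + clampR (-A) B x.1, clampR (-Y) Y (x.2 - h θ)) := by
    intro g hg
    refine bddLip_of_contDiffAt (g := fun p => g (p.1, 1 + p.2.1, p.2.2)) hhc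
      (by linarith : -A ≤ B) (by linarith) fun p hp => ?_
    refine ContDiffAt.comp p (g := g) (f := fun p : ℝ × ℝ × ℝ => (p.1, 1 + p.2.1, p.2.2)) (hg _ ?_)
      (by fun_prop)
    exact ⟨hp.1, ⟨by linarith [hp.2.1.1], by linarith [hp.2.1.2]⟩, hp.2.2⟩
  have hneg : ∀ θ, h (-θ) = -h θ := fun θ => by
    rw [hdef, hdef, Real.sin_neg, Real.cos_neg]; ring
  have hper : ∀ θ, h (θ + 2 * Real.pi) = h θ := fun θ => by
    rw [hdef, hdef, Real.sin_add_two_pi, Real.cos_add_two_pi]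
  have hflip : ∀ w θ, clampR (-Y) Y (-w - h (-θ)) = -clampR (-Y) Y (w - h θ) := fun w θ => by
    rw [hneg, ← clampR_neg _ _ hY]; congr 1; ring
  obtain ⟨ζ, w, hζ, hw, hζe, hwo, hζp, hwp, hζ0, hζ1, hwb⟩ := oscillator_periodic (h := h)
    (j₀ := j₀) (j₁ := j₁) (b := β / 2) (hshift gN hgN) (hshift gJ hgJ) hhc
    (fun θ x => (hb _ (hcos θ) _ (hcl1 _) _ (hcl2 _)).1)
    (fun θ x => (hb _ (hcos θ) _ (hcl1 _) _ (hcl2 _)).2.1)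
    (fun θ x => (hb _ (hcos θ) _ (hcl1 _) _ (hcl2 _)).2.2.1)
    (fun θ x => (hb _ (hcos θ) _ (hcl1 _) _ (hcl2 _)).2.2.2) hhb hj0 hj1 hs0 hs1
    (fun θ ζ w => by simp only [Real.cos_neg, hflip, hNe])
    (fun θ ζ w => by simp only [Real.cos_neg, hflip, hJe])
    hneg (fun θ x => by simp only [Real.cos_add_two_pi, hper])
    (fun θ x => by simp only [Real.cos_add_two_pi, hper]) hper
  have hζm : ∀ θ, clampR (-A) B (ζ θ) = ζ θ := fun θ =>
    clampR_of_mem ⟨by linarith [hζ0 θ], by linarith [hζ1 θ]⟩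
  have hym : ∀ θ, w θ - h θ ∈ Icc (-Y) Y := fun θ => by
    have h1 := abs_le.1 (hwb θ)
    have h2 := abs_le.1 (hhb θ)
    exact ⟨by linarith, by linarith⟩
  have hyc : ∀ θ, clampR (-Y) Y (w θ - h θ) = w θ - h θ := fun θ => clampR_of_mem (hym θ)
  have hh' : ∀ θ, HasDerivAt h (β * (2 * Real.cos θ ^ 2 - 1)) θ := fun θ => by
    rw [hfun]
    refine (((Real.hasDerivAt_sin θ).mul (Real.hasDerivAt_cos θ)).const_mul β).congr_deriv ?_
    linear_combination (-β) * Real.sin_sq_add_cos_sq θ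
  refine ⟨fun θ => 1 + ζ θ, fun θ => w θ - h θ, fun θ => ?_, fun θ => ?_, fun θ => ?_, fun θ => ?_,
    fun θ => ?_, fun θ => ?_, fun θ => ?_, fun θ => ?_, hym⟩
  · have := (hζ θ).const_add 1
    simp only [hζm, hyc] at this
    exact this
  · have := (hw θ).sub (hh' θ)
    simp only [hζm, hyc] at this
    refine this.congr_deriv ?_
    ring
  · simp only [hζe]
  · simp only [hwo, hneg]; ring
  · simp only [hζp]
  · simp only [hwp, hper]
  · linarith [hζ0 θ]
  · linarith [hζ1 θ]

theorem Rplus_involutive (x : V4) : Rplus (Rplus x) = x := by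
  funext i
  fin_cases i <;> simp [Rplus]

/-- A curve tracing a symmetric orbit with the polar angle as parameter, at bounded angular speed,
can be reparametrised by time. -/
theorem exists_orbit_of_angle_param {H : V4 → ℝ} {D : Set V4} {X : ℝ → V4} {S ρ : ℝ → ℝ} {S₀ : ℝ}
    (hS0 : 0 < S₀) (hS : ∀ θ, S₀ ≤ S θ) (hSc : Continuous S)
    (hSe : ∀ θ, S (-θ) = S θ) (hSp : ∀ θ, S (θ + 2 * Real.pi) = S θ)
    (hD : ∀ θ, X θ ∈ D) (hX : ∀ θ, HasDerivAt X ((S θ)⁻¹ • symplGrad H (X θ)) θ)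
    (hXp : ∀ θ, X (θ + 2 * Real.pi) = X θ) (hXs : ∀ θ, X (-θ) = Rplus (X θ))
    (hρ : ∀ θ, 0 < ρ θ) (hX1 : ∀ θ, X θ 1 = ρ θ * Real.sin θ) :
    ∃ (T : ℝ) (γ : ℝ → V4), 0 < T ∧ T ≤ 2 * Real.pi / S₀ ∧ IsOrbit H D γ ∧
      (∀ t, γ (t + T) = γ t) ∧ (∀ t, γ t = Rplus (γ (T - t))) ∧
      {t ∈ Ico 0 T | γ t 1 = 0}.ncard = 2 ∧ ∀ t, ∃ θ, γ t = X θ := by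
  have hpi := Real.pi_pos
  have hSpos : ∀ θ, 0 < S θ := fun θ => hS0.trans_le (hS θ)
  have hc : Continuous fun θ => (S θ)⁻¹ := hSc.inv₀ fun θ => (hSpos θ).ne'
  obtain ⟨τ, hτ⟩ : ∃ τ : ℝ → ℝ, ∀ θ, τ θ = ∫ x in (0 : ℝ)..θ, (S x)⁻¹ := ⟨_, fun _ => rfl⟩
  have hτd : ∀ θ, HasDerivAt τ (S θ)⁻¹ θ := fun θ => by
    rw [funext hτ]
    exact intervalIntegral.integral_hasDerivAt_right (hc.intervalIntegrable _ _)
      (hc.stronglyMeasurableAtFilter _ _) hc.continuousAt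
  have hτ0 : τ 0 = 0 := by rw [hτ, intervalIntegral.integral_same]
  have hτc : Continuous τ := continuous_iff_continuousAt.2 fun θ => (hτd θ).continuousAt
  have hmono : StrictMono τ := strictMono_of_deriv_pos fun θ => by
    rw [(hτd θ).deriv]; exact inv_pos.2 (hSpos θ)
  have hτp : ∀ θ, τ (θ + 2 * Real.pi) = τ θ + τ (2 * Real.pi) := by
    have hd : ∀ θ, HasDerivAt (fun θ => τ (θ + 2 * Real.pi) - τ θ) 0 θ := fun θ => by
      have := ((hτd (θ + 2 * Real.pi)).comp_add_const θ (2 * Real.pi)).fun_sub (hτd θ)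
      rwa [hSp, sub_self] at this
    intro θ
    have h := is_const_of_deriv_eq_zero (fun θ => (hd θ).differentiableAt)
      (fun θ => (hd θ).deriv) θ 0
    simp only [zero_add, hτ0] at h
    linarith
  have hτo : ∀ θ, τ (-θ) = -τ θ := by
    have hd : ∀ θ, HasDerivAt (fun θ => τ (-θ) + τ θ) 0 θ := fun θ => by
      refine (((hτd (-θ)).comp θ (hasDerivAt_neg θ)).fun_add (hτd θ)).congr_deriv ?_
      rw [hSe]; ring
    intro θ
    have h := is_const_of_deriv_eq_zero (fun θ => (hd θ).differentiableAt)
      (fun θ => (hd θ).deriv) θ 0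
    simp only [neg_zero, hτ0] at h
    linarith
  set T := τ (2 * Real.pi) with hT
  have hTpos : 0 < T := by rw [← hτ0]; exact hmono (by positivity)
  have hmul : ∀ k : ℕ, τ (k * (2 * Real.pi)) = k * T := by
    intro k
    induction k with
    | zero => simp [hτ0]
    | succ k ih =>
      push_cast
      rw [add_mul, one_mul, hτp, ih]; ring
  have hsurj : Function.Surjective τ := by
    refine hτc.surjective ?_ ?_
    · refine hmono.monotone.tendsto_atTop_atTop fun b => ?_
      obtain ⟨k, hk⟩ := exists_nat_ge (b / T)
      exact ⟨_, by rw [hmul]; rwa [div_le_iff₀ hTpos] at hk⟩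
    · refine hmono.monotone.tendsto_atBot_atBot fun b => ?_
      obtain ⟨k, hk⟩ := exists_nat_ge (-b / T)
      refine ⟨-(k * (2 * Real.pi)), ?_⟩
      rw [hτo, hmul]
      rw [div_le_iff₀ hTpos] at hk
      linarith
  let e := StrictMono.orderIsoOfSurjective τ hmono hsurj
  obtain ⟨ϑ, hϑ⟩ : ∃ ϑ : ℝ → ℝ, ϑ = e.symm := ⟨_, rfl⟩
  have hr : ∀ t, τ (ϑ t) = t := fun t => by rw [hϑ]; exact e.apply_symm_apply t
  have hl : ∀ θ, ϑ (τ θ) = θ := fun θ => hmono.injective (hr _)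
  have hϑc : Continuous ϑ := by rw [hϑ]; exact e.symm.continuous
  have hϑd : ∀ t, HasDerivAt ϑ (S (ϑ t)) t := fun t => by
    have := HasDerivAt.of_local_left_inverse (f := τ) (g := ϑ) (a := t) hϑc.continuousAt (hτd (ϑ t))
      (inv_pos.2 (hSpos _)).ne' (Filter.Eventually.of_forall hr)
    rwa [inv_inv] at this
  have hϑm : StrictMono ϑ := by rw [hϑ]; exact e.symm.strictMono
  have hϑT : ∀ t, ϑ (t + T) = ϑ t + 2 * Real.pi := fun t => by
    rw [← hl (ϑ t + 2 * Real.pi), hτp, hr]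
  have hϑn : ∀ t, ϑ (-t) = -ϑ t := fun t => by rw [← hl (-ϑ t), hτo, hr]
  have hϑ0 : ϑ 0 = 0 := by simpa only [hτ0] using hl 0
  have hϑT0 : ϑ T = 2 * Real.pi := hl _
  refine ⟨T, fun t => X (ϑ t), hTpos, ?_, fun t => ⟨hD _, ?_⟩, fun t => ?_, fun t => ?_, ?_,
    fun t => ⟨_, rfl⟩⟩
  · have h := intervalIntegral.integral_mono_on (a := 0) (b := 2 * Real.pi) (by positivity)
      (hc.intervalIntegrable _ _) ((continuous_const (y := S₀⁻¹)).intervalIntegrable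
          (μ := MeasureTheory.volume) _ _)
      fun x _ => inv_anti₀ hS0 (hS x)
    rwa [← hτ, intervalIntegral.integral_const, smul_eq_mul, sub_zero, ← div_eq_mul_inv] at h
  · refine (HasDerivAt.scomp t (hX (ϑ t)) (hϑd t)).congr_deriv ?_
    rw [smul_smul, mul_inv_cancel₀ (hSpos _).ne', one_smul]
  · simp only [hϑT, hXp]
  · have : ϑ (T - t) = -ϑ t + 2 * Real.pi := by
      rw [← hϑn, ← hϑT]; congr 1; ring
    simp only [this, hXp, hXs, Rplus_involutive]
  · have : {t ∈ Ico 0 T | X (ϑ t) 1 = 0} = {0, τ Real.pi} := by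
      ext t
      simp only [mem_ofPred_eq, mem_insert_iff, mem_singleton_iff, hX1, mul_eq_zero, (hρ _).ne',
        false_or]
      constructor
      · rintro ⟨⟨h0, h1⟩, h2⟩
        have g0 : 0 ≤ ϑ t := hϑ0 ▸ hϑm.monotone h0
        have g1 : ϑ t < 2 * Real.pi := hϑT0 ▸ hϑm h1
        rcases g0.eq_or_lt with h | h
        · left; rw [← hr t, ← h, hτ0]
        · right
          rcases lt_trichotomy (ϑ t) Real.pi with h' | h' | h'
          · exact absurd h2 (Real.sin_pos_of_pos_of_lt_pi h h').ne'
          · rw [← hr t, h']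
          · exfalso
            have := Real.sin_pos_of_pos_of_lt_pi (x := ϑ t - Real.pi) (by linarith) (by linarith)
            rw [Real.sin_sub_pi, h2] at this
            simp at this
      · rintro (rfl | rfl)
        · exact ⟨⟨le_rfl, hTpos⟩, by rw [hϑ0, Real.sin_zero]⟩
        · refine ⟨⟨?_, hmono (by linarith)⟩, by rw [hl, Real.sin_pi]⟩
          rw [← hτ0]; exact hmono.monotone hpi.le
    rw [this, ncard_pair]
    rw [← hτ0]; exact (hmono hpi).ne

/-- The phase point with polar angle given by the cosine `C` and the sine `σ`, with inverse radius
`v ^ 2 * z`, radial momentum `v * y` and angular momentum `-l / v`. -/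
noncomputable def polarPoint (v C σ z y l : ℝ) : V4 :=
  ![C / (v ^ 2 * z), σ / (v ^ 2 * z), v * (y * C + l * z * σ), v * (y * σ - l * z * C)]

theorem Rplus_polarPoint (v C σ z y l : ℝ) :
    Rplus (polarPoint v C σ z y l) = polarPoint v C (-σ) z (-y) l := by
  funext i
  fin_cases i <;> simp [Rplus, polarPoint] <;> ring

theorem dist_sq_polarPoint {v C σ z y l : ℝ} (e : ℝ) (hv : 0 < v) (hz : 0 < z)
    (h : C ^ 2 + σ ^ 2 = 1) :
    (polarPoint v C σ z y l 0 - e) ^ 2 + (polarPoint v C σ z y l 1) ^ 2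
      = (1 - 2 * (e * z * v ^ 2) * C + (e * z * v ^ 2) ^ 2) / (v ^ 2 * z) ^ 2 := by
  simp only [polarPoint, cons_val_zero, cons_val_one]
  field_simp
  linear_combination h

theorem invDist_polarPoint {v C σ z y l : ℝ} (e : ℝ) (hv : 0 < v) (hz : 0 < z)
    (h : C ^ 2 + σ ^ 2 = 1) :
    invDist e (polarPoint v C σ z y l) = v ^ 2 * z * legF (e * z * v ^ 2) C := by
  rw [invDist, dist_sq_polarPoint e hv hz h, legF, Real.sqrt_div' _ (by positivity),
    Real.sqrt_sq (by positivity), inv_div, div_eq_mul_inv]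

theorem invDist_neg_polarPoint {v C σ z y l : ℝ} (μ : ℝ) (hv : 0 < v) (hz : 0 < z)
    (h : C ^ 2 + σ ^ 2 = 1) :
    invDist (-μ) (polarPoint v C σ z y l) = v ^ 2 * z * legF (μ * z * v ^ 2) (-C) := by
  rw [invDist_polarPoint _ hv hz h, legF, legF]
  congr 4 <;> ring

theorem polarPoint_mem_dom {μ v C σ z y l : ℝ} (hv : 0 < v) (hz : 0 < z) (h : C ^ 2 + σ ^ 2 = 1)
    (hμ : 0 ≤ μ) (hμ' : μ ≤ 1 / 2) (ht : (1 - μ) * z * v ^ 2 ≤ 2 / 5) :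
    polarPoint v C σ z y l ∈ JacobiDom μ := by
  have hC := abs_le.1 (abs_le_of_sq_le_sq (a := C) (b := 1) (by nlinarith [sq_nonneg σ])
      (by norm_num))
  have hzv : 0 < z * v ^ 2 := by positivity
  rw [dom_iff, dist_sq_polarPoint _ hv hz h, dist_sq_polarPoint _ hv hz h]
  constructor
  · have := legendre_disc_pos (t := μ * z * v ^ 2) (C := -C) (by positivity) (by nlinarith)
      (by linarith [hC.1])
    refine div_pos ?_ (by positivity)
    linarith
  · refine div_pos (legendre_disc_pos ?_ (by linarith) hC.2) (by positivity)
    rw [mul_assoc]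
    exact mul_nonneg (by linarith) hzv.le

/-- Angular derivative of the scaled potential. -/
noncomputable def potT (μ d C σ z : ℝ) : ℝ :=
  σ * z ^ 2 * (μ * (1 - μ)) * d *
    (legF (μ * z * d) (-C) ^ 3 - legF ((1 - μ) * z * d) C ^ 3)

theorem attr_polarPoint {v C σ z y l : ℝ} (μ : ℝ) (hv : 0 < v) (hz : 0 < z)
    (h : C ^ 2 + σ ^ 2 = 1) :
    attr0 μ (polarPoint v C σ z y l)
      = v ^ 4 * z * (potK μ (v ^ 2) C z * C + potT μ (v ^ 2) C σ z * σ) ∧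
    attr1 μ (polarPoint v C σ z y l)
      = v ^ 4 * z * (potK μ (v ^ 2) C z * σ - potT μ (v ^ 2) C σ z * C) := by
  rw [attr0, attr1, invDist_neg_polarPoint _ hv hz h, invDist_polarPoint _ hv hz h, potK, potT,
    legG, legG]
  simp only [polarPoint, cons_val_zero, cons_val_one]
  generalize legF (μ * z * v ^ 2) (-C) = f
  generalize legF ((1 - μ) * z * v ^ 2) C = g
  constructor
  · field_simp
    linear_combination (-(μ * (1 - μ) * v ^ 2 * z * (f ^ 3 - g ^ 3))) * h
  · field_simp
    ring

theorem jacobiH_polarPoint {v C σ z y l : ℝ} (μ : ℝ) (hv : 0 < v) (hz : 0 < z)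
    (h : C ^ 2 + σ ^ 2 = 1) :
    JacobiH μ (polarPoint v C σ z y l)
      = v ^ 2 / 2 * (y ^ 2 + l ^ 2 * z ^ 2) - l / v - v ^ 2 * potU μ (v ^ 2) C z := by
  rw [jacobiH_eq]
  simp only
  rw [invDist_neg_polarPoint _ hv hz h, invDist_polarPoint _ hv hz h, potU]
  simp only [polarPoint, cons_val]
  generalize legF (μ * z * v ^ 2) (-C) = f
  generalize legF ((1 - μ) * z * v ^ 2) C = g
  field_simp
  linear_combination (z * (v ^ 3 * (y ^ 2 + l ^ 2 * z ^ 2) - 2 * l)) * h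

theorem hasDerivAt_polarPoint {μ v θ : ℝ} {z y l : ℝ → ℝ} (hv : 0 < v) (hz : 0 < z θ)
    (hS : 1 - v ^ 3 * z θ ^ 2 * l θ ≠ 0)
    (hdom : polarPoint v (Real.cos θ) (Real.sin θ) (z θ) (y θ) (l θ) ∈ JacobiDom μ)
    (hz' : HasDerivAt z (-(v ^ 3 * z θ ^ 2 * y θ / (1 - v ^ 3 * z θ ^ 2 * l θ))) θ)
    (hy' : HasDerivAt y (v ^ 3 * z θ * (l θ ^ 2 * z θ ^ 2 - potK μ (v ^ 2) (Real.cos θ) (z θ))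
      / (1 - v ^ 3 * z θ ^ 2 * l θ)) θ)
    (hl' : HasDerivAt l (-(v ^ 3 * potT μ (v ^ 2) (Real.cos θ) (Real.sin θ) (z θ)
      / (1 - v ^ 3 * z θ ^ 2 * l θ))) θ) :
    HasDerivAt (fun θ => polarPoint v (Real.cos θ) (Real.sin θ) (z θ) (y θ) (l θ))
      ((1 - v ^ 3 * z θ ^ 2 * l θ)⁻¹ •
        symplGrad (JacobiH μ) (polarPoint v (Real.cos θ) (Real.sin θ) (z θ) (y θ) (l θ))) θ := by
  have h : Real.cos θ ^ 2 + Real.sin θ ^ 2 = 1 := by linarith [Real.sin_sq_add_cos_sq θ]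
  obtain ⟨a0, a1⟩ := attr_polarPoint (y := y θ) (l := l θ) μ hv hz h
  have hc := Real.hasDerivAt_cos θ
  have hs := Real.hasDerivAt_sin θ
  rw [symplGrad_jacobiH hdom, a0, a1]
  generalize potK μ (v ^ 2) (Real.cos θ) (z θ) = K at *
  generalize potT μ (v ^ 2) (Real.cos θ) (Real.sin θ) (z θ) = W at *
  have hw : v ^ 2 * z θ ≠ 0 := by positivity
  have hw' := hz'.const_mul (v ^ 2)
  refine hasDerivAt_pi.2 fun i => ?_
  fin_cases i
  · refine (hc.fun_div hw' hw).congr_deriv ?_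
    simp [polarPoint]
    field_simp
    ring
  · refine (hs.fun_div hw' hw).congr_deriv ?_
    simp [polarPoint]
    field_simp
    ring
  · refine (((hy'.fun_mul hc).fun_add ((hl'.fun_mul hz').fun_mul hs)).const_mul v).congr_deriv ?_
    simp [polarPoint]
    field_simp
    ring
  · refine (((hy'.fun_mul hs).fun_sub ((hl'.fun_mul hz').fun_mul hc)).const_mul v).congr_deriv ?_
    simp [polarPoint]
    field_simp
    ring

theorem hasDerivAt_legF {t C : ℝ → ℝ} {t' C' θ : ℝ} (ht : HasDerivAt t t' θ)
    (hC : HasDerivAt C C' θ) (h : 0 < 1 - 2 * t θ * C θ + t θ ^ 2) :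
    HasDerivAt (fun θ => legF (t θ) (C θ))
      (legF (t θ) (C θ) ^ 3 * (t' * (C θ - t θ) + t θ * C')) θ := by
  have hD := ((((ht.const_mul 2).fun_mul hC).const_sub 1).fun_add (ht.fun_pow 2))
  have hr : Real.sqrt (1 - 2 * t θ * C θ + t θ ^ 2) ≠ 0 := (Real.sqrt_pos.2 h).ne'
  refine ((hD.sqrt h.ne').fun_inv hr).congr_deriv ?_
  rw [legF]
  field_simp
  push_cast
  ring

theorem hasDerivAt_potU {μ d θ z' : ℝ} {z : ℝ → ℝ} (hμ : 0 ≤ μ) (hμ' : μ ≤ 1 / 2) (hd : 0 ≤ d)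
    (hz : 0 < z θ) (ht : (1 - μ) * z θ * d ≤ 2 / 5) (hz' : HasDerivAt z z' θ) :
    HasDerivAt (fun θ => potU μ d (Real.cos θ) (z θ))
      (potK μ d (Real.cos θ) (z θ) / z θ * z' + potT μ d (Real.cos θ) (Real.sin θ) (z θ)) θ := by
  have hzd : 0 ≤ z θ * d := by positivity
  have g1 : 0 ≤ μ * z θ * d := by positivity
  have g2 : 0 ≤ (1 - μ) * z θ * d := by rw [mul_assoc]; exact mul_nonneg (by linarith) hzd
  have g3 : μ * z θ * d < 1 := by nlinarith
  have c1 : -Real.cos θ ≤ 1 := by linarith [Real.neg_one_le_cos θ]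
  have c2 := Real.cos_le_one θ
  have d1 := hasDerivAt_legF ((hz'.const_mul μ).mul_const d) (Real.hasDerivAt_cos θ).fun_neg
    (legendre_disc_pos g1 g3 c1)
  have d2 := hasDerivAt_legF ((hz'.const_mul (1 - μ)).mul_const d) (Real.hasDerivAt_cos θ)
    (legendre_disc_pos g2 (by linarith) c2)
  have s1 := legF_sq_mul g1 g3 c1
  have s2 := legF_sq_mul g2 (by linarith) c2
  refine (hz'.fun_mul ((d1.const_mul (1 - μ)).fun_add (d2.const_mul μ))).congr_deriv ?_
  rw [potK, potT, mul_div_cancel_left₀ _ hz.ne', legG, legG]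
  generalize legF (μ * z θ * d) (-Real.cos θ) = f at *
  generalize legF ((1 - μ) * z θ * d) (Real.cos θ) = g at *
  linear_combination (-z' * (1 - μ) * f) * s1 - (z' * μ * g) * s2

theorem hasDerivAt_polL {ε θ K W : ℝ} {z y U : ℝ → ℝ} (hε : 0 < ε) (hz : 0 < z θ)
    (hD : 0 < 1 - 2 * ε * z θ ^ 2 - ε ^ 2 * z θ ^ 2 * (1 - 2 * U θ + y θ ^ 2))
    (hz' : HasDerivAt z (-(ε * z θ ^ 2 * y θ / polS ε (z θ) (y θ) (U θ))) θ)
    (hy' : HasDerivAt y (ε * z θ * (polL ε (z θ) (y θ) (U θ) ^ 2 * z θ ^ 2 - K)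
      / polS ε (z θ) (y θ) (U θ)) θ)
    (hU' : HasDerivAt U (K / z θ * (-(ε * z θ ^ 2 * y θ / polS ε (z θ) (y θ) (U θ))) + W) θ) :
    HasDerivAt (fun θ => polL ε (z θ) (y θ) (U θ))
      (-(ε * W / polS ε (z θ) (y θ) (U θ))) θ := by
  have hS : polS ε (z θ) (y θ) (U θ) ≠ 0 := (Real.sqrt_pos.2 hD).ne'
  have hS2 : polS ε (z θ) (y θ) (U θ) ^ 2
      = 1 - 2 * ε * z θ ^ 2 - ε ^ 2 * z θ ^ 2 * (1 - 2 * U θ + y θ ^ 2) := Real.sq_sqrt hD.le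
  have hD' := ((((hz'.fun_pow 2).const_mul (2 * ε)).const_sub 1).fun_sub
    (((hz'.fun_pow 2).const_mul (ε ^ 2)).fun_mul
      (((hU'.const_mul 2).const_sub 1).fun_add (hy'.fun_pow 2))))
  have hS' := hD'.sqrt hD.ne'
  have hden : ε * z θ ^ 2 ≠ 0 := by positivity
  refine ((hS'.const_sub 1).fun_div ((hz'.fun_pow 2).const_mul ε) hden).congr_deriv ?_
  have : Real.sqrt (1 - 2 * ε * z θ ^ 2 - ε ^ 2 * z θ ^ 2 * (1 - 2 * U θ + y θ ^ 2))
    = polS ε (z θ) (y θ) (U θ) := rfl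
  rw [this, polL]
  generalize polS ε (z θ) (y θ) (U θ) = S at *
  field_simp
  push_cast
  linear_combination (-(2 * z θ * y θ)) * hS2

theorem contDiffAt_legF {E : Type*} [NormedAddCommGroup E] [NormedSpace ℝ E] {t C : E → ℝ} {p : E}
    (ht : ContDiffAt ℝ 1 t p) (hC : ContDiffAt ℝ 1 C p) (h : 0 < 1 - 2 * t p * C p + t p ^ 2) :
    ContDiffAt ℝ 1 (fun q => legF (t q) (C q)) p := by
  unfold legF
  exact ((((contDiffAt_const.sub ((contDiffAt_const.mul ht).mul hC)).add (ht.pow 2)).sqrt h.ne').inv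
    (Real.sqrt_pos.2 h).ne')

theorem contDiffAt_potU_potK {μ d : ℝ} {p : ℝ × ℝ × ℝ} (hμ : 0 ≤ μ) (hμ' : μ ≤ 1 / 2) (hd : 0 ≤ d)
    (hz : 0 < p.2.1) (ht : (1 - μ) * p.2.1 * d ≤ 2 / 5) (hC : p.1 ∈ Icc (-1 : ℝ) 1) :
    ContDiffAt ℝ 1 (fun q : ℝ × ℝ × ℝ => potU μ d q.1 q.2.1) p ∧
    ContDiffAt ℝ 1 (fun q : ℝ × ℝ × ℝ => potK μ d q.1 q.2.1) p := by
  have hzd : 0 ≤ p.2.1 * d := by positivity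
  have g1 : 0 ≤ μ * p.2.1 * d := by positivity
  have g2 : 0 ≤ (1 - μ) * p.2.1 * d := by rw [mul_assoc]; exact mul_nonneg (by linarith) hzd
  have g3 : μ * p.2.1 * d < 1 := by nlinarith
  have c1 : ContDiffAt ℝ 1 (fun q : ℝ × ℝ × ℝ => q.1) p := by fun_prop
  have c2 : ContDiffAt ℝ 1 (fun q : ℝ × ℝ × ℝ => q.2.1) p := by fun_prop
  have t1 : ContDiffAt ℝ 1 (fun q : ℝ × ℝ × ℝ => μ * q.2.1 * d) p := by fun_prop
  have t2 : ContDiffAt ℝ 1 (fun q : ℝ × ℝ × ℝ => (1 - μ) * q.2.1 * d) p := by fun_prop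
  have f1 := contDiffAt_legF t1 c1.neg (legendre_disc_pos g1 g3 (by linarith [hC.1]))
  have f2 := contDiffAt_legF t2 c1 (legendre_disc_pos g2 (by linarith) hC.2)
  unfold potU potK legG
  constructor
  · exact c2.mul ((contDiffAt_const.mul f1).add (contDiffAt_const.mul f2))
  · exact c2.mul ((contDiffAt_const.mul ((f1.pow 3).mul (contDiffAt_const.sub (t1.mul c1.neg)))).add
      (contDiffAt_const.mul ((f2.pow 3).mul (contDiffAt_const.sub (t2.mul c1)))))

theorem contDiffAt_polS {ε : ℝ} {u : ℝ × ℝ × ℝ → ℝ} {p : ℝ × ℝ × ℝ} (hu : ContDiffAt ℝ 1 u p)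
    (h : 0 < 1 - 2 * ε * p.2.1 ^ 2 - ε ^ 2 * p.2.1 ^ 2 * (1 - 2 * u p + p.2.2 ^ 2)) :
    ContDiffAt ℝ 1 (fun q => polS ε q.2.1 q.2.2 (u q)) p := by
  unfold polS
  refine ContDiffAt.sqrt ?_ h.ne'
  fun_prop

/-- If the reduced polar equations are controlled on a box, there is a symmetric orbit in that box
circling around both primaries. -/
theorem exists_symmetric_orbit {μ v A B Y j₀ j₁ S₀ : ℝ} (hμ : 0 ≤ μ) (hμ' : μ ≤ 1 / 2) (hv : 0 < v)
    (hA : 0 ≤ A) (hA1 : A < 1) (hB : 0 ≤ B) (hB1 : B ≤ 1) (hY : 0 ≤ Y)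
        (ht : (1 - μ) * (1 + B) * v ^ 2 ≤ 2 / 5)
    (hS₀ : 0 < S₀)
    (hbox : ∀ C ∈ Icc (-1 : ℝ) 1, ∀ z ∈ Icc (1 - A) (1 + B), ∀ y ∈ Icc (-Y) Y,
      S₀ ≤ polS (v ^ 3) z y (potU μ (v ^ 2) C z) ∧
      2 * (v ^ 3 * z ^ 2) ≤ polS (v ^ 3) z y (potU μ (v ^ 2) C z) ∧
      -j₀ ≤ polJ (v ^ 3) (μ * (1 - μ) * v ^ 4) C z y (potU μ (v ^ 2) C z) (potK μ (v ^ 2) C z) ∧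
      polJ (v ^ 3) (μ * (1 - μ) * v ^ 4) C z y (potU μ (v ^ 2) C z) (potK μ (v ^ 2) C z) ≤ j₁)
    (hj0 : 0 ≤ j₀) (hj1 : 0 ≤ j₁)
    (hW1 : j₁ + 2.13 * (μ * (1 - μ) * v ^ 7) ≤ A) (hW0 : j₀ + 2.13 * (μ * (1 - μ) * v ^ 7) ≤ B)
    (hW2 : j₀ + j₁ + 4.5 * (μ * (1 - μ) * v ^ 7) ≤ Y) :
    ∃ (T : ℝ) (γ : ℝ → V4), 0 < T ∧ T ≤ 2 * Real.pi / S₀ ∧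
      IsOrbit (JacobiH μ) (JacobiDom μ) γ ∧ (∀ t, γ (t + T) = γ t) ∧
      (∀ t, JacobiH μ (γ t) = -(1 / v + v ^ 2 / 2)) ∧ (∀ t, γ t = Rplus (γ (T - t))) ∧
      {t ∈ Ico 0 T | γ t 1 = 0}.ncard = 2 ∧
      ∀ t, ∃ C σ z y : ℝ, C ^ 2 + σ ^ 2 = 1 ∧ 1 - (j₁ + 2.13 * (μ * (1 - μ) * v ^ 7)) ≤ z ∧
        z ≤ 1 + (j₀ + 2.13 * (μ * (1 - μ) * v ^ 7)) ∧ y ∈ Icc (-Y) Y ∧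
        γ t = polarPoint v C σ z y (polL (v ^ 3) z y (potU μ (v ^ 2) C z)) := by
  have hε : 0 < v ^ 3 := by positivity
  have hm : 0 ≤ μ * (1 - μ) := mul_nonneg hμ (by linarith)
  have hβ : 0 ≤ μ * (1 - μ) * v ^ 7 := by positivity
  have ht' : ∀ z ≤ 1 + B, (1 - μ) * z * v ^ 2 ≤ 2 / 5 := fun z hz =>
    le_trans (by gcongr; linarith) ht
  have hpos : ∀ {ε z y U : ℝ}, 0 < polS ε z y U →
      0 < 1 - 2 * ε * z ^ 2 - ε ^ 2 * z ^ 2 * (1 - 2 * U + y ^ 2) := Real.sqrt_pos.1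
  have hDD : ∀ p ∈ Icc (-1 : ℝ) 1 ×ˢ Icc (1 - A) (1 + B) ×ˢ Icc (-Y) Y,
      ContDiffAt ℝ 1 (fun q : ℝ × ℝ × ℝ => polS (v ^ 3) q.2.1 q.2.2 (potU μ (v ^ 2) q.1 q.2.1)) p ∧
      ContDiffAt ℝ 1 (fun q : ℝ × ℝ × ℝ => potK μ (v ^ 2) q.1 q.2.1) p ∧ 0 < p.2.1 ∧
      0 < polS (v ^ 3) p.2.1 p.2.2 (potU μ (v ^ 2) p.1 p.2.1) := by
    intro p hp
    have hz : 0 < p.2.1 := by linarith [hp.2.1.1]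
    have hS := hS₀.trans_le (hbox _ hp.1 _ hp.2.1 _ hp.2.2).1
    obtain ⟨h1, h2⟩ := contDiffAt_potU_potK (p := p) hμ hμ' (sq_nonneg v) hz (ht' _ hp.2.1.2) hp.1
    exact ⟨contDiffAt_polS h1 (hpos hS), h2, hz, hS⟩
  obtain ⟨gN, hN⟩ : ∃ g : ℝ × ℝ × ℝ → ℝ, g =
      fun q => v ^ 3 * q.2.1 ^ 2 / polS (v ^ 3) q.2.1 q.2.2 (potU μ (v ^ 2) q.1 q.2.1) := ⟨_, rfl⟩
  obtain ⟨gJ, hJ⟩ : ∃ g : ℝ × ℝ × ℝ → ℝ, g =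
      fun q => polJ (v ^ 3) (μ * (1 - μ) * v ^ 4) q.1 q.2.1 q.2.2
        (potU μ (v ^ 2) q.1 q.2.1) (potK μ (v ^ 2) q.1 q.2.1) := ⟨_, rfl⟩
  have hgN : ∀ p ∈ Icc (-1 : ℝ) 1 ×ˢ Icc (1 - A) (1 + B) ×ˢ Icc (-Y) Y, ContDiffAt ℝ 1 gN p := by
    rw [hN]
    intro p hp
    obtain ⟨h1, h2, h3, h4⟩ := hDD p hp
    exact ContDiffAt.div (by fun_prop) h1 h4.ne'
  have hgJ : ∀ p ∈ Icc (-1 : ℝ) 1 ×ˢ Icc (1 - A) (1 + B) ×ˢ Icc (-Y) Y, ContDiffAt ℝ 1 gJ p := by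
    rw [hJ]
    intro p hp
    obtain ⟨h1, h2, h3, h4⟩ := hDD p hp
    have c2 : ContDiffAt ℝ 1 (fun q : ℝ × ℝ × ℝ => q.2.1) p := by fun_prop
    have e1 : v ^ 3 * p.2.1 ^ 2 ≠ 0 := by positivity
    have e2 : p.2.1 ^ 2 ≠ 0 := by positivity
    unfold polJ polL
    refine (((((contDiffAt_const.sub h1).div (by fun_prop) e1).pow 2).mul c2).sub
      (h2.div c2 h3.ne')).sub (c2.sub contDiffAt_const) |>.add (ContDiffAt.mul (by fun_prop)
      (h1.div (by fun_prop) e2))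
  have hNe : ∀ C z y, gN (C, z, -y) = gN (C, z, y) := by
    intro C z y
    simp only [hN, polS, neg_sq]
  have hJe : ∀ C z y, gJ (C, z, -y) = gJ (C, z, y) := by
    intro C z y
    simp only [hJ, polJ, polL, polS, neg_sq]
  have hb : ∀ C ∈ Icc (-1 : ℝ) 1, ∀ z ∈ Icc (1 - A) (1 + B), ∀ y ∈ Icc (-Y) Y,
      0 ≤ gN (C, z, y) ∧ gN (C, z, y) ≤ 1 / 2 ∧ -j₀ ≤ gJ (C, z, y) ∧ gJ (C, z, y) ≤ j₁ := by
    intro C hC z hz y hy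
    obtain ⟨h1, h2, h3, h4⟩ := hbox C hC z hz y hy
    have hS := hS₀.trans_le h1
    rw [hN, hJ]
    refine ⟨by positivity, ?_, h3, h4⟩
    rw [div_le_iff₀ hS]
    linarith
  obtain ⟨z, y, hz', hy', hze, hyo, hzp, hyp, hz0, hz1, hyb⟩ := driven_oscillator_periodic
    (gN := gN) (gJ := gJ) (A := A) (B := B) (Y := Y) (j₀ := j₀) (j₁ := j₁)
    (β := 3 * (μ * (1 - μ) * v ^ 7)) hA hB hY (by linarith) hgN hgJ hNe hJe hb hj0 hj1 (by linarith)
    (by linarith) (by linarith) (by linarith) (by linarith)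
  have hzm : ∀ θ, z θ ∈ Icc (1 - A) (1 + B) := fun θ =>
    ⟨by linarith [hz0 θ], by linarith [hz1 θ]⟩
  have hcos : ∀ θ, Real.cos θ ∈ Icc (-1 : ℝ) 1 := fun θ => ⟨Real.neg_one_le_cos θ,
      Real.cos_le_one θ⟩
  have hzpos : ∀ θ, 0 < z θ := fun θ => by linarith [(hzm θ).1]
  have hS : ∀ θ, S₀ ≤ polS (v ^ 3) (z θ) (y θ) (potU μ (v ^ 2) (Real.cos θ) (z θ)) := fun θ =>
    (hbox _ (hcos θ) _ (hzm θ) _ (hyb θ)).1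
  have hSpos := fun θ => hS₀.trans_le (hS θ)
  have hSl : ∀ θ, 1 - v ^ 3 * z θ ^ 2 *
      polL (v ^ 3) (z θ) (y θ) (potU μ (v ^ 2) (Real.cos θ) (z θ))
      = polS (v ^ 3) (z θ) (y θ) (potU μ (v ^ 2) (Real.cos θ) (z θ)) := fun θ => by
    have := hzpos θ
    rw [polL]
    field_simp
    ring
  have hcs : ∀ θ, Real.cos θ ^ 2 + Real.sin θ ^ 2 = 1 := fun θ => by
    linarith [Real.sin_sq_add_cos_sq θ]
  have hdz : ∀ θ, HasDerivAt z (-(v ^ 3 * z θ ^ 2 * y θ /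
      polS (v ^ 3) (z θ) (y θ) (potU μ (v ^ 2) (Real.cos θ) (z θ)))) θ := fun θ => by
    refine (hz' θ).congr_deriv ?_
    rw [hN]
    ring
  have hdy : ∀ θ, HasDerivAt y (v ^ 3 * z θ * (polL (v ^ 3) (z θ) (y θ)
      (potU μ (v ^ 2) (Real.cos θ) (z θ)) ^ 2 * z θ ^ 2 - potK μ (v ^ 2) (Real.cos θ) (z θ)) /
      polS (v ^ 3) (z θ) (y θ) (potU μ (v ^ 2) (Real.cos θ) (z θ))) θ := fun θ => by
    refine (hy' θ).congr_deriv ?_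
    rw [hN, hJ]
    dsimp only
    have h1 := (hSpos θ).ne'
    have h2 := (hzpos θ).ne'
    rw [polJ]
    generalize polL (v ^ 3) (z θ) (y θ) (potU μ (v ^ 2) (Real.cos θ) (z θ)) = l
    generalize polS (v ^ 3) (z θ) (y θ) (potU μ (v ^ 2) (Real.cos θ) (z θ)) = S at *
    field_simp
    ring
  have hdl : ∀ θ, HasDerivAt
      (fun θ => polL (v ^ 3) (z θ) (y θ) (potU μ (v ^ 2) (Real.cos θ) (z θ)))
      (-(v ^ 3 * potT μ (v ^ 2) (Real.cos θ) (Real.sin θ) (z θ) /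
        polS (v ^ 3) (z θ) (y θ) (potU μ (v ^ 2) (Real.cos θ) (z θ)))) θ := fun θ =>
    hasDerivAt_polL (U := fun θ => potU μ (v ^ 2) (Real.cos θ) (z θ)) hε (hzpos θ) (hpos (hSpos θ))
      (hdz θ) (hdy θ) (hasDerivAt_potU hμ hμ' (sq_nonneg v) (hzpos θ) (ht' _ (hzm θ).2) (hdz θ))
  obtain ⟨l, hl⟩ : ∃ l : ℝ → ℝ,
    ∀ θ, l θ = polL (v ^ 3) (z θ) (y θ) (potU μ (v ^ 2) (Real.cos θ) (z θ)) := ⟨_, fun _ => rfl⟩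
  simp only [← hl] at hSl hdy hdl
  have hlc : Continuous l := continuous_iff_continuousAt.2 fun θ => (hdl θ).continuousAt
  have hzc : Continuous z := continuous_iff_continuousAt.2 fun θ => (hdz θ).continuousAt
  simp only [← hSl] at hdz hdy hdl
  have hdom : ∀ θ, polarPoint v (Real.cos θ) (Real.sin θ) (z θ) (y θ) (l θ) ∈ JacobiDom μ :=
    fun θ => polarPoint_mem_dom hv (hzpos θ) (hcs θ) hμ hμ' (ht' _ (hzm θ).2)
  have hle : ∀ θ, l (-θ) = l θ := fun θ => by
    simp only [hl, hze, hyo, Real.cos_neg, polL, polS, neg_sq]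
  have hlp : ∀ θ, l (θ + 2 * Real.pi) = l θ := fun θ => by
    simp only [hl, hzp, hyp, Real.cos_add_two_pi]
  obtain ⟨T, γ, hT0, hT1, hγ, hper, hsym, hcard, hpt⟩ := exists_orbit_of_angle_param
    (H := JacobiH μ) (D := JacobiDom μ)
    (X := fun θ => polarPoint v (Real.cos θ) (Real.sin θ) (z θ) (y θ) (l θ))
    (S := fun θ => 1 - v ^ 3 * z θ ^ 2 * l θ) (ρ := fun θ => 1 / (v ^ 2 * z θ)) hS₀
    (fun θ => (hS θ).trans_eq (hSl θ).symm) (by fun_prop)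
    (fun θ => by simp only [hze, hle]) (fun θ => by simp only [hzp, hlp]) hdom
    (fun θ => hasDerivAt_polarPoint hv (hzpos θ) ((hSpos θ).trans_eq (hSl θ).symm).ne' (hdom θ)
      (hdz θ) (hdy θ) (hdl θ))
    (fun θ => by simp only [hzp, hyp, hlp, Real.cos_add_two_pi, Real.sin_add_two_pi])
    (fun θ => by simp only [Rplus_polarPoint, hze, hyo, hle, Real.cos_neg, Real.sin_neg])
    (fun θ => by have := hzpos θ; positivity)
    (fun θ => by simp only [polarPoint, cons_val_one, cons_val_zero]; ring)
  refine ⟨T, γ, hT0, hT1, hγ, hper, fun t => ?_, hsym, hcard, fun t => ?_⟩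
  · obtain ⟨θ, hθ⟩ := hpt t
    have h1 := hSl θ
    have h2 := Real.sq_sqrt (hpos (hSpos θ)).le
    rw [← polS, ← h1] at h2
    rw [hθ, jacobiH_polarPoint μ hv (hzpos θ) (hcs θ)]
    have h3 : v ^ 3 * z θ ^ 2 * (v ^ 3 * (z θ ^ 2 * l θ ^ 2) - 2 * l θ + 2
      + v ^ 3 * (1 - 2 * potU μ (v ^ 2) (Real.cos θ) (z θ) + y θ ^ 2)) = 0 := by
      linear_combination h2
    have h4 := (mul_eq_zero.1 h3).resolve_left (by have := hzpos θ; positivity)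
    field_simp
    linear_combination h4
  · obtain ⟨θ, hθ⟩ := hpt t
    refine ⟨Real.cos θ, Real.sin θ, z θ, y θ, hcs θ, by linarith [hz0 θ], by linarith [hz1 θ],
        hyb θ,
      ?_⟩
    rw [hθ, hl]

/-- Estimates on the large box `z ∈ [0.92, 1.11]`, `|y| ≤ 0.185`. -/
theorem large_box_bounds {μ v C z y : ℝ} (hμ : 0 ≤ μ) (hμ' : μ ≤ 1 / 2) (h0 : 0.13 ≤ v ^ 3)
    (h1 : v ^ 3 ≤ 0.2426) (ht : (1 - μ) * 1.11 * v ^ 2 ≤ 2 / 5)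
    (hn : μ * (1 - μ) * v ^ 4 ≤ 0.0215) (hk3 : μ * (1 - μ) * (1 - 2 * μ) * v ^ 6 ≤ 0.0046)
    (hk4 : μ * (1 - μ) * (1 - 3 * (μ * (1 - μ))) * v ^ 8 ≤ 0.0017) (hC : C ∈ Icc (-1 : ℝ) 1)
    (hz : z ∈ Icc (1 - 0.08 : ℝ) (1 + 0.11)) (hy : y ∈ Icc (-0.185 : ℝ) 0.185) :
    (1 - v ^ 3 * z ^ 2 - 0.0052 ≤ polS (v ^ 3) z y (potU μ (v ^ 2) C z) ∧
      polS (v ^ 3) z y (potU μ (v ^ 2) C z) ≤ 1 - v ^ 3 * z ^ 2 + 0.0052) ∧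
    |polL (v ^ 3) z y (potU μ (v ^ 2) C z) - 1| ≤ 0.0165 ∧
    -(3.08 * (μ * (1 - μ) * v ^ 4) + 6.66 * (μ * (1 - μ) * (1 - 2 * μ) * v ^ 6)
        + 16.62 * (μ * (1 - μ) * (1 - 3 * (μ * (1 - μ))) * v ^ 8))
      ≤ polJ (v ^ 3) (μ * (1 - μ) * v ^ 4) C z y (potU μ (v ^ 2) C z) (potK μ (v ^ 2) C z) ∧
    polJ (v ^ 3) (μ * (1 - μ) * v ^ 4) C z y (potU μ (v ^ 2) C z) (potK μ (v ^ 2) C z)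
      ≤ 0.0181 + 0.69 * (μ * (1 - μ) * v ^ 4) + 6.66 * (μ * (1 - μ) * (1 - 2 * μ) * v ^ 6)
        + 6.4 * (μ * (1 - μ) * (1 - 3 * (μ * (1 - μ))) * v ^ 8) := by
  obtain ⟨hz0, hz1⟩ := hz
  obtain ⟨hy0, hy1⟩ := hy
  have hm : 0 ≤ μ * (1 - μ) := mul_nonneg hμ (by linarith)
  have hm' : 0 ≤ 1 - 3 * (μ * (1 - μ)) := by nlinarith only [sq_nonneg (1 - 2 * μ)]
  have hzp : 0 < z := by linarith
  have ht' : (1 - μ) * z * v ^ 2 ≤ 2 / 5 := le_trans (by gcongr <;> linarith) ht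
  have en : μ * (1 - μ) * v ^ 4 = μ * (1 - μ) * (v ^ 2) ^ 2 := by ring
  have e3 : μ * (1 - μ) * (1 - 2 * μ) * v ^ 6 = μ * (1 - μ) * v ^ 4 * (1 - 2 * μ) * v ^ 2 := by ring
  have e4 : μ * (1 - μ) * (1 - 3 * (μ * (1 - μ))) * v ^ 8
    = μ * (1 - μ) * v ^ 4 * (1 - 3 * (μ * (1 - μ))) * (v ^ 2) ^ 2 := by ring
  obtain ⟨hη, hη'⟩ := potU_bounds hμ hμ' (sq_nonneg v) hzp ht' hC.1 hC.2 en e3 e4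
  obtain ⟨hκ, hκ'⟩ := potK_bounds hμ hμ' (sq_nonneg v) hzp ht' hC.1 hC.2 en e3 e4
  have h3 : 0 ≤ μ * (1 - μ) * (1 - 2 * μ) * v ^ 6 :=
    mul_nonneg (mul_nonneg hm (by linarith)) (by positivity)
  obtain ⟨a1, -, a3, -, -, a6, a7⟩ := box_bounds (ε₀ := 0.13) (ε₁ := 0.2426) (z₀ := 0.92)
    (z₁ := 1.11) (Y := 0.0343) (D := 0.0121) (n₁ := 0.0215) (m₃ := 0.0046) (m₄ := 0.0017)
    (Xm := 0.0944) (s₀ := 0.7010) (δ := 0.0052) (lam := 0.0165) (e₁ := 0.351) (q₀ := 0.564)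
    (q₁ := 1.0633) (cn := 3.08) (dn := 0.69) (c₃ := 6.66) (c₄ := 16.62) (d₄ := 6.4) (d₀ := 0.0181)
    (y := y) (by norm_num) h0 h1 (by positivity) hn h3 hk3 (by positivity) hk4 hC.1 hC.2
    (by norm_num) (by linarith) (by linarith) (by nlinarith only [hy0, hy1])
    (by nlinarith only [hz0, hz1]) hη hη' hκ hκ'
    (by norm_num) (by norm_num) (by norm_num) (by norm_num) (by norm_num) (by norm_num)
    (by norm_num) (by norm_num) (by norm_num) (by norm_num) (by norm_num) (by norm_num)
    (by norm_num) (by norm_num) (by norm_num) (by norm_num) (by norm_num) (by norm_num)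
    (by norm_num) (by norm_num) (by norm_num) (by norm_num)
  exact ⟨a1, a3, a6, a7⟩

/-- Estimates on the small box `z ∈ [0.97, 1.08]`, `|y| ≤ 0.1`. -/
theorem small_box_bounds {μ v C z y : ℝ} (hμ : 0 ≤ μ) (hμ' : μ ≤ 1 / 2) (h0 : 0.13 ≤ v ^ 3)
    (h1 : v ^ 3 ≤ 0.16) (ht : (1 - μ) * 1.08 * v ^ 2 ≤ 2 / 5)
    (hn : μ * (1 - μ) * v ^ 4 ≤ 0.0215) (hk3 : μ * (1 - μ) * (1 - 2 * μ) * v ^ 6 ≤ 0.00065)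
    (hk4 : μ * (1 - μ) * (1 - 3 * (μ * (1 - μ))) * v ^ 8 ≤ 0.0005) (hC : C ∈ Icc (-1 : ℝ) 1)
    (hz : z ∈ Icc (1 - 0.03 : ℝ) (1 + 0.08)) (hy : y ∈ Icc (-0.1 : ℝ) 0.1) :
    (1 - v ^ 3 * z ^ 2 - 0.0011 ≤ polS (v ^ 3) z y (potU μ (v ^ 2) C z) ∧
      polS (v ^ 3) z y (potU μ (v ^ 2) C z) ≤ 1 - v ^ 3 * z ^ 2 + 0.0011) ∧
    |polL (v ^ 3) z y (potU μ (v ^ 2) C z) - 1| ≤ 0.006 ∧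
    -(1.95 * (μ * (1 - μ) * v ^ 4) + 5.63 * (μ * (1 - μ) * (1 - 2 * μ) * v ^ 6)
        + 14 * (μ * (1 - μ) * (1 - 3 * (μ * (1 - μ))) * v ^ 8))
      ≤ polJ (v ^ 3) (μ * (1 - μ) * v ^ 4) C z y (potU μ (v ^ 2) C z) (potK μ (v ^ 2) C z) ∧
    polJ (v ^ 3) (μ * (1 - μ) * v ^ 4) C z y (potU μ (v ^ 2) C z) (potK μ (v ^ 2) C z)
      ≤ 0.0036 + 5.63 * (μ * (1 - μ) * (1 - 2 * μ) * v ^ 6)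
        + 5.3 * (μ * (1 - μ) * (1 - 3 * (μ * (1 - μ))) * v ^ 8) := by
  obtain ⟨hz0, hz1⟩ := hz
  obtain ⟨hy0, hy1⟩ := hy
  have hm : 0 ≤ μ * (1 - μ) := mul_nonneg hμ (by linarith)
  have hm' : 0 ≤ 1 - 3 * (μ * (1 - μ)) := by nlinarith only [sq_nonneg (1 - 2 * μ)]
  have hzp : 0 < z := by linarith
  have ht' : (1 - μ) * z * v ^ 2 ≤ 2 / 5 := le_trans (by gcongr <;> linarith) ht
  have en : μ * (1 - μ) * v ^ 4 = μ * (1 - μ) * (v ^ 2) ^ 2 := by ring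
  have e3 : μ * (1 - μ) * (1 - 2 * μ) * v ^ 6 = μ * (1 - μ) * v ^ 4 * (1 - 2 * μ) * v ^ 2 := by ring
  have e4 : μ * (1 - μ) * (1 - 3 * (μ * (1 - μ))) * v ^ 8
    = μ * (1 - μ) * v ^ 4 * (1 - 3 * (μ * (1 - μ))) * (v ^ 2) ^ 2 := by ring
  obtain ⟨hη, hη'⟩ := potU_bounds hμ hμ' (sq_nonneg v) hzp ht' hC.1 hC.2 en e3 e4
  obtain ⟨hκ, hκ'⟩ := potK_bounds hμ hμ' (sq_nonneg v) hzp ht' hC.1 hC.2 en e3 e4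
  have h3 : 0 ≤ μ * (1 - μ) * (1 - 2 * μ) * v ^ 6 :=
    mul_nonneg (mul_nonneg hm (by linarith)) (by positivity)
  obtain ⟨a1, -, a3, -, -, a6, a7⟩ := box_bounds (ε₀ := 0.13) (ε₁ := 0.16) (z₀ := 0.97)
    (z₁ := 1.08) (Y := 0.01) (D := 0.0064) (n₁ := 0.0215) (m₃ := 0.00065) (m₄ := 0.0005)
    (Xm := 0.0584) (s₀ := 0.8133) (δ := 0.0011) (lam := 0.006) (e₁ := 0.198) (q₀ := 0.696)
    (q₁ := 0.934) (cn := 1.95) (dn := 0) (c₃ := 5.63) (c₄ := 14) (d₄ := 5.3) (d₀ := 0.0036)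
    (y := y) (by norm_num) h0 h1 (by positivity) hn h3 hk3 (by positivity) hk4 hC.1 hC.2
    (by norm_num) (by linarith) (by linarith) (by nlinarith only [hy0, hy1])
    (by nlinarith only [hz0, hz1]) hη hη' hκ hκ'
    (by norm_num) (by norm_num) (by norm_num) (by norm_num) (by norm_num) (by norm_num)
    (by norm_num) (by norm_num) (by norm_num) (by norm_num) (by norm_num) (by norm_num)
    (by norm_num) (by norm_num) (by norm_num) (by norm_num) (by norm_num) (by norm_num)
    (by norm_num) (by norm_num) (by norm_num) (by norm_num)
  exact ⟨a1, a3, a6, by linarith only [a7]⟩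

theorem legF_cube_le {t C : ℝ} (ht : 0 ≤ t) (ht' : t ≤ 2 / 5) (hC : -1 ≤ C) (hC' : C ≤ 1) :
    legF t C ^ 3 ≤ 1 + 3 * (t * C) + 15.3 * t ^ 2 := by
  have h1 : t < 1 := by linarith
  have hD := legendre_disc_pos ht h1 hC'
  have hf := legF_sq_mul ht h1 hC'
  have hf0 := legF_pos ht h1 hC'
  have hC2 : C ^ 2 ≤ 1 := by nlinarith only [hC, hC']
  have hP3 : (5 * C ^ 3 - 3 * C) / 2 ≤ 1 := (abs_le.1 (abs_legendre_three_le hC hC')).2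
  have ht2 : 0 ≤ t ^ 2 := sq_nonneg t
  have hF : legF t C ≤ 1 + t * C + 1.67 * t ^ 2 := by
    have a1 : t ^ 2 * ((3 * C ^ 2 - 1) / 2) ≤ t ^ 2 * 1 := by gcongr; linarith
    have a2 : t ^ 3 * ((5 * C ^ 3 - 3 * C) / 2) ≤ t ^ 3 * 1 := by gcongr
    have a3 : t ^ 3 ≤ 2 / 5 * t ^ 2 := by nlinarith only [ht2, ht']
    have a4 : t ^ 4 ≤ 4 / 25 * t ^ 2 := by nlinarith only [ht2, ht', ht, a3]
    linarith only [(legF_bounds ht ht' hC hC').2, a1, a2, a3, a4, ht2]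
  have hx : t * C ≤ t := mul_le_of_le_one_right ht hC'
  have hx2 : (t * C) ^ 2 ≤ t ^ 2 := by rw [mul_pow]; exact mul_le_of_le_one_right ht2 hC2
  have hB : 1 + t * C + 1.67 * t ^ 2
      ≤ (1 + 3 * (t * C) + 15.3 * t ^ 2) * (1 - 2 * t * C + t ^ 2) := by
    have h8 : 0 ≤ t ^ 2 * (8.63 - 27.6 * (t * C) + 15.3 * t ^ 2) :=
      mul_nonneg ht2 (by nlinarith only [hx, ht, ht'])
    nlinarith only [h8, hx2]
  have h3 : legF t C ^ 3 * (1 - 2 * t * C + t ^ 2) = legF t C := by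
    linear_combination legF t C * hf
  exact le_of_mul_le_mul_right (h3.trans_le (hF.trans hB)) hD

theorem abs_potT_le {μ d C σ z : ℝ} (hμ : 0 ≤ μ) (hμ' : μ ≤ 1 / 2) (hd : 0 ≤ d) (hz : 0 < z)
    (ht : (1 - μ) * z * d ≤ 2 / 5) (h : C ^ 2 + σ ^ 2 = 1) :
    |potT μ d C σ z| ≤ 4.65 * (z ^ 2 * (μ * (1 - μ)) * d) := by
  have hC : -1 ≤ C := by nlinarith only [h, sq_nonneg σ]
  have hC' : C ≤ 1 := by nlinarith only [h, sq_nonneg σ]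
  have hσ : |σ| ≤ 1 := abs_le_one_iff_mul_self_le_one.2 (by nlinarith only [h, sq_nonneg C])
  have hm : 0 ≤ μ * (1 - μ) := mul_nonneg hμ (by linarith)
  have hb : ∀ {t c : ℝ}, 0 ≤ t → t ≤ 2 / 5 → -1 ≤ c → c ≤ 1 →
      0 ≤ legF t c ^ 3 ∧ legF t c ^ 3 ≤ 4.65 := fun {t c} h0 h1 h2 h3 => by
    refine ⟨(pow_pos (legF_pos h0 (by linarith) h3) 3).le, (legF_cube_le h0 h1 h2 h3).trans ?_⟩
    nlinarith only [h0, h1, h2, h3, mul_le_of_le_one_right h0 h3]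
  have hzd : 0 ≤ z * d := mul_nonneg hz.le hd
  have ht1 : μ * z * d ≤ 2 / 5 := by nlinarith only [ht, hzd, hμ']
  obtain ⟨a1, a2⟩ := hb (c := -C) (by positivity : 0 ≤ μ * z * d) ht1 (by linarith) (by linarith)
  obtain ⟨b1, b2⟩ := hb (c := C) (t := (1 - μ) * z * d)
    (mul_nonneg (mul_nonneg (by linarith) hz.le) hd) ht hC hC'
  have hd' : |legF (μ * z * d) (-C) ^ 3 - legF ((1 - μ) * z * d) C ^ 3| ≤ 4.65 :=
    abs_le.2 ⟨by linarith, by linarith⟩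
  have h0 : 0 ≤ z ^ 2 * (μ * (1 - μ)) * d := by positivity
  calc |potT μ d C σ z|
      = |σ| * (z ^ 2 * (μ * (1 - μ)) * d) *
        |legF (μ * z * d) (-C) ^ 3 - legF ((1 - μ) * z * d) C ^ 3| := by
        rw [potT, show σ * z ^ 2 * (μ * (1 - μ)) * d = σ * (z ^ 2 * (μ * (1 - μ)) * d) by ring,
          abs_mul, abs_mul, abs_of_nonneg h0]
    _ ≤ 1 * (z ^ 2 * (μ * (1 - μ)) * d) * 4.65 := by gcongr
    _ = _ := by ring

theorem speedSq_polarPoint {v C σ z y l : ℝ} (hv : 0 < v) (hz : 0 < z) (h : C ^ 2 + σ ^ 2 = 1) :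
    speedSq (polarPoint v C σ z y l)
      = ((1 - v ^ 3 * z ^ 2 * l) ^ 2 / z ^ 2 + v ^ 6 * y ^ 2) / v ^ 4 := by
  simp only [speedSq, polarPoint, cons_val_zero, cons_val_one, cons_val]
  have : ((1 - v ^ 3 * z ^ 2 * l) ^ 2 / z ^ 2 + v ^ 6 * y ^ 2) / v ^ 4
      = ((1 - v ^ 3 * z ^ 2 * l) ^ 2 / z ^ 2 + v ^ 6 * y ^ 2) / v ^ 4 * (C ^ 2 + σ ^ 2) := by
    rw [h, mul_one]
  rw [this]
  field_simp
  ring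

theorem forceSq_polarPoint {v C σ z y l : ℝ} (μ : ℝ) (hv : 0 < v) (hz : 0 < z)
    (h : C ^ 2 + σ ^ 2 = 1) :
    forceSq μ (polarPoint v C σ z y l)
      = v ^ 2 * (z ^ 2 * (l - v ^ 3 * potK μ (v ^ 2) C z) ^ 2
        + (y + v ^ 3 * z * potT μ (v ^ 2) C σ z) ^ 2) := by
  obtain ⟨h0, h1⟩ := attr_polarPoint (y := y) (l := l) μ hv hz h
  rw [forceSq, h0, h1]
  simp only [polarPoint, cons_val]
  linear_combination (v ^ 2 * (z ^ 2 * (l - v ^ 3 * potK μ (v ^ 2) C z) ^ 2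
        + (y + v ^ 3 * z * potT μ (v ^ 2) C σ z) ^ 2)) * h

theorem tide_trace {μ : ℝ} {x : V4} (h1 : ((x 0 + μ) ^ 2 + x 1 ^ 2) * invDist (-μ) x ^ 2 = 1)
    (h2 : ((x 0 - (1 - μ)) ^ 2 + x 1 ^ 2) * invDist (1 - μ) x ^ 2 = 1) :
    tide00 μ x + tide11 μ x = (1 - μ) * invDist (-μ) x ^ 3 + μ * invDist (1 - μ) x ^ 3 := by
  rw [tide00, tide11]
  linear_combination 3 * (1 - μ) * invDist (-μ) x ^ 3 * h1 + 3 * μ * invDist (1 - μ) x ^ 3 * h2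

theorem tide_trace_polarPoint {μ v C σ z y l : ℝ} (hμ : 0 ≤ μ) (hμ' : μ ≤ 1 / 2) (hv : 0 < v)
    (hz : 0 < z) (ht : (1 - μ) * z * v ^ 2 ≤ 2 / 5) (h : C ^ 2 + σ ^ 2 = 1) :
    0 ≤ tide00 μ (polarPoint v C σ z y l) + tide11 μ (polarPoint v C σ z y l) ∧
    tide00 μ (polarPoint v C σ z y l) + tide11 μ (polarPoint v C σ z y l)
      ≤ (v ^ 2 * z) ^ 3 * (1 + 15.3 * (μ * (1 - μ) * v ^ 4) * z ^ 2) := by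
  have hC : -1 ≤ C := by nlinarith only [h, sq_nonneg σ]
  have hC' : C ≤ 1 := by nlinarith only [h, sq_nonneg σ]
  have hμ1 : 0 ≤ 1 - μ := by linarith
  have hzv : 0 < z * v ^ 2 := by positivity
  have ht1 : μ * z * v ^ 2 ≤ 2 / 5 := by nlinarith only [ht, hzv, hμ']
  have p1 : 0 ≤ μ * z * v ^ 2 := by positivity
  have p2 : 0 ≤ (1 - μ) * z * v ^ 2 := by positivity
  have q1 := legF_cube_le p1 ht1 (by linarith : -1 ≤ -C) (by linarith)
  have q2 := legF_cube_le p2 ht hC hC'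
  have f1 := legF_pos p1 (by linarith) (by linarith : -C ≤ 1)
  have f2 := legF_pos p2 (by linarith) hC'
  have s1 := legF_sq_mul p1 (by linarith) (by linarith : -C ≤ 1)
  have s2 := legF_sq_mul p2 (by linarith) hC'
  have d1 := dist_sq_polarPoint (y := y) (l := l) (-μ) hv hz h
  have d2 := dist_sq_polarPoint (y := y) (l := l) (1 - μ) hv hz h
  have i1 := invDist_neg_polarPoint (y := y) (l := l) μ hv hz h
  have i2 := invDist_polarPoint (y := y) (l := l) (1 - μ) hv hz h
  rw [tide_trace, i1, i2]
  · refine ⟨by positivity, ?_⟩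
    have : (1 - μ) * legF (μ * z * v ^ 2) (-C) ^ 3 + μ * legF ((1 - μ) * z * v ^ 2) C ^ 3
        ≤ 1 + 15.3 * (μ * (1 - μ) * v ^ 4) * z ^ 2 := by
      nlinarith only [mul_le_mul_of_nonneg_left q1 hμ1, mul_le_mul_of_nonneg_left q2 hμ]
    calc _ = (v ^ 2 * z) ^ 3 * ((1 - μ) * legF (μ * z * v ^ 2) (-C) ^ 3
          + μ * legF ((1 - μ) * z * v ^ 2) C ^ 3) := by ring
      _ ≤ _ := by gcongr
  · rw [sub_neg_eq_add] at d1
    rw [d1, i1]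
    field_simp
    linear_combination s1
  · rw [d2, i2]
    field_simp
    linear_combination s2

theorem large_box_numerics {ε z y l S K W c : ℝ} (h0 : 0.13 ≤ ε) (h1 : ε ≤ 0.2426) (hz0 : 0.92 ≤ z)
    (hz1 : z ≤ 1.11) (hS : 1 - ε * z ^ 2 - 0.0052 ≤ S) (hS' : S ≤ 1 - ε * z ^ 2 + 0.0052)
    (hl : |l - 1| ≤ 0.0165) (hK : 0.926 * z ≤ K) (hK' : K ≤ 1.13 * z) (hW : W ^ 2 ≤ 0.0732)
    (hy : y ^ 2 ≤ 0.0343) (hc : c ≤ 1.406) :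
    0.9948 - 1.2321 * ε ≤ S ∧
    S ^ 2 / z ^ 2 + ε ^ 2 * y ^ 2 ≤ (1.0052 - 0.8464 * ε) ^ 2 / 0.8464 + 0.0021 ∧
    c * (S ^ 2 + ε ^ 2 * z ^ 2 * y ^ 2) < 2 * z * (l - ε * K) ^ 2 ∧
    z ^ 2 * (l - ε * K) ^ 2 + W ^ 2 ≤ (1.11 * (1.0165 - 1.0277 * ε)) ^ 2 + 0.0732 := by
  obtain ⟨hl0, hl1⟩ := abs_le.1 hl
  have hzz0 : 0.8464 ≤ z ^ 2 := by nlinarith only [hz0]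
  have hzz1 : z ^ 2 ≤ 1.2321 := by nlinarith only [hz0, hz1]
  have b1 : ε * z ^ 2 ≤ ε * 1.2321 := by gcongr
  have b2 : ε * 0.8464 ≤ ε * z ^ 2 := by gcongr
  have hSm : 0.9948 - 1.2321 * ε ≤ S := by linarith only [hS, b1]
  have hSp : 0.69 ≤ S := by linarith only [hSm, h1]
  have hSz : S * 0.92 ≤ (1.0052 - 0.8464 * ε) * z := by
    nlinarith only [hS', h0, h1, hz0, mul_nonneg (sub_nonneg.2 hz0) (by linarith : 0 ≤ ε)]
  have hey : ε ^ 2 * y ^ 2 ≤ 0.2426 ^ 2 * 0.0343 := by gcongr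
  have hey' : ε ^ 2 * z ^ 2 * y ^ 2 ≤ 0.2426 ^ 2 * 1.2321 * 0.0343 := by gcongr
  have hεK : ε * K ≤ ε * (1.13 * z) := by gcongr
  have hεK' : ε * (0.926 * z) ≤ ε * K := by gcongr
  have hεz : ε * z ≤ 0.2426 * 1.11 := by gcongr
  have hL0 : 0.67 ≤ l - ε * K := by linarith only [hl0, hεK, hεz]
  have hzL : z * (l - ε * K) ≤ 1.11 * (1.0165 - 1.0277 * ε) := by
    have a1 : z * (l - ε * K) ≤ z * (1.0165 - ε * (0.926 * z)) := by
      gcongr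
      linarith only [hl1]
    nlinarith only [a1, h0, mul_nonneg (sub_nonneg.2 hz1)
      (by nlinarith only [hεz, h1] : 0 ≤ 1.0165 - 0.926 * (ε * z) - 1.02786 * ε)]
  refine ⟨hSm, ?_, ?_, ?_⟩
  · have : S ^ 2 / z ^ 2 ≤ (1.0052 - 0.8464 * ε) ^ 2 / 0.8464 := by
      rw [div_le_div_iff₀ (by positivity) (by norm_num)]
      nlinarith only [hSz, hSp, mul_self_le_mul_self (by positivity) hSz]
    linarith only [this, hey]
  · have hLS : 1.2 * S + 0.03 ≤ 1.3564 * (l - ε * K) := by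
      nlinarith only [hεK, hl0, hS', h0, h1, hz0, hz1, mul_nonneg (sub_nonneg.2 hz0)
        (by linarith : 0 ≤ ε)]
    have hq := mul_self_le_mul_self (by linarith) hLS
    have hX : c * (S ^ 2 + ε ^ 2 * z ^ 2 * y ^ 2) ≤ 1.406 * (S ^ 2 + ε ^ 2 * z ^ 2 * y ^ 2) := by
      gcongr
    have hL2 : 0.92 * (l - ε * K) ^ 2 ≤ z * (l - ε * K) ^ 2 := by gcongr
    nlinarith only [hq, hX, hL2, hey', hSp]
  · have := mul_self_le_mul_self (by positivity) hzL
    linarith only [this, hW]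

/-- Speed and normal curvature along an orbit in the large box. -/
theorem large_box_curvature {μ v C σ z y : ℝ} (hμ : 0 ≤ μ) (hμ' : μ ≤ 1 / 2) (hv : 0 < v)
    (h0 : 0.13 ≤ v ^ 3) (h1 : v ^ 3 ≤ 0.2426) (ht : (1 - μ) * 1.11 * v ^ 2 ≤ 2 / 5)
    (hn : μ * (1 - μ) * v ^ 4 ≤ 0.0215) (hk3 : μ * (1 - μ) * (1 - 2 * μ) * v ^ 6 ≤ 0.0046)
    (hk4 : μ * (1 - μ) * (1 - 3 * (μ * (1 - μ))) * v ^ 8 ≤ 0.0017) (hCσ : C ^ 2 + σ ^ 2 = 1)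
    (hz : z ∈ Icc (1 - 0.08 : ℝ) (1 + 0.11)) (hy : y ∈ Icc (-0.185 : ℝ) 0.185) {x : V4}
    (hx : x = polarPoint v C σ z y (polL (v ^ 3) z y (potU μ (v ^ 2) C z))) :
    0 < speedSq x ∧ speedSq x ≤ ((1.0052 - 0.8464 * v ^ 3) ^ 2 / 0.8464 + 0.0021) / v ^ 4 ∧
    0 < normalCurv μ x ∧ normalCurv μ x ≤ v ^ 4 * (2 * (v ^ 3) ^ 2 *
      ((1.11 * (1.0165 - 1.0277 * v ^ 3)) ^ 2 + 0.0732) * 1.5181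
        / (0.9948 - 1.2321 * v ^ 3) ^ 4) := by
  have hC : C ∈ Icc (-1 : ℝ) 1 :=
    ⟨by nlinarith only [hCσ, sq_nonneg σ], by nlinarith only [hCσ, sq_nonneg σ]⟩
  obtain ⟨⟨hS0, hS1⟩, hl, -, -⟩ := large_box_bounds hμ hμ' h0 h1 ht hn hk3 hk4 hC hz hy
  have hm : 0 ≤ μ * (1 - μ) := mul_nonneg hμ (by linarith)
  have hm' : 0 ≤ 1 - 3 * (μ * (1 - μ)) := by nlinarith only [sq_nonneg (1 - 2 * μ)]
  obtain ⟨hz0, hz1⟩ := hz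
  obtain ⟨hy0, hy1⟩ := hy
  norm_num at hz0 hz1
  have hzp : 0 < z := by linarith
  have ht' : (1 - μ) * z * v ^ 2 ≤ 2 / 5 := le_trans (by gcongr <;> linarith) ht
  have en : μ * (1 - μ) * v ^ 4 = μ * (1 - μ) * (v ^ 2) ^ 2 := by ring
  have e3 : μ * (1 - μ) * (1 - 2 * μ) * v ^ 6 = μ * (1 - μ) * v ^ 4 * (1 - 2 * μ) * v ^ 2 := by ring
  have e4 : μ * (1 - μ) * (1 - 3 * (μ * (1 - μ))) * v ^ 8
    = μ * (1 - μ) * v ^ 4 * (1 - 3 * (μ * (1 - μ))) * (v ^ 2) ^ 2 := by ring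
  obtain ⟨hκ, hκ'⟩ := potK_bounds hμ hμ' (sq_nonneg v) hzp ht' hC.1 hC.2 en e3 e4
  have k3p : 0 ≤ μ * (1 - μ) * (1 - 2 * μ) * v ^ 6 :=
    mul_nonneg (mul_nonneg hm (by linarith)) (by positivity)
  have k4p : 0 ≤ μ * (1 - μ) * (1 - 3 * (μ * (1 - μ))) * v ^ 8 := by positivity
  have np : 0 ≤ μ * (1 - μ) * v ^ 4 := by positivity
  have hT := abs_potT_le hμ hμ' (sq_nonneg v) hzp ht' hCσ
  have hTn : z ^ 2 * (μ * (1 - μ)) * v ^ 2 * (v ^ 3 * z) = z ^ 3 * (μ * (1 - μ) * v ^ 4) * v := by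
    ring
  obtain ⟨htr0, htr⟩ := tide_trace_polarPoint (y := y)
    (l := polL (v ^ 3) z y (potU μ (v ^ 2) C z)) hμ hμ' hv hzp ht' hCσ
  have hVe := speedSq_polarPoint (y := y) (l := polL (v ^ 3) z y (potU μ (v ^ 2) C z)) hv hzp hCσ
  have hFe := forceSq_polarPoint (y := y) (l := polL (v ^ 3) z y (potU μ (v ^ 2) C z)) μ hv hzp hCσ
  have hSl : 1 - v ^ 3 * z ^ 2 * polL (v ^ 3) z y (potU μ (v ^ 2) C z)
      = polS (v ^ 3) z y (potU μ (v ^ 2) C z) := by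
    rw [polL]
    field_simp
    ring
  rw [hSl] at hVe
  rw [← hx] at htr0 htr hVe hFe
  rw [normalCurv]
  generalize polL (v ^ 3) z y (potU μ (v ^ 2) C z) = l at *
  generalize polS (v ^ 3) z y (potU μ (v ^ 2) C z) = S at *
  generalize potK μ (v ^ 2) C z = K at *
  generalize potT μ (v ^ 2) C σ z = T at *
  generalize μ * (1 - μ) * (1 - 2 * μ) * v ^ 6 = k₃ at *
  generalize μ * (1 - μ) * (1 - 3 * (μ * (1 - μ))) * v ^ 8 = k₄ at *
  generalize μ * (1 - μ) * v ^ 4 = n at *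
  generalize tide00 μ x + tide11 μ x = τ at *
  generalize speedSq x = V at *
  generalize forceSq μ x = F at *
  have hz2 : z ^ 2 ≤ 1.2321 := by nlinarith only [hz1, hzp]
  have hz3 : z ^ 3 ≤ 1.3677 := by nlinarith only [hz1, hz2, hzp]
  have hz4 : z ^ 4 ≤ 1.5181 := by nlinarith only [hz2, sq_nonneg z]
  have hv1 : v ≤ 0.624 := by
    by_contra! h
    have : (0.624 : ℝ) ^ 3 < v ^ 3 := by gcongr
    norm_num at this
    linarith only [this, h1]
  have hC2 : C ^ 2 ≤ 1 := by nlinarith only [hCσ, sq_nonneg σ]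
  obtain ⟨hP0, hP1⟩ := abs_le.1 (abs_legendre_three_le hC.1 hC.2)
  have c2 : n * z ^ 2 ≤ 0.0215 * 1.2321 := by gcongr
  have c3 : k₃ * z ^ 3 ≤ 0.0046 * 1.3677 := by gcongr
  have c4 : k₄ * z ^ 4 ≤ 0.0017 * 1.5181 := by gcongr
  have d2 : 0 ≤ n * z ^ 2 := by positivity
  have d3 : 0 ≤ k₃ * z ^ 3 := by positivity
  have hK : 0.926 ≤ K / z := by
    nlinarith only [hκ, c2, c3, c4, mul_nonneg d3 (neg_le_iff_add_nonneg.1 hP0),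
      mul_nonneg d2 (sq_nonneg C)]
  have hK' : K / z ≤ 1.13 := by
    nlinarith only [hκ', c2, c3, c4, mul_nonneg d3 (sub_nonneg.2 hP1),
      mul_nonneg d2 (sub_nonneg.2 hC2)]
  rw [le_div_iff₀ hzp] at hK
  rw [div_le_iff₀ hzp] at hK'
  have hW : (y + v ^ 3 * z * T) ^ 2 ≤ 0.0732 := by
    have a1 : |v ^ 3 * z * T| ≤ 0.0854 := by
      have : z ^ 3 * n * v ≤ 1.3677 * 0.0215 * 0.624 := by gcongr
      rw [abs_mul, abs_of_nonneg (by positivity : 0 ≤ v ^ 3 * z)]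
      nlinarith only [mul_le_mul_of_nonneg_left hT (by positivity : 0 ≤ v ^ 3 * z), hTn, this]
    obtain ⟨a2, a3⟩ := abs_le.1 a1
    have a4 : -0.2704 ≤ y + v ^ 3 * z * T := by linarith only [a2, hy0]
    have a5 : y + v ^ 3 * z * T ≤ 0.2704 := by linarith only [a3, hy1]
    nlinarith only [mul_nonneg (sub_nonneg.2 a4) (sub_nonneg.2 a5)]
  have hc : 1 + 15.3 * n * z ^ 2 ≤ 1.406 := by linarith only [c2]
  obtain ⟨r1, r2, r3, r4⟩ := large_box_numerics (y := y) h0 h1 (by linarith)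
      (by linarith) hS0 hS1 hl
    hK hK' hW (by nlinarith only [hy0, hy1]) hc
  have hs : 0.69 ≤ 0.9948 - 1.2321 * v ^ 3 := by linarith only [h1]
  have hS : 0 < S := by linarith only [r1, hs]
  have hvy : (v ^ 3) ^ 2 * y ^ 2 = v ^ 6 * y ^ 2 := by ring
  rw [hvy] at r2
  have hV : 0 < V := by
    rw [hVe]
    positivity
  refine ⟨hV, ?_, ?_, ?_⟩
  · rw [hVe]
    gcongr
  · refine div_pos (sub_pos.2 ?_) hV
    rw [lt_div_iff₀ hV]
    refine (mul_le_mul_of_nonneg_right htr hV.le).trans_lt ?_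
    rw [hVe, hFe]
    have b1 := mul_lt_mul_of_pos_left r3 (by positivity : 0 < v ^ 2 * z)
    have b2 : 0 ≤ 2 * (v ^ 2 * (y + v ^ 3 * z * T) ^ 2) := by positivity
    calc _ = v ^ 2 * z * ((1 + 15.3 * n * z ^ 2) * (S ^ 2 + (v ^ 3) ^ 2 * z ^ 2 * y ^ 2)) := by
          field_simp
          try ring
      _ < v ^ 2 * z * (2 * z * (l - v ^ 3 * K) ^ 2) := b1
      _ ≤ _ := by linarith only [b2]
  · have b1 : (2 * F / V - τ) / V ≤ 2 * F / V ^ 2 := by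
      rw [sq, ← div_div]
      gcongr
      linarith only [htr0]
    have b2 : S ^ 2 / (z ^ 2 * v ^ 4) ≤ V := by
      rw [hVe, ← div_div]
      gcongr
      linarith only [(by positivity : 0 ≤ v ^ 6 * y ^ 2)]
    have b3 : 0 < S ^ 2 / (z ^ 2 * v ^ 4) := by positivity
    have b4 : 0 ≤ F := by rw [hFe]; positivity
    calc (2 * F / V - τ) / V ≤ 2 * F / V ^ 2 := b1
      _ ≤ 2 * F / (S ^ 2 / (z ^ 2 * v ^ 4)) ^ 2 := by gcongr
      _ = v ^ 4 * (2 * (v ^ 3) ^ 2 * (z ^ 2 * (l - v ^ 3 * K) ^ 2 + (y + v ^ 3 * z * T) ^ 2)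
          * z ^ 4 / S ^ 4) := by
        rw [hFe]
        field_simp
      _ ≤ _ := by gcongr

theorem large_box_index {ε : ℝ} (h0 : 0.13 ≤ ε) (h1 : ε ≤ 0.2426) :
    2 * ε ^ 2 * ((1.11 * (1.0165 - 1.0277 * ε)) ^ 2 + 0.0732) * 1.5181
      / (0.9948 - 1.2321 * ε) ^ 4 * ((1.0052 - 0.8464 * ε) ^ 2 / 0.8464 + 0.0021)
      < (0.9948 - 1.2321 * ε) ^ 2 := by
  have hs : 0.69589 ≤ 0.9948 - 1.2321 * ε := by linarith
  have hs6 : 0.1134 ≤ (0.9948 - 1.2321 * ε) ^ 6 := le_trans (by norm_num)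
      (pow_le_pow_left₀ (by norm_num) hs 6)
  have p1 : 0 ≤ ε * (1.0052 - 0.8464 * ε) := mul_nonneg (by linarith) (by linarith)
  have p2 : 0 ≤ ε * (1.11 * (1.0165 - 1.0277 * ε)) := mul_nonneg (by linarith) (by linarith)
  have a1 : ε * (1.0052 - 0.8464 * ε) ≤ 0.19406 := by nlinarith
  have a2 : ε * (1.11 * (1.0165 - 1.0277 * ε)) ≤ 0.2067 := by nlinarith
  have a3 : ε * (1.0052 - 0.8464 * ε) * (1.11 * (1.0165 - 1.0277 * ε)) ≤ 0.1655 := by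
    nlinarith
  have q1 := mul_self_le_mul_self p1 a1
  have q2 := mul_self_le_mul_self p2 a2
  have q3 := mul_self_le_mul_self (mul_nonneg p1 (by linarith)) a3
  have hε2 : ε ^ 2 ≤ 0.2426 ^ 2 := by gcongr
  rw [div_mul_eq_mul_div, div_lt_iff₀ (by positivity)]
  have e : (0.9948 - 1.2321 * ε) ^ 2 * (0.9948 - 1.2321 * ε) ^ 4 = (0.9948 - 1.2321 * ε) ^ 6 :=
      by ring
  rw [e]
  generalize (0.9948 - 1.2321 * ε) ^ 6 = s₆ at *
  generalize 1.0052 - 0.8464 * ε = a at *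
  generalize 1.11 * (1.0165 - 1.0277 * ε) = b at *
  have e' : 2 * ε ^ 2 * (b ^ 2 + 0.0732) * 1.5181 * (a ^ 2 / 0.8464 + 0.0021)
      = 3.0362 * (ε * a * b * (ε * a * b) / 0.8464 + 0.0021 * (ε * b * (ε * b))
        + 0.0732 / 0.8464 * (ε * a * (ε * a)) + 0.0732 * 0.0021 * ε ^ 2) := by ring
  rw [e']
  norm_num at q1 q2 q3 hε2 hs6 ⊢
  linarith only [q1, q2, q3, hε2, hs6]

/-- Existence of a non-degenerate symmetric orbit, given bounds for the scaled radial force. -/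
theorem exists_nondegenerate_orbit {μ v A B Y j₀ j₁ : ℝ} (hμ : 0 ≤ μ) (hμ' : μ ≤ 1 / 2) (hv : 0 < v)
    (h0 : 0.13 ≤ v ^ 3) (h1 : v ^ 3 ≤ 0.2426) (ht : (1 - μ) * 1.11 * v ^ 2 ≤ 2 / 5)
    (hn : μ * (1 - μ) * v ^ 4 ≤ 0.0215) (hk3 : μ * (1 - μ) * (1 - 2 * μ) * v ^ 6 ≤ 0.0046)
    (hk4 : μ * (1 - μ) * (1 - 3 * (μ * (1 - μ))) * v ^ 8 ≤ 0.0017)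
    (hA : 0 ≤ A) (hA' : A ≤ 0.08) (hB : 0 ≤ B) (hB' : B ≤ 0.11) (hY : 0 ≤ Y) (hY' : Y ≤ 0.185)
    (hbox : ∀ C ∈ Icc (-1 : ℝ) 1, ∀ z ∈ Icc (1 - A) (1 + B), ∀ y ∈ Icc (-Y) Y,
      -j₀ ≤ polJ (v ^ 3) (μ * (1 - μ) * v ^ 4) C z y (potU μ (v ^ 2) C z) (potK μ (v ^ 2) C z) ∧
      polJ (v ^ 3) (μ * (1 - μ) * v ^ 4) C z y (potU μ (v ^ 2) C z) (potK μ (v ^ 2) C z) ≤ j₁)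
    (hj0 : 0 ≤ j₀) (hj1 : 0 ≤ j₁)
    (hW1 : j₁ + 2.13 * (μ * (1 - μ) * v ^ 7) ≤ A) (hW0 : j₀ + 2.13 * (μ * (1 - μ) * v ^ 7) ≤ B)
    (hW2 : j₀ + j₁ + 4.5 * (μ * (1 - μ) * v ^ 7) ≤ Y) :
    ∃ (T : ℝ) (γ : ℝ → V4), 0 < T ∧
      IsOrbit (JacobiH μ) (JacobiDom μ) γ ∧ (∀ t, γ (t + T) = γ t) ∧
      (∀ t, JacobiH μ (γ t) = -(1 / v + v ^ 2 / 2)) ∧ (∀ t, γ t = Rplus (γ (T - t))) ∧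
      {t ∈ Ico 0 T | γ t 1 = 0}.ncard = 2 ∧ TransverseNondeg (JacobiH μ) T γ ∧
      ∀ t, ∃ C σ z y : ℝ, C ^ 2 + σ ^ 2 = 1 ∧ 1 - (j₁ + 2.13 * (μ * (1 - μ) * v ^ 7)) ≤ z ∧
        z ≤ 1 + (j₀ + 2.13 * (μ * (1 - μ) * v ^ 7)) ∧ y ∈ Icc (-Y) Y ∧
        γ t = polarPoint v C σ z y (polL (v ^ 3) z y (potU μ (v ^ 2) C z)) := by
  have hm : 0 ≤ μ * (1 - μ) := mul_nonneg hμ (by linarith)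
  have hs : 0.69 ≤ 0.9948 - 1.2321 * v ^ 3 := by linarith
  have hzA : ∀ z ∈ Icc (1 - A) (1 + B), z ∈ Icc (1 - 0.08 : ℝ) (1 + 0.11) := fun z hz =>
    ⟨by linarith [hz.1], by linarith [hz.2]⟩
  have hyY : ∀ y ∈ Icc (-Y) Y, y ∈ Icc (-0.185 : ℝ) 0.185 := fun y hy =>
    ⟨by linarith [hy.1], by linarith [hy.2]⟩
  obtain ⟨T, γ, hT, hT', hγ, hper, hE, hR, hcard, hloc⟩ := exists_symmetric_orbit
    (S₀ := 0.9948 - 1.2321 * v ^ 3) hμ hμ' hv hA (by linarith) hB (by linarith) hY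
    (le_trans (by gcongr <;> linarith) ht) (by linarith) (fun C hC z hz y hy => by
      obtain ⟨⟨hS, -⟩, -⟩ :=
        large_box_bounds hμ hμ' h0 h1 ht hn hk3 hk4 hC (hzA z hz) (hyY y hy)
      have hz0 : 0 < z := by linarith [hz.1]
      have hz2 : v ^ 3 * z ^ 2 ≤ v ^ 3 * 1.11 ^ 2 := by
        gcongr
        linarith [hz.2]
      exact ⟨by linarith only [hS, hz2], by linarith only [hS, hz2, h1], hbox C hC z hz y hy⟩)
    hj0 hj1 hW1 hW0 hW2
  refine ⟨T, γ, hT, hγ, hper, hE, hR, hcard, ?_, hloc⟩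
  have hcurv : ∀ t, 0 < speedSq (γ t) ∧
      speedSq (γ t) ≤ ((1.0052 - 0.8464 * v ^ 3) ^ 2 / 0.8464 + 0.0021) / v ^ 4 ∧
      0 < normalCurv μ (γ t) ∧ normalCurv μ (γ t) ≤ v ^ 4 * (2 * (v ^ 3) ^ 2 *
      ((1.11 * (1.0165 - 1.0277 * v ^ 3)) ^ 2 + 0.0732) * 1.5181
        / (0.9948 - 1.2321 * v ^ 3) ^ 4) := by
    intro t
    obtain ⟨C, σ, z, y, hCσ, hz0, hz1, hy, hx⟩ := hloc t
    exact large_box_curvature hμ hμ' hv h0 h1 ht hn hk3 hk4 hCσ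
      (hzA z ⟨by linarith, by linarith⟩) (hyY y hy) hx
  refine transverseNondeg_of_bounds hT hγ hper (fun t => (hcurv t).1) (fun t => (hcurv t).2.1)
    (fun t => (hcurv t).2.2.1) (fun t => (hcurv t).2.2.2) ?_
  have key := large_box_index h0 h1
  have hT2 : T ^ 2 ≤ (2 * Real.pi / (0.9948 - 1.2321 * v ^ 3)) ^ 2 := by gcongr
  have hs0 : 0 < 0.9948 - 1.2321 * v ^ 3 := by linarith
  generalize 2 * (v ^ 3) ^ 2 * ((1.11 * (1.0165 - 1.0277 * v ^ 3)) ^ 2 + 0.0732) * 1.5181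
    / (0.9948 - 1.2321 * v ^ 3) ^ 4 = Q at *
  generalize (1.0052 - 0.8464 * v ^ 3) ^ 2 / 0.8464 + 0.0021 = P at *
  have e : v ^ 4 * Q * (P / v ^ 4) = Q * P := by field_simp
  rw [e]
  calc T ^ 2 * (Q * P) < T ^ 2 * (0.9948 - 1.2321 * v ^ 3) ^ 2 := by gcongr
    _ ≤ (2 * Real.pi / (0.9948 - 1.2321 * v ^ 3)) ^ 2 * (0.9948 - 1.2321 * v ^ 3) ^ 2 := by gcongr
    _ = 4 * Real.pi ^ 2 := by
      field_simp
      ring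

theorem inv_dist_le_of_equilibrium {α β X Y d e i j : ℝ} (hα : 0.1 ≤ α) (hβ : 0 < β) (hβ' : β ≤ 0.9)
    (hd : 0 < d) (he : 0 < e) (hi : d * i = 1) (hj : e * j = 1) (hdX : X ^ 2 + Y ^ 2 = d ^ 2)
    (heX : (X - 1) ^ 2 + Y ^ 2 = e ^ 2)
    (h0 : α * ((1 - i ^ 3) * X) + β * ((1 - j ^ 3) * (X - 1)) = 0)
    (h1 : α * ((1 - i ^ 3) * Y) + β * ((1 - j ^ 3) * Y) = 0) (hde : d ≤ e) :
    d ≤ 1 ∧ i ≤ 7 ∧ j ≤ 7 := by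
  have hip : 0 < i := by
    by_contra! h
    nlinarith
  have hjp : 0 < j := by
    by_contra! h
    nlinarith
  have hd1 : d ≤ 1 := by
    by_contra! h
    have he1 : 1 < e := by linarith
    have hi1 : i < 1 := by nlinarith
    have hj1 : j < 1 := by nlinarith
    have hi3 : 0 < 1 - i ^ 3 := sub_pos.2 (pow_lt_one₀ hip.le hi1 (by norm_num))
    have hj3 : 0 < 1 - j ^ 3 := sub_pos.2 (pow_lt_one₀ hjp.le hj1 (by norm_num))
    have e1 : α * ((1 - i ^ 3) * d ^ 2) + β * ((1 - j ^ 3) * (X * (X - 1) + Y ^ 2)) = 0 := by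
      linear_combination X * h0 + Y * h1 - α * (1 - i ^ 3) * hdX
    have e2 : 0 < X * (X - 1) + Y ^ 2 := by nlinarith
    have : 0 < α := by linarith
    have : 0 < α * ((1 - i ^ 3) * d ^ 2) + β * ((1 - j ^ 3) * (X * (X - 1) + Y ^ 2)) :=
        by positivity
    linarith
  have hi1 : 1 ≤ i := by nlinarith
  have he2 : e ≤ 2 := by
    have : X ≥ -1 := by nlinarith [sq_nonneg Y]
    nlinarith
  have he0 : 1 / 2 ≤ e := by
    have hsum : 1 ≤ 2 * (d ^ 2 + e ^ 2) := by nlinarith [sq_nonneg (2 * X - 1), sq_nonneg Y]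
    nlinarith
  have hj2 : j ≤ 2 := by nlinarith
  have hsq : (α * (d - i ^ 2)) ^ 2 = (β * (e - j ^ 2)) ^ 2 := by
    have a1 : α * ((1 - i ^ 3) * X) = -(β * ((1 - j ^ 3) * (X - 1))) := by linarith
    have a2 : α * ((1 - i ^ 3) * Y) = -(β * ((1 - j ^ 3) * Y)) := by linarith
    have b1 : d - i ^ 2 = (1 - i ^ 3) * d := by linear_combination i ^ 2 * hi
    have b2 : e - j ^ 2 = (1 - j ^ 3) * e := by linear_combination j ^ 2 * hj
    have c1 : (α * ((1 - i ^ 3) * d)) ^ 2 = (α * ((1 - i ^ 3) * X)) ^ 2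
        + (α * ((1 - i ^ 3) * Y)) ^ 2 := by
      linear_combination -(α * (1 - i ^ 3)) ^ 2 * hdX
    have c2 : (β * ((1 - j ^ 3) * e)) ^ 2
        = (β * ((1 - j ^ 3) * (X - 1))) ^ 2 + (β * ((1 - j ^ 3) * Y)) ^ 2 := by
      linear_combination -(β * (1 - j ^ 3)) ^ 2 * heX
    rw [b1, b2, c1, c2, a1, a2]
    ring
  have hb : |α * (d - i ^ 2)| = |β * (e - j ^ 2)| := (sq_eq_sq_iff_abs_eq_abs _ _).1 hsq
  have hb2 : |e - j ^ 2| ≤ 4 := abs_le.2 ⟨by nlinarith, by nlinarith⟩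
  have hb3 : |β * (e - j ^ 2)| ≤ 0.9 * 4 := by
    rw [abs_mul, abs_of_pos hβ]
    gcongr
  rw [← hb] at hb3
  have hb4 := (abs_le.1 hb3).1
  refine ⟨hd1, ?_, by linarith⟩
  by_contra! h
  have h48 : 48 ≤ i ^ 2 - d := by nlinarith
  nlinarith only [hb4, mul_le_mul hα h48 (by norm_num) (by linarith)]

theorem bddBelow_critVals {μ : ℝ} (hμ : μ ∈ Icc (0.1 : ℝ) 0.5) : BddBelow (JacobiCritVals μ) := by
  obtain ⟨hμ0, hμ1⟩ := hμ
  refine ⟨-50, ?_⟩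
  rintro _ ⟨x, hx, hcr, rfl⟩
  rw [(hasFDerivAt_jacobiH hx).fderiv] at hcr
  have hc := fun i : Fin 4 => congrArg (fun f : V4 →L[ℝ] ℝ => f (Pi.single i 1)) hcr
  have c0 := hc 0
  have c1 := hc 1
  have c2 := hc 2
  have c3 := hc 3
  simp at c0 c1 c2 c3
  obtain ⟨hd, he⟩ := dom_iff.1 hx
  have hds := Real.sqrt_pos.2 hd
  have hes := Real.sqrt_pos.2 he
  have hi : Real.sqrt ((x 0 - (-μ)) ^ 2 + (x 1) ^ 2) * invDist (-μ) x = 1 := mul_inv_cancel₀ hds.ne'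
  have hj : Real.sqrt ((x 0 - (1 - μ)) ^ 2 + (x 1) ^ 2) * invDist (1 - μ) x = 1 :=
    mul_inv_cancel₀ hes.ne'
  have hdq := Real.sq_sqrt hd.le
  have heq := Real.sq_sqrt he.le
  rw [attr0] at c0
  rw [attr1] at c1
  rw [jacobiH_eq]
  dsimp only
  generalize Real.sqrt ((x 0 - (-μ)) ^ 2 + (x 1) ^ 2) = d at *
  generalize Real.sqrt ((x 0 - (1 - μ)) ^ 2 + (x 1) ^ 2) = e at *
  generalize invDist (-μ) x = i at *
  generalize invDist (1 - μ) x = j at *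
  have hp2 : x 2 = x 1 := by linarith
  have hp3 : x 3 = -x 0 := by linarith
  rw [hp2] at c1 ⊢
  rw [hp3] at c0 ⊢
  have key : x 0 ^ 2 ≤ 9 ∧ x 1 ^ 2 ≤ 9 ∧ i ≤ 7 ∧ j ≤ 7 := by
    rcases le_total d e with hde | hde
    · obtain ⟨h1, h2, h3⟩ := inv_dist_le_of_equilibrium (α := 1 - μ) (β := μ) (X := x 0 + μ)
        (Y := x 1) (by linarith) (by linarith) (by linarith) hds hes hi hj (by linarith)
        (by linarith) (by linarith) (by linarith) hde
      have hq : d ^ 2 ≤ 1 := pow_le_one₀ (by positivity) h1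
      obtain ⟨q0, q1⟩ := abs_le.1 ((sq_le_one_iff_abs_le_one (x 0 - (-μ))).1
        (by linarith only [hq, hdq, sq_nonneg (x 1)]))
      refine ⟨by nlinarith only [q0, q1, hμ0, hμ1],
        by linarith only [hq, hdq, sq_nonneg (x 0 - (-μ))], h2, h3⟩
    · obtain ⟨h1, h2, h3⟩ := inv_dist_le_of_equilibrium (α := μ) (β := 1 - μ) (X := 1 - μ - x 0)
        (Y := x 1) (by linarith) (by linarith) (by linarith) hes hds hj hi (by linarith)
        (by linarith) (by linarith) (by linarith) hde
      have hq : e ^ 2 ≤ 1 := pow_le_one₀ (by positivity) h1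
      obtain ⟨q0, q1⟩ := abs_le.1 ((sq_le_one_iff_abs_le_one (x 0 - (1 - μ))).1
        (by linarith only [hq, heq, sq_nonneg (x 1)]))
      refine ⟨by nlinarith only [q0, q1, hμ0, hμ1],
        by linarith only [hq, heq, sq_nonneg (x 0 - (1 - μ))], h3, h2⟩
  obtain ⟨k0, k1, k2, k3⟩ := key
  have : (1 - μ) * i ≤ (1 - μ) * 7 := by gcongr; linarith
  have : μ * j ≤ μ * 7 := by gcongr
  nlinarith

/-- The collinear critical point between the two primaries, at distance `a` from the first one. -/
theorem collinear_mem_critVals {μ a : ℝ} (ha : 0 < a) (ha' : a < 1)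
    (h : (1 - μ) * (a - 1 / a ^ 2) - μ * ((1 - a) - 1 / (1 - a) ^ 2) = 0) :
    -((1 - μ) * (a ^ 2 / 2 + 1 / a) + μ * ((1 - a) ^ 2 / 2 + 1 / (1 - a)) - μ * (1 - μ) / 2)
      ∈ JacobiCritVals μ := by
  have hb : 0 < 1 - a := by linarith
  set x : V4 := ![a - μ, 0, 0, -(a - μ)] with hx
  have x0 : x 0 = a - μ := rfl
  have x1 : x 1 = 0 := rfl
  have x2 : x 2 = 0 := rfl
  have x3 : x 3 = -(a - μ) := rfl
  have hdom : x ∈ JacobiDom μ := by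
    rw [dom_iff, x0, x1]
    constructor
    · have : 0 < a ^ 2 := by positivity
      nlinarith
    · have : 0 < (1 - a) ^ 2 := by positivity
      nlinarith
  have hi : invDist (-μ) x = 1 / a := by
    rw [invDist, x0, x1, show (a - μ - -μ) ^ 2 + 0 ^ 2 = a ^ 2 by ring, Real.sqrt_sq ha.le, one_div]
  have hj : invDist (1 - μ) x = 1 / (1 - a) := by
    rw [invDist, x0, x1, show (a - μ - (1 - μ)) ^ 2 + 0 ^ 2 = (1 - a) ^ 2 by ring,
      Real.sqrt_sq hb.le, one_div]
  refine ⟨x, hdom, ?_, ?_⟩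
  · rw [(hasFDerivAt_jacobiH hdom).fderiv, attr0, attr1, hi, hj, x0, x1, x2, x3]
    have e : -(a - μ) + ((1 - μ) * ((a - μ + μ) * (1 / a) ^ 3)
        + μ * ((a - μ - (1 - μ)) * (1 / (1 - a)) ^ 3)) = 0 := by
      have e1 : (a - μ + μ) * (1 / a) ^ 3 = 1 / a ^ 2 := by
        field_simp
        ring
      have e2 : (a - μ - (1 - μ)) * (1 / (1 - a)) ^ 3 = -(1 / (1 - a) ^ 2) := by
        field_simp
        ring
      rw [e1, e2]
      linear_combination -h
    rw [e]
    simp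
  · rw [jacobiH_eq]
    dsimp only
    rw [hi, hj, x0, x1, x2, x3]
    ring

theorem le_firstCritEnergy {μ a : ℝ} (hμ : μ ∈ Icc (0.1 : ℝ) 0.5) (ha : 0 < a) (ha' : a < 1) :
    (1 - μ) * (a ^ 2 / 2 + 1 / a) + μ * ((1 - a) ^ 2 / 2 + 1 / (1 - a)) - μ * (1 - μ) / 2
      - ((1 - μ) * (a - 1 / a ^ 2) - μ * ((1 - a) - 1 / (1 - a) ^ 2)) ^ 2 / 6
      ≤ firstCritEnergy μ := by
  obtain ⟨hμ0, hμ1⟩ := id hμ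
  have hcont : ContinuousOn (fun b : ℝ => (1 - μ) * (b - 1 / b ^ 2) - μ
      * ((1 - b) - 1 / (1 - b) ^ 2))
      (Icc 0.5 0.9) := by
    have h1 : ∀ b ∈ Icc (0.5 : ℝ) 0.9, b ^ 2 ≠ 0 := fun b hb =>
      pow_ne_zero 2 (by linarith [hb.1] : 0 < b).ne'
    have h2 : ∀ b ∈ Icc (0.5 : ℝ) 0.9, (1 - b) ^ 2 ≠ 0 := fun b hb =>
      pow_ne_zero 2 (by linarith [hb.2] : 0 < 1 - b).ne'
    fun_prop (disch := assumption)
  obtain ⟨b, hb, hb0⟩ := intermediate_value_Icc (by norm_num : (0.5 : ℝ) ≤ 0.9) hcont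
    (show (0 : ℝ) ∈ _ from ⟨by norm_num; linarith, by norm_num; linarith⟩)
  have hbp : 0 < b := by linarith [hb.1]
  have hbp' : b < 1 := by linarith [hb.2]
  have hmem := collinear_mem_critVals hbp hbp' hb0
  have hle := neg_le_neg (csInf_le (bddBelow_critVals hμ) hmem)
  rw [neg_neg] at hle
  refine le_trans ?_ hle
  have conv : ∀ {x y : ℝ}, 0 < x → x < 1 → 0 < y → y < 1 →
      x ^ 2 / 2 + 1 / x + (x - 1 / x ^ 2) * (y - x) + 3 / 2 * (y - x) ^ 2 ≤ y ^ 2 / 2 + 1 / y := by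
    intro x y hx hx' hy hy'
    have e : y ^ 2 / 2 + 1 / y = x ^ 2 / 2 + 1 / x + (x - 1 / x ^ 2) * (y - x)
        + (1 / 2 + 1 / (y * x ^ 2)) * (y - x) ^ 2 := by
      field_simp
      ring
    have : 1 ≤ 1 / (y * x ^ 2) := by
      rw [one_le_div (by positivity)]
      have : x ^ 2 ≤ 1 := by nlinarith
      nlinarith
    rw [e]
    nlinarith [sq_nonneg (y - x)]
  have h1 := conv ha ha' hbp hbp'
  have h2 := conv (sub_pos.2 ha') (by linarith) (sub_pos.2 hbp') (by linarith)
  have h3 := mul_le_mul_of_nonneg_left h1 (by linarith : 0 ≤ 1 - μ)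
  have h4 := mul_le_mul_of_nonneg_left h2 (by linarith : 0 ≤ μ)
  generalize 1 / a = u₁ at *
  generalize 1 / a ^ 2 = u₂ at *
  generalize 1 / (1 - a) = u₃ at *
  generalize 1 / (1 - a) ^ 2 = u₄ at *
  generalize 1 / b = u₅ at *
  generalize 1 / (1 - b) = u₆ at *
  have h5 := sq_nonneg ((1 - μ) * (a - u₂) - μ * ((1 - a) - u₄) + 3 * (b - a))
  linear_combination h3 + h4 + h5 / 6

/-- Existence of a non-degenerate symmetric direct orbit of energy `-c` crossing the axis twice. -/
def HasDirectOrbit (μ c : ℝ) : Prop :=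
  ∃ (T : ℝ) (γ : ℝ → V4), 0 < T ∧ IsOrbit (JacobiH μ) (JacobiDom μ) γ ∧
    (∀ t, γ (t + T) = γ t) ∧ (∀ t, JacobiH μ (γ t) = -c) ∧ (∀ t, γ t = Rplus (γ (T - t))) ∧
    (∀ t : ℝ, (γ t 0 + μ) * γ t 3 - γ t 1 * γ t 2 < μ * (γ t 0 + μ)) ∧
    {t ∈ Ico (0 : ℝ) T | γ t 1 = 0}.ncard = 2 ∧ TransverseNondeg (JacobiH μ) T γ

theorem polarPoint_direct {μ v C σ z y l R δ : ℝ} (hμ : 0 ≤ μ) (hv : 0 < v) (hz : 0 < z)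
    (hCσ : C ^ 2 + σ ^ 2 = 1) (hR : 0 < R) (hRr : (R + μ) * (v ^ 2 * z) ≤ 1) (hδ : 0 ≤ δ)
    (hu : μ + δ ≤ v * l * z) (hp : μ * (v * y) ^ 2 < 2 * R ^ 2 * δ) :
    (polarPoint v C σ z y l 0 + μ) * polarPoint v C σ z y l 3
        - polarPoint v C σ z y l 1 * polarPoint v C σ z y l 2
      < μ * (polarPoint v C σ z y l 0 + μ) := by
  have hr : R + μ ≤ 1 / (v ^ 2 * z) := (le_div_iff₀ (by positivity)).2 hRr
  have e0 : polarPoint v C σ z y l 0 = 1 / (v ^ 2 * z) * C := by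
    simp [polarPoint, div_eq_mul_inv, mul_comm]
  have e1 : polarPoint v C σ z y l 1 = 1 / (v ^ 2 * z) * σ := by
    simp [polarPoint, div_eq_mul_inv, mul_comm]
  have e2 : polarPoint v C σ z y l 2 = v * (y * C + l * z * σ) := rfl
  have e3 : polarPoint v C σ z y l 3 = v * (y * σ - l * z * C) := rfl
  rw [e0, e1, e2, e3]
  generalize 1 / (v ^ 2 * z) = r at *
  obtain ⟨hC0, hC1⟩ : -1 ≤ C ∧ C ≤ 1 :=
    ⟨by nlinarith only [hCσ, sq_nonneg σ], by nlinarith only [hCσ, sq_nonneg σ]⟩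
  have h1 : R ≤ r + μ * C := by nlinarith only [hr, hμ, hC0]
  have h2 : σ ^ 2 / 2 ≤ 1 + C := by nlinarith only [hCσ, hC0, hC1]
  have h3 : δ + μ * (σ ^ 2 / 2) ≤ v * l * z + μ * C := by nlinarith only [hu, hμ, h2]
  have h4 := mul_le_mul h1 h3 (by positivity) (hR.le.trans h1)
  have h5 : 0 < R * (δ + μ * (σ ^ 2 / 2)) + μ ^ 2 * σ ^ 2 - μ * (v * y) * σ := by
    refine (mul_pos_iff_of_pos_left (by positivity : 0 < 2 * R)).1 ?_
    have := mul_nonneg hμ (sq_nonneg (R * σ - v * y))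
    have : 0 ≤ 2 * R * (μ ^ 2 * σ ^ 2) := by positivity
    linarith
  have e : μ * (r * C + μ) - ((r * C + μ) * (v * (y * σ - l * z * C))
      - r * σ * (v * (y * C + l * z * σ)))
      = (r + μ * C) * (v * l * z + μ * C) + μ ^ 2 * σ ^ 2 - μ * (v * y) * σ := by
    linear_combination (r * v * l * z - μ ^ 2) * hCσ
  linarith

theorem exists_energy_parameter {c v₀ : ℝ} (hv₀ : 0.51 ≤ v₀) (h : 1 / v₀ + v₀ ^ 2 / 2 ≤ c)
    (hc : c ≤ 2.1) : ∃ v, 0.50725 ≤ v ∧ v ≤ v₀ ∧ 1 / v + v ^ 2 / 2 = c := by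
  have hcont : ContinuousOn (fun v : ℝ => 1 / v + v ^ 2 / 2) (Icc 0.50725 v₀) := by
    have h1 : ∀ v ∈ Icc (0.50725 : ℝ) v₀, v ≠ 0 := fun v hv =>
      (by linarith [hv.1] : 0 < v).ne'
    fun_prop (disch := assumption)
  obtain ⟨v, hv, hvc⟩ := intermediate_value_Icc' (by linarith : (0.50725 : ℝ) ≤ v₀) hcont
    (show c ∈ _ from ⟨h, by norm_num at hc ⊢; linarith⟩)
  exact ⟨v, hv.1, hv.2, hvc⟩

theorem lower_bound_of_endpoints {μ a b p q r t E : ℝ} (ha : a ≤ μ) (hb : μ ≤ b) (hrt : r + t ≤ -2)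
    (hEa : E ≤ (1 - a) * p + a * q - a * (1 - a) / 2 - ((1 - a) * r - a * t) ^ 2 / 6)
    (hEb : E ≤ (1 - b) * p + b * q - b * (1 - b) / 2 - ((1 - b) * r - b * t) ^ 2 / 6) :
    E ≤ (1 - μ) * p + μ * q - μ * (1 - μ) / 2 - ((1 - μ) * r - μ * t) ^ 2 / 6 := by
  rcases ha.eq_or_lt with rfl | ha'
  · exact hEa
  have hab : 0 < b - a := by linarith
  have hκ : 0 ≤ (r + t) ^ 2 / 6 - 1 / 2 := by nlinarith
  have h1 := mul_le_mul_of_nonneg_left hEa (sub_nonneg.2 hb)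
  have h2 := mul_le_mul_of_nonneg_left hEb (sub_nonneg.2 ha)
  have h3 := mul_nonneg (mul_nonneg hκ (mul_nonneg (sub_nonneg.2 ha) (sub_nonneg.2 hb))) hab.le
  refine le_of_mul_le_mul_left ?_ hab
  linear_combination h1 + h2 + h3

theorem exists_parameter_of_cell {μ c a b a₀ v₀ : ℝ} (hμ : μ ∈ Icc (0.1 : ℝ) 0.5)
    (hc1 : firstCritEnergy μ ≤ c) (hc2 : c ≤ 2.1) (ha : a ≤ μ) (hb : μ ≤ b) (ha0 : 0 < a₀)
    (ha1 : a₀ < 1) (hv₀ : 0.51 ≤ v₀)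
    (hrt : a₀ - 1 / a₀ ^ 2 + (1 - a₀ - 1 / (1 - a₀) ^ 2) ≤ -2)
    (hEa : 1 / v₀ + v₀ ^ 2 / 2 ≤ (1 - a) * (a₀ ^ 2 / 2 + 1 / a₀)
      + a * ((1 - a₀) ^ 2 / 2 + 1 / (1 - a₀)) - a * (1 - a) / 2
      - ((1 - a) * (a₀ - 1 / a₀ ^ 2) - a * (1 - a₀ - 1 / (1 - a₀) ^ 2)) ^ 2 / 6)
    (hEb : 1 / v₀ + v₀ ^ 2 / 2 ≤ (1 - b) * (a₀ ^ 2 / 2 + 1 / a₀)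
      + b * ((1 - a₀) ^ 2 / 2 + 1 / (1 - a₀)) - b * (1 - b) / 2
      - ((1 - b) * (a₀ - 1 / a₀ ^ 2) - b * (1 - a₀ - 1 / (1 - a₀) ^ 2)) ^ 2 / 6) :
    ∃ v, 0.50725 ≤ v ∧ v ≤ v₀ ∧ 1 / v + v ^ 2 / 2 = c :=
  exists_energy_parameter hv₀ ((lower_bound_of_endpoints ha hb hrt hEa hEb).trans
    ((le_firstCritEnergy hμ ha0 ha1).trans hc1)) hc2

theorem le_of_cube_le {v a b : ℝ} (ha : 0 ≤ a) (h : v ^ 3 ≤ b) (hb : b ≤ a ^ 3) : v ≤ a := by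
  by_contra! hlt
  have : a ^ 3 < v ^ 3 := by gcongr
  linarith

theorem exists_direct_orbit_large {μ v : ℝ} (hμ : 0 ≤ μ) (hμ' : μ ≤ 0.45) (hv : 0.50725 ≤ v)
    (h1 : v ^ 3 ≤ 0.2426) (ht : (1 - μ) * 1.11 * v ^ 2 ≤ 2 / 5)
    (hn : μ * (1 - μ) * v ^ 4 ≤ 0.0215) (hk3 : μ * (1 - μ) * (1 - 2 * μ) * v ^ 6 ≤ 0.0046)
    (hk4 : μ * (1 - μ) * (1 - 3 * (μ * (1 - μ))) * v ^ 8 ≤ 0.0017)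
    (hW1 : 0.0181 + 0.69 * (μ * (1 - μ) * v ^ 4) + 6.66 * (μ * (1 - μ) * (1 - 2 * μ) * v ^ 6)
        + 6.4 * (μ * (1 - μ) * (1 - 3 * (μ * (1 - μ))) * v ^ 8)
        + 2.13 * (μ * (1 - μ) * v ^ 7) ≤ 0.08)
    (hW0 : 3.08 * (μ * (1 - μ) * v ^ 4) + 6.66 * (μ * (1 - μ) * (1 - 2 * μ) * v ^ 6)
        + 16.62 * (μ * (1 - μ) * (1 - 3 * (μ * (1 - μ))) * v ^ 8)
        + 2.13 * (μ * (1 - μ) * v ^ 7) ≤ 0.11)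
    (hW2 : 0.0181 + 3.77 * (μ * (1 - μ) * v ^ 4) + 13.32 * (μ * (1 - μ) * (1 - 2 * μ) * v ^ 6)
        + 23.02 * (μ * (1 - μ) * (1 - 3 * (μ * (1 - μ))) * v ^ 8)
        + 4.5 * (μ * (1 - μ) * v ^ 7) ≤ 0.185) :
    HasDirectOrbit μ (1 / v + v ^ 2 / 2) := by
  have hvp : 0 < v := by linarith
  have h0 : 0.13 ≤ v ^ 3 := le_trans (by norm_num) (pow_le_pow_left₀ (by norm_num) hv 3)
  have hμ2 : μ ≤ 1 / 2 := by linarith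
  have hm : 0 ≤ μ * (1 - μ) := mul_nonneg hμ (by linarith)
  have hm' : 0 ≤ 1 - 3 * (μ * (1 - μ)) := by nlinarith only [sq_nonneg (1 - 2 * μ)]
  have np : 0 ≤ μ * (1 - μ) * v ^ 4 := by positivity
  have n7 : 0 ≤ μ * (1 - μ) * v ^ 7 := by positivity
  have k3p : 0 ≤ μ * (1 - μ) * (1 - 2 * μ) * v ^ 6 :=
    mul_nonneg (mul_nonneg hm (by linarith)) (by positivity)
  have k4p : 0 ≤ μ * (1 - μ) * (1 - 3 * (μ * (1 - μ))) * v ^ 8 := by positivity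
  obtain ⟨T, γ, hT, hγ, hper, hE, hR, hcard, hnd, hloc⟩ := exists_nondegenerate_orbit
    (A := 0.08) (B := 0.11) (Y := 0.185) hμ hμ2 hvp h0 h1 ht hn hk3 hk4 (by norm_num) le_rfl
    (by norm_num) le_rfl (by norm_num) le_rfl
    (fun C hC z hz y hy => (large_box_bounds hμ hμ2 h0 h1 ht hn hk3 hk4 hC hz
      (by norm_num at hy ⊢; exact hy)).2.2)
    (by positivity) (by positivity) hW1 hW0 (by linarith only [hW2])
  refine ⟨T, γ, hT, hγ, hper, hE, hR, fun t => ?_, hcard, hnd⟩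
  obtain ⟨C, σ, z, y, hCσ, hz0, hz1, hy, hx⟩ := hloc t
  have hz0' : 0.92 ≤ z := by linarith only [hz0, hW1]
  have hz1' : z ≤ 1.11 := by linarith only [hz1, hW0]
  have hC : C ∈ Icc (-1 : ℝ) 1 :=
    ⟨by nlinarith only [hCσ, sq_nonneg σ], by nlinarith only [hCσ, sq_nonneg σ]⟩
  have hl := (large_box_bounds hμ hμ2 h0 h1 ht hn hk3 hk4 hC
    (z := z) ⟨by linarith, by linarith⟩ (by norm_num at hy ⊢; exact hy)).2.1
  rw [hx]
  generalize polL (v ^ 3) z y (potU μ (v ^ 2) C z) = l at *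
  have hl0 : 0.9835 ≤ l := by linarith only [(abs_le.1 hl).1]
  have hv1 : v ≤ 0.6238 := le_of_cube_le (by norm_num) h1 (by norm_num)
  have hv2 : v ^ 2 ≤ 0.6238 ^ 2 := by gcongr
  have hy2 : y ^ 2 ≤ 0.185 ^ 2 := sq_le_sq' (by linarith only [hy.1]) hy.2
  refine polarPoint_direct (R := 1.8) (δ := 0.0089) hμ hvp (by linarith) hCσ (by norm_num) ?_
    (by norm_num) ?_ ?_
  · have : v ^ 2 * z ≤ 0.6238 ^ 2 * 1.11 := by gcongr
    nlinarith only [this, hμ', hμ]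
  · have : 0.50725 * 0.9835 * 0.92 ≤ v * l * z := by gcongr
    linarith only [this, hμ']
  · have : (v * y) ^ 2 ≤ 0.6238 ^ 2 * 0.185 ^ 2 := by
      rw [mul_pow]
      gcongr
    nlinarith only [this, hμ', hμ, sq_nonneg (v * y)]

theorem angular_momentum_lower_bound {ε z y U S l n k₃ k₄ a P : ℝ} (hε0 : 0 ≤ ε) (hε : ε ≤ 0.13488)
    (hz0 : 0 < z) (hz1 : z ≤ 1) (hn : 0 ≤ n) (h3 : 0 ≤ k₃) (h4 : 0 ≤ k₄) (ha : a ≤ 1) (hP : P ≤ 1)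
    (hU : U - z ≤ n * z ^ 3 * a + k₃ * z ^ 4 * P + 1.67 * k₄ * z ^ 5)
    (hl : (l - 1) * (S + (1 - ε * z ^ 2)) = ε * ((z - 1) ^ 2 - 2 * (U - z) + y ^ 2))
    (hS : 1 - ε * z ^ 2 - 0.0011 ≤ S) : 1 - 0.1561 * (n + k₃ + 1.67 * k₄) ≤ l := by
  have hz3 : z ^ 3 ≤ 1 := pow_le_one₀ hz0.le hz1
  have hz4 : z ^ 4 ≤ 1 := pow_le_one₀ hz0.le hz1
  have hz5 : z ^ 5 ≤ 1 := pow_le_one₀ hz0.le hz1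
  have hz2 : z ^ 2 ≤ 1 := pow_le_one₀ hz0.le hz1
  have b1 : n * z ^ 3 * a ≤ n * 1 * 1 :=
    (mul_le_mul_of_nonneg_left ha (by positivity)).trans (by gcongr)
  have b2 : k₃ * z ^ 4 * P ≤ k₃ * 1 * 1 :=
    (mul_le_mul_of_nonneg_left hP (by positivity)).trans (by gcongr)
  have b3 : 1.67 * k₄ * z ^ 5 ≤ 1.67 * k₄ * 1 := by gcongr
  have b4 : ε * z ^ 2 ≤ 0.13488 * 1 := by gcongr
  set Q := n + k₃ + 1.67 * k₄ with hQ
  have hQ0 : 0 ≤ Q := by positivity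
  have hX : -(2 * Q) ≤ (z - 1) ^ 2 - 2 * (U - z) + y ^ 2 := by
    linarith only [b1, b2, b3, hU, hQ, sq_nonneg (z - 1), sq_nonneg y]
  have hD : 1.729 ≤ S + (1 - ε * z ^ 2) := by linarith only [hS, b4]
  have h5 : -(0.13488 * (2 * Q)) ≤ (l - 1) * (S + (1 - ε * z ^ 2)) := by
    rw [hl]
    nlinarith only [hX, hQ0, hε0, hε]
  by_contra! h
  nlinarith only [h, h5, hD, hQ0]

theorem small_box_angular_momentum {μ v C z y : ℝ} (hμ : 0.45 ≤ μ) (hμ' : μ ≤ 1 / 2)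
    (hv : 0.50725 ≤ v) (h1 : v ^ 3 ≤ 0.16) (ht : (1 - μ) * 1.08 * v ^ 2 ≤ 2 / 5)
    (hn : μ * (1 - μ) * v ^ 4 ≤ 0.0215) (hk3 : μ * (1 - μ) * (1 - 2 * μ) * v ^ 6 ≤ 0.00065)
    (hk4 : μ * (1 - μ) * (1 - 3 * (μ * (1 - μ))) * v ^ 8 ≤ 0.0005) (hC : C ∈ Icc (-1 : ℝ) 1)
    (hz0 : 1 - (0.0036 + 5.63 * (μ * (1 - μ) * (1 - 2 * μ) * v ^ 6)
      + 5.3 * (μ * (1 - μ) * (1 - 3 * (μ * (1 - μ))) * v ^ 8) + 2.13 * (μ * (1 - μ) * v ^ 7)) ≤ z)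
    (hz1 : z ≤ 1.08) (hy : y ∈ Icc (-0.1 : ℝ) 0.1) :
    μ + 0.00012 ≤ v * polL (v ^ 3) z y (potU μ (v ^ 2) C z) * z := by
  have hvp : 0 < v := by linarith
  have h0 : 0.13 ≤ v ^ 3 := le_trans (by norm_num) (pow_le_pow_left₀ (by norm_num) hv 3)
  have hμ0 : 0 ≤ μ := by linarith
  have hm : 0 ≤ μ * (1 - μ) := mul_nonneg hμ0 (by linarith)
  have hm1 : μ * (1 - μ) ≤ 0.25 := by nlinarith only [sq_nonneg (1 - 2 * μ)]
  have hm2 : 1 - 3 * (μ * (1 - μ)) ≤ 0.2575 := by nlinarith only [hμ, hμ']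
  have hm' : 0 ≤ 1 - 3 * (μ * (1 - μ)) := by linarith only [hm1]
  have hε : 0 < v ^ 3 := by positivity
  have e7 : μ * (1 - μ) * v ^ 7 = μ * (1 - μ) * v ^ 4 * v ^ 3 := by ring
  have n7 : μ * (1 - μ) * v ^ 4 * v ^ 3 ≤ 0.0215 * 0.16 := by gcongr
  have hzl : 0.9827 ≤ z := by linarith only [hz0, e7, n7, hk3, hk4]
  obtain ⟨⟨hS, -⟩, hl, -⟩ := small_box_bounds (z := z) hμ0 hμ' h0 h1 ht hn hk3 hk4 hC
    ⟨by linarith only [hzl], by linarith only [hz1]⟩ hy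
  have hl0 := (abs_le.1 hl).1
  have hl1 : 0.994 ≤ polL (v ^ 3) z y (potU μ (v ^ 2) C z) := by linarith only [hl0]
  have hzp : 0 < z := by linarith only [hzl]
  rcases le_total 0.51283 v with hv2 | hv2
  · have : 0.51283 * 0.994 * 0.9827 ≤ v * polL (v ^ 3) z y (potU μ (v ^ 2) C z) * z := by gcongr
    linarith only [this, hμ']
  rcases le_total 1 z with hz2 | hz2
  · have : 0.50725 * 0.994 * 1 ≤ v * polL (v ^ 3) z y (potU μ (v ^ 2) C z) * z := by gcongr
    linarith only [this, hμ']
  have ht' : (1 - μ) * z * v ^ 2 ≤ 2 / 5 := le_trans (by gcongr; linarith) ht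
  have en : μ * (1 - μ) * v ^ 4 = μ * (1 - μ) * (v ^ 2) ^ 2 := by ring
  have e3 : μ * (1 - μ) * (1 - 2 * μ) * v ^ 6 = μ * (1 - μ) * v ^ 4 * (1 - 2 * μ) * v ^ 2 := by ring
  have e4 : μ * (1 - μ) * (1 - 3 * (μ * (1 - μ))) * v ^ 8
    = μ * (1 - μ) * v ^ 4 * (1 - 3 * (μ * (1 - μ))) * (v ^ 2) ^ 2 := by ring
  have k3p : 0 ≤ μ * (1 - μ) * (1 - 2 * μ) * v ^ 6 :=
    mul_nonneg (mul_nonneg hm (by linarith)) (by positivity)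
  have k4p : 0 ≤ μ * (1 - μ) * (1 - 3 * (μ * (1 - μ))) * v ^ 8 := by positivity
  have np : 0 ≤ μ * (1 - μ) * v ^ 4 := by positivity
  have hUz := (potU_bounds hμ0 hμ' (sq_nonneg v) hzp ht' hC.1 hC.2 en e3 e4).2
  have hSpos : 0 < polS (v ^ 3) z y (potU μ (v ^ 2) C z) := by
    have : v ^ 3 * z ^ 2 ≤ 0.16 * 1 ^ 2 := by gcongr
    linarith only [hS, this]
  have hSq : polS (v ^ 3) z y (potU μ (v ^ 2) C z) ^ 2 = _ :=
      Real.sq_sqrt (Real.sqrt_pos.1 hSpos).le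
  have hLe := polL_sub_one hε hzp hSq
  have hv4 : v ^ 4 ≤ 0.51283 ^ 4 := by gcongr
  have hv3 : v ^ 3 ≤ 0.51283 ^ 3 := by gcongr
  have hv6 : v ^ 2 ≤ 0.51283 ^ 2 := by gcongr
  have c0 : μ * (1 - μ) * v ^ 4 ≤ 0.25 * 0.51283 ^ 4 := by gcongr
  have c3 : μ * (1 - μ) * (1 - 2 * μ) * v ^ 6 ≤ 0.00455 * (1 - 2 * μ) := by
    have : μ * (1 - μ) * v ^ 4 * v ^ 2 ≤ 0.25 * 0.51283 ^ 4 * 0.51283 ^ 2 := by gcongr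
    rw [e3]
    nlinarith only [mul_le_mul_of_nonneg_left this (by linarith only [hμ'] : 0 ≤ 1 - 2 * μ), hμ']
  have c4 : μ * (1 - μ) * (1 - 3 * (μ * (1 - μ))) * v ^ 8 ≤ 0.00031 := by
    rw [e4]
    have : μ * (1 - μ) * v ^ 4 * (1 - 3 * (μ * (1 - μ))) * (v ^ 2) ^ 2
        ≤ 0.25 * 0.51283 ^ 4 * 0.2575 * (0.51283 ^ 2) ^ 2 := by gcongr
    exact this.trans (by norm_num)
  have c7 : μ * (1 - μ) * v ^ 7 ≤ 0.25 * 0.51283 ^ 4 * 0.51283 ^ 3 := by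
    rw [e7]
    gcongr
  have hl2 := angular_momentum_lower_bound (S := polS (v ^ 3) z y (potU μ (v ^ 2) C z)) hε.le
    (hv3.trans (by norm_num)) hzp hz2 np k3p k4p
    (by nlinarith only [hC.1, hC.2] : (3 * C ^ 2 - 1) / 2 ≤ 1)
    (abs_le.1 (abs_legendre_three_le hC.1 hC.2)).2 hUz hLe hS
  generalize polL (v ^ 3) z y (potU μ (v ^ 2) C z) = l at *
  have d1 : 0.98975 - 0.0257 * (1 - 2 * μ) ≤ z := by
    norm_num at c7
    linarith only [hz0, c3, c4, c7, hμ']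
  have d2 : 0.9971 - 0.0008 * (1 - 2 * μ) ≤ l := by
    norm_num at c0
    linarith only [hl2, c0, c3, c4, hμ']
  have d3 : 0.98685 - 0.0267 * (1 - 2 * μ) ≤ l * z := by
    nlinarith only [mul_le_mul d2 d1 (by linarith only [hμ]) (by linarith only [hl1]), hμ, hμ']
  have d4 : 0.50725 * (0.98685 - 0.0267 * (1 - 2 * μ)) ≤ v * (l * z) :=
    mul_le_mul hv d3 (by linarith only [hμ]) hvp.le
  linarith only [d4, hμ']

theorem exists_direct_orbit_small {μ v : ℝ} (hμ : 0.45 ≤ μ) (hμ' : μ ≤ 1 / 2) (hv : 0.50725 ≤ v)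
    (h1 : v ^ 3 ≤ 0.16) (ht : (1 - μ) * 1.11 * v ^ 2 ≤ 2 / 5)
    (hn : μ * (1 - μ) * v ^ 4 ≤ 0.0215) (hk3 : μ * (1 - μ) * (1 - 2 * μ) * v ^ 6 ≤ 0.00065)
    (hk4 : μ * (1 - μ) * (1 - 3 * (μ * (1 - μ))) * v ^ 8 ≤ 0.0005)
    (hW1 : 0.0036 + 5.63 * (μ * (1 - μ) * (1 - 2 * μ) * v ^ 6)
        + 5.3 * (μ * (1 - μ) * (1 - 3 * (μ * (1 - μ))) * v ^ 8)
        + 2.13 * (μ * (1 - μ) * v ^ 7) ≤ 0.03)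
    (hW0 : 1.95 * (μ * (1 - μ) * v ^ 4) + 5.63 * (μ * (1 - μ) * (1 - 2 * μ) * v ^ 6)
        + 14 * (μ * (1 - μ) * (1 - 3 * (μ * (1 - μ))) * v ^ 8)
        + 2.13 * (μ * (1 - μ) * v ^ 7) ≤ 0.08)
    (hW2 : 0.0036 + 1.95 * (μ * (1 - μ) * v ^ 4) + 11.26 * (μ * (1 - μ) * (1 - 2 * μ) * v ^ 6)
        + 19.3 * (μ * (1 - μ) * (1 - 3 * (μ * (1 - μ))) * v ^ 8)
        + 4.5 * (μ * (1 - μ) * v ^ 7) ≤ 0.1) :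
    HasDirectOrbit μ (1 / v + v ^ 2 / 2) := by
  have hvp : 0 < v := by linarith
  have h0 : 0.13 ≤ v ^ 3 := le_trans (by norm_num) (pow_le_pow_left₀ (by norm_num) hv 3)
  have hμ0 : 0 ≤ μ := by linarith
  have hm : 0 ≤ μ * (1 - μ) := mul_nonneg hμ0 (by linarith)
  have hm' : 0 ≤ 1 - 3 * (μ * (1 - μ)) := by nlinarith only [sq_nonneg (1 - 2 * μ)]
  have np : 0 ≤ μ * (1 - μ) * v ^ 4 := by positivity
  have n7 : 0 ≤ μ * (1 - μ) * v ^ 7 := by positivity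
  have k3p : 0 ≤ μ * (1 - μ) * (1 - 2 * μ) * v ^ 6 :=
    mul_nonneg (mul_nonneg hm (by linarith)) (by positivity)
  have k4p : 0 ≤ μ * (1 - μ) * (1 - 3 * (μ * (1 - μ))) * v ^ 8 := by positivity
  have ht' : (1 - μ) * 1.08 * v ^ 2 ≤ 2 / 5 := le_trans (by gcongr <;> norm_num; linarith) ht
  obtain ⟨T, γ, hT, hγ, hper, hE, hR, hcard, hnd, hloc⟩ := exists_nondegenerate_orbit
    (A := 0.03) (B := 0.08) (Y := 0.1) hμ0 hμ' hvp h0 (h1.trans (by norm_num)) ht hn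
    (hk3.trans (by norm_num)) (hk4.trans (by norm_num)) (by norm_num) (by norm_num)
    (by norm_num) (by norm_num) (by norm_num) (by norm_num)
    (fun C hC z hz y hy => (small_box_bounds hμ0 hμ' h0 h1 ht' hn hk3 hk4 hC hz
      (by norm_num at hy ⊢; exact hy)).2.2)
    (by positivity) (by positivity) hW1 hW0 (by linarith only [hW2])
  refine ⟨T, γ, hT, hγ, hper, hE, hR, fun t => ?_, hcard, hnd⟩
  obtain ⟨C, σ, z, y, hCσ, hz0, hz1, hy, hx⟩ := hloc t
  have hz1' : z ≤ 1.08 := by linarith only [hz1, hW0]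
  have hzp : 0 < z := by linarith only [hz0, hW1]
  have hC : C ∈ Icc (-1 : ℝ) 1 :=
    ⟨by nlinarith only [hCσ, sq_nonneg σ], by nlinarith only [hCσ, sq_nonneg σ]⟩
  rw [hx]
  have hv1 : v ≤ 0.5429 := le_of_cube_le (by norm_num) h1 (by norm_num)
  have hv2 : v ^ 2 ≤ 0.5429 ^ 2 := by gcongr
  have hy2 : y ^ 2 ≤ 0.1 ^ 2 := sq_le_sq' (by linarith only [hy.1]) hy.2
  refine polarPoint_direct (R := 2.6) (δ := 0.00012) hμ0 hvp hzp hCσ (by norm_num) ?_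
    (by norm_num) (small_box_angular_momentum hμ hμ' hv h1 ht' hn hk3 hk4 hC hz0 hz1'
      (by norm_num at hy ⊢; exact hy)) ?_
  · have : v ^ 2 * z ≤ 0.5429 ^ 2 * 1.08 := by gcongr
    nlinarith only [this, hμ', hμ]
  · have : (v * y) ^ 2 ≤ 0.5429 ^ 2 * 0.1 ^ 2 := by
      rw [mul_pow]
      gcongr
    nlinarith only [this, hμ', hμ, sq_nonneg (v * y)]

theorem cell_bounds {μ a b v v₀ : ℝ} (hv : 0 ≤ v) (hvv : v ≤ v₀) (ha0 : 0 ≤ a) (ha : a ≤ μ)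
    (hb : μ ≤ b) (hb' : b ≤ 1 / 2) :
    μ * (1 - μ) * v ^ 4 ≤ b * (1 - b) * v₀ ^ 4 ∧
    μ * (1 - μ) * (1 - 2 * μ) * v ^ 6 ≤ b * (1 - b) * (1 - 2 * a) * v₀ ^ 6 ∧
    μ * (1 - μ) * (1 - 3 * (μ * (1 - μ))) * v ^ 8
      ≤ b * (1 - b) * (1 - 3 * (a * (1 - a))) * v₀ ^ 8 ∧
    μ * (1 - μ) * v ^ 7 ≤ b * (1 - b) * v₀ ^ 7 ∧
    (1 - μ) * 1.11 * v ^ 2 ≤ (1 - a) * 1.11 * v₀ ^ 2 := by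
  have h1 : μ * (1 - μ) ≤ b * (1 - b) := by nlinarith only [hb, hb']
  have h2 : a * (1 - a) ≤ μ * (1 - μ) := by nlinarith only [ha, hb, hb']
  have h3 : 0 ≤ μ * (1 - μ) := mul_nonneg (by linarith) (by linarith)
  have h4 : 0 ≤ 1 - 2 * μ := by linarith
  have h5 : 0 ≤ 1 - 3 * (μ * (1 - μ)) := by nlinarith only [sq_nonneg (1 - 2 * μ)]
  have h6 : 0 ≤ 1 - μ := by linarith
  have h7 : 0 ≤ b * (1 - b) := h3.trans h1
  have h8 : 0 ≤ 1 - 2 * a := by linarith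
  have h9 : 0 ≤ 1 - 3 * (a * (1 - a)) := by linarith
  have hc : 0 ≤ (1 - a) * 1.11 := mul_nonneg (by linarith) (by norm_num)
  exact ⟨by gcongr, by gcongr, by gcongr, by gcongr, by gcongr⟩

theorem hasDirectOrbit_of_large_cell {μ c a b a₀ v₀ : ℝ} (hμ : μ ∈ Icc (0.1 : ℝ) 0.5)
    (hc1 : firstCritEnergy μ ≤ c) (hc2 : c ≤ 2.1) (ha : a ≤ μ) (hb : μ ≤ b) (ha0 : 0 < a₀)
    (ha1 : a₀ < 1) (hv₀ : 0.51 ≤ v₀)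
    (hrt : a₀ - 1 / a₀ ^ 2 + (1 - a₀ - 1 / (1 - a₀) ^ 2) ≤ -2)
    (hEa : 1 / v₀ + v₀ ^ 2 / 2 ≤ (1 - a) * (a₀ ^ 2 / 2 + 1 / a₀)
      + a * ((1 - a₀) ^ 2 / 2 + 1 / (1 - a₀)) - a * (1 - a) / 2
      - ((1 - a) * (a₀ - 1 / a₀ ^ 2) - a * (1 - a₀ - 1 / (1 - a₀) ^ 2)) ^ 2 / 6)
    (hEb : 1 / v₀ + v₀ ^ 2 / 2 ≤ (1 - b) * (a₀ ^ 2 / 2 + 1 / a₀)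
      + b * ((1 - a₀) ^ 2 / 2 + 1 / (1 - a₀)) - b * (1 - b) / 2
      - ((1 - b) * (a₀ - 1 / a₀ ^ 2) - b * (1 - a₀ - 1 / (1 - a₀) ^ 2)) ^ 2 / 6)
    (ha' : 0 ≤ a) (hb' : b ≤ 0.45) (h1 : v₀ ^ 3 ≤ 0.2426)
    (ht : (1 - a) * 1.11 * v₀ ^ 2 ≤ 2 / 5) (hn : b * (1 - b) * v₀ ^ 4 ≤ 0.0215)
    (hk3 : b * (1 - b) * (1 - 2 * a) * v₀ ^ 6 ≤ 0.0046)
    (hk4 : b * (1 - b) * (1 - 3 * (a * (1 - a))) * v₀ ^ 8 ≤ 0.0017)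
    (hW1 : 0.0181 + 0.69 * (b * (1 - b) * v₀ ^ 4) + 6.66 * (b * (1 - b) * (1 - 2 * a) * v₀ ^ 6)
      + 6.4 * (b * (1 - b) * (1 - 3 * (a * (1 - a))) * v₀ ^ 8) + 2.13 * (b * (1 - b) * v₀ ^ 7)
      ≤ 0.08)
    (hW0 : 3.08 * (b * (1 - b) * v₀ ^ 4) + 6.66 * (b * (1 - b) * (1 - 2 * a) * v₀ ^ 6)
      + 16.62 * (b * (1 - b) * (1 - 3 * (a * (1 - a))) * v₀ ^ 8) + 2.13 * (b * (1 - b) * v₀ ^ 7)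
      ≤ 0.11)
    (hW2 : 0.0181 + 3.77 * (b * (1 - b) * v₀ ^ 4) + 13.32 * (b * (1 - b) * (1 - 2 * a) * v₀ ^ 6)
      + 23.02 * (b * (1 - b) * (1 - 3 * (a * (1 - a))) * v₀ ^ 8) + 4.5 * (b * (1 - b) * v₀ ^ 7)
      ≤ 0.185) : HasDirectOrbit μ c := by
  obtain ⟨v, hv, hvv, rfl⟩ := exists_parameter_of_cell hμ hc1 hc2 ha hb ha0 ha1 hv₀ hrt hEa hEb
  obtain ⟨bn, b3, b4, b7, bt⟩ := cell_bounds (by linarith) hvv (by linarith) ha hb (by linarith)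
  have bv : v ^ 3 ≤ v₀ ^ 3 := pow_le_pow_left₀ (by linarith) hvv 3
  exact exists_direct_orbit_large (by linarith) (by linarith) hv (bv.trans h1) (bt.trans ht)
    (bn.trans hn) (b3.trans hk3) (b4.trans hk4)
    (by linarith only [hW1, bn, b3, b4, b7]) (by linarith only [hW0, bn, b3, b4, b7])
    (by linarith only [hW2, bn, b3, b4, b7])

theorem hasDirectOrbit_of_small_cell {μ c a b a₀ v₀ : ℝ} (hμ : μ ∈ Icc (0.1 : ℝ) 0.5)
    (hc1 : firstCritEnergy μ ≤ c) (hc2 : c ≤ 2.1) (ha : a ≤ μ) (hb : μ ≤ b) (ha0 : 0 < a₀)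
    (ha1 : a₀ < 1) (hv₀ : 0.51 ≤ v₀)
    (hrt : a₀ - 1 / a₀ ^ 2 + (1 - a₀ - 1 / (1 - a₀) ^ 2) ≤ -2)
    (hEa : 1 / v₀ + v₀ ^ 2 / 2 ≤ (1 - a) * (a₀ ^ 2 / 2 + 1 / a₀)
      + a * ((1 - a₀) ^ 2 / 2 + 1 / (1 - a₀)) - a * (1 - a) / 2
      - ((1 - a) * (a₀ - 1 / a₀ ^ 2) - a * (1 - a₀ - 1 / (1 - a₀) ^ 2)) ^ 2 / 6)
    (hEb : 1 / v₀ + v₀ ^ 2 / 2 ≤ (1 - b) * (a₀ ^ 2 / 2 + 1 / a₀)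
      + b * ((1 - a₀) ^ 2 / 2 + 1 / (1 - a₀)) - b * (1 - b) / 2
      - ((1 - b) * (a₀ - 1 / a₀ ^ 2) - b * (1 - a₀ - 1 / (1 - a₀) ^ 2)) ^ 2 / 6)
    (ha' : 0.45 ≤ a) (hb' : b ≤ 1 / 2) (h1 : v₀ ^ 3 ≤ 0.16)
    (ht : (1 - a) * 1.11 * v₀ ^ 2 ≤ 2 / 5) (hn : b * (1 - b) * v₀ ^ 4 ≤ 0.0215)
    (hk3 : b * (1 - b) * (1 - 2 * a) * v₀ ^ 6 ≤ 0.00065)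
    (hk4 : b * (1 - b) * (1 - 3 * (a * (1 - a))) * v₀ ^ 8 ≤ 0.0005)
    (hW1 : 0.0036 + 5.63 * (b * (1 - b) * (1 - 2 * a) * v₀ ^ 6)
      + 5.3 * (b * (1 - b) * (1 - 3 * (a * (1 - a))) * v₀ ^ 8) + 2.13 * (b * (1 - b) * v₀ ^ 7)
      ≤ 0.03)
    (hW0 : 1.95 * (b * (1 - b) * v₀ ^ 4) + 5.63 * (b * (1 - b) * (1 - 2 * a) * v₀ ^ 6)
      + 14 * (b * (1 - b) * (1 - 3 * (a * (1 - a))) * v₀ ^ 8) + 2.13 * (b * (1 - b) * v₀ ^ 7)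
      ≤ 0.08)
    (hW2 : 0.0036 + 1.95 * (b * (1 - b) * v₀ ^ 4) + 11.26 * (b * (1 - b) * (1 - 2 * a) * v₀ ^ 6)
      + 19.3 * (b * (1 - b) * (1 - 3 * (a * (1 - a))) * v₀ ^ 8) + 4.5 * (b * (1 - b) * v₀ ^ 7)
      ≤ 0.1) : HasDirectOrbit μ c := by
  obtain ⟨v, hv, hvv, rfl⟩ := exists_parameter_of_cell hμ hc1 hc2 ha hb ha0 ha1 hv₀ hrt hEa hEb
  obtain ⟨bn, b3, b4, b7, bt⟩ := cell_bounds (by linarith) hvv (by linarith) ha hb (by linarith)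
  have bv : v ^ 3 ≤ v₀ ^ 3 := pow_le_pow_left₀ (by linarith) hvv 3
  exact exists_direct_orbit_small (by linarith) (by linarith) hv (bv.trans h1) (bt.trans ht)
    (bn.trans hn) (b3.trans hk3) (b4.trans hk4)
    (by linarith only [hW1, bn, b3, b4, b7]) (by linarith only [hW0, bn, b3, b4, b7])
    (by linarith only [hW2, bn, b3, b4, b7])

theorem hasDirectOrbit {μ c : ℝ} (hμ : μ ∈ Icc (0.1 : ℝ) 0.5) (hc1 : firstCritEnergy μ ≤ c)
    (hc2 : c ≤ 2.1) : HasDirectOrbit μ c := by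
  rcases le_total μ 0.107 with h' | h'
  · apply hasDirectOrbit_of_large_cell (a := 0.1) (b := 0.107) (a₀ := 0.706) (v₀ := 0.6235)
      hμ hc1 hc2 hμ.1 h' <;> norm_num
  have h := h'
  rcases le_total μ 0.114 with h' | h'
  · apply hasDirectOrbit_of_large_cell (a := 0.107) (b := 0.114) (a₀ := 0.7) (v₀ := 0.6186)
      hμ hc1 hc2 h h' <;> norm_num
  replace h := h'
  rcases le_total μ 0.1215 with h' | h'
  · apply hasDirectOrbit_of_large_cell (a := 0.114) (b := 0.1215) (a₀ := 0.694) (v₀ := 0.6141)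
      hμ hc1 hc2 h h' <;> norm_num
  replace h := h'
  rcases le_total μ 0.1295 with h' | h'
  · apply hasDirectOrbit_of_large_cell (a := 0.1215) (b := 0.1295) (a₀ := 0.688) (v₀ := 0.6095)
      hμ hc1 hc2 h h' <;> norm_num
  replace h := h'
  rcases le_total μ 0.1385 with h' | h'
  · apply hasDirectOrbit_of_large_cell (a := 0.1295) (b := 0.1385) (a₀ := 0.681) (v₀ := 0.6051)
      hμ hc1 hc2 h h' <;> norm_num
  replace h := h'
  rcases le_total μ 0.1485 with h' | h'
  · apply hasDirectOrbit_of_large_cell (a := 0.1385) (b := 0.1485) (a₀ := 0.674) (v₀ := 0.6004)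
      hμ hc1 hc2 h h' <;> norm_num
  replace h := h'
  rcases le_total μ 0.16 with h' | h'
  · apply hasDirectOrbit_of_large_cell (a := 0.1485) (b := 0.16) (a₀ := 0.667) (v₀ := 0.5956)
      hμ hc1 hc2 h h' <;> norm_num
  replace h := h'
  rcases le_total μ 0.173 with h' | h'
  · apply hasDirectOrbit_of_large_cell (a := 0.16) (b := 0.173) (a₀ := 0.659) (v₀ := 0.5906)
      hμ hc1 hc2 h h' <;> norm_num
  replace h := h'
  rcases le_total μ 0.1885 with h' | h'
  · apply hasDirectOrbit_of_large_cell (a := 0.173) (b := 0.1885) (a₀ := 0.65) (v₀ := 0.5854)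
      hμ hc1 hc2 h h' <;> norm_num
  replace h := h'
  rcases le_total μ 0.207 with h' | h'
  · apply hasDirectOrbit_of_large_cell (a := 0.1885) (b := 0.207) (a₀ := 0.639) (v₀ := 0.5801)
      hμ hc1 hc2 h h' <;> norm_num
  replace h := h'
  rcases le_total μ 0.2305 with h' | h'
  · apply hasDirectOrbit_of_large_cell (a := 0.207) (b := 0.2305) (a₀ := 0.627) (v₀ := 0.5744)
      hμ hc1 hc2 h h' <;> norm_num
  replace h := h'
  rcases le_total μ 0.2625 with h' | h'
  · apply hasDirectOrbit_of_large_cell (a := 0.2305) (b := 0.2625) (a₀ := 0.613) (v₀ := 0.5682)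
      hμ hc1 hc2 h h' <;> norm_num
  replace h := h'
  rcases le_total μ 0.3105 with h' | h'
  · apply hasDirectOrbit_of_large_cell (a := 0.2625) (b := 0.3105) (a₀ := 0.593) (v₀ := 0.5619)
      hμ hc1 hc2 h h' <;> norm_num
  replace h := h'
  rcases le_total μ 0.356 with h' | h'
  · apply hasDirectOrbit_of_large_cell (a := 0.3105) (b := 0.356) (a₀ := 0.571) (v₀ := 0.5533)
      hμ hc1 hc2 h h' <;> norm_num
  replace h := h'
  rcases le_total μ 0.3975 with h' | h'
  · apply hasDirectOrbit_of_large_cell (a := 0.356) (b := 0.3975) (a₀ := 0.552) (v₀ := 0.5473)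
      hμ hc1 hc2 h h' <;> norm_num
  replace h := h'
  rcases le_total μ 0.436 with h' | h'
  · apply hasDirectOrbit_of_large_cell (a := 0.3975) (b := 0.436) (a₀ := 0.535) (v₀ := 0.5435)
      hμ hc1 hc2 h h' <;> norm_num
  replace h := h'
  rcases le_total μ 0.45 with h' | h'
  · apply hasDirectOrbit_of_large_cell (a := 0.436) (b := 0.45) (a₀ := 0.524) (v₀ := 0.5407)
      hμ hc1 hc2 h h' <;> norm_num
  replace h := h'
  rcases le_total μ 0.499 with h' | h'
  · apply hasDirectOrbit_of_small_cell (a := 0.45) (b := 0.499) (a₀ := 0.511) (v₀ := 0.5413)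
      hμ hc1 hc2 h h' <;> norm_num
  replace h := h'
  apply hasDirectOrbit_of_small_cell (a := 0.499) (b := 0.5) (a₀ := 0.5) (v₀ := 0.5392)
      hμ hc1 hc2 h hμ.2 <;> norm_num

/-- For every `μ ∈ [0.1, 0.5]` and every Jacobi energy `c` between the first
critical energy `c₁(μ)` and `2.1`, there is a symmetric periodic orbit of the Jacobi
Hamiltonian on the level set `H⁻¹(-c)` which is direct, crosses the `q₁`-axis exactly
twice per period, and is transversely non-degenerate. -/
theorem statement6 (μ c : ℝ) (hμ : μ ∈ Set.Icc (0.1:ℝ) 0.5)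
    (hc1 : firstCritEnergy μ ≤ c) (hc2 : c ≤ 2.1) :
    ∃ (T : ℝ) (γ : ℝ → V4),
      0 < T ∧
      IsOrbit (JacobiH μ) (JacobiDom μ) γ ∧
      (∀ t, γ (t + T) = γ t) ∧
      (∀ t, JacobiH μ (γ t) = -c) ∧
      (∀ t, γ t = Rplus (γ (T - t))) ∧
      (∀ t : ℝ, (γ t 0 + μ) * γ t 3 - γ t 1 * γ t 2 < μ * (γ t 0 + μ)) ∧
      ({t ∈ Set.Ico (0:ℝ) T | γ t 1 = 0}.ncard = 2) ∧
      TransverseNondeg (JacobiH μ) T γ := by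
  exact hasDirectOrbit hμ hc1 hc2
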